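/- For every ε > 0 there exist δ > 0 and a positive integer N such that for all n ≥ N the following holds. Suppose G and G′ are simple graphs, each on n vertices, each with independence number at most δn, each admitting a partition of its edge set into a part with no clique on 3 vertices and a part with no clique on 7 vertices, and each having at least (7/16 − δ)·n² edges. Then there is a bijection σ from V(G) to V(G′) such that the symmetric difference of E(G′) and the image of E(G) under σ has size at most ε·n². -/

import Mathlib

structure RCfg {V : Type*} (r h : V → V → Prop) (A : Finset V) (q : ℕ) : Prop where
  rsymm : ∀ a b, r a b → r b a
  hsymm : ∀ a b, h a b → h b a
  rirr : ∀ a, ¬ r a a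
  hirr : ∀ a, ¬ h a a
  notri : ∀ a ∈ A, ∀ b ∈ A, ∀ c ∈ A, r a b → r b c → r a c → False
  clq : ∀ S T : Finset V, T ⊆ S → S ⊆ A → (∀ a ∈ S, ∀ b ∈ S, ¬ r a b) →
    (∀ a ∈ T, ∀ b ∈ T, ¬ h a b) → S.card + T.card ≤ q

open Finset

section ramsey
variable {V : Type*} (r : V → V → Prop)

def RamseyHas (n t : ℕ) : Prop :=
  ∀ J : Finset V, (∀ a ∈ J, ∀ b ∈ J, ∀ c ∈ J, r a b → r b c → r a c → False) → n ≤ J.card →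
    ∃ S ⊆ J, S.card = t ∧ ∀ a ∈ S, ∀ b ∈ S, ¬ r a b

variable {r}
lemma blue_of_nbhd (_rsymm : ∀ a b, r a b → r b a) {J : Finset V}
    (hJ : ∀ a ∈ J, ∀ b ∈ J, ∀ c ∈ J, r a b → r b c → r a c → False) {v : V} (hv : v ∈ J)
    {S : Finset V} (hS : S ⊆ J) (hr : ∀ a ∈ S, r v a) : ∀ a ∈ S, ∀ b ∈ S, ¬ r a b := by
  intro a ha b hb hab
  exact hJ v hv a (hS ha) b (hS hb) (hr a ha) hab (hr b hb)

lemma blue_insert [DecidableEq V] (rsymm : ∀ a b, r a b → r b a) (rirr : ∀ a, ¬ r a a)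
    {S : Finset V} (hS : ∀ a ∈ S, ∀ b ∈ S, ¬ r a b) {v : V} (hv : ∀ a ∈ S, ¬ r v a) :
    ∀ a ∈ insert v S, ∀ b ∈ insert v S, ¬ r a b := by
  intro a ha b hb
  rw [mem_insert] at ha hb
  rcases ha with rfl | ha <;> rcases hb with rfl | hb
  · exact rirr _
  · exact hv b hb
  · exact fun h => hv a ha (rsymm _ _ h)
  · exact hS a ha b hb

lemma ramsey_one (rirr : ∀ a, ¬ r a a) : RamseyHas r 1 1 := by
  intro J _ hc
  obtain ⟨v, hv⟩ := card_pos.mp hc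
  exact ⟨{v}, by simpa using hv, by simp, by simpa using rirr v⟩

lemma ramsey_step (rsymm : ∀ a b, r a b → r b a) (rirr : ∀ a, ¬ r a a) {n t : ℕ}
    (H : RamseyHas r n t) : RamseyHas r (n + t + 1) (t + 1) := by
  classical
  intro J hJ hc
  obtain ⟨v, hv⟩ := card_pos.mp (show 0 < J.card by omega)
  by_cases hd : t + 1 ≤ (J.filter (fun a => r v a)).card
  · obtain ⟨S, hS, hSc⟩ := exists_subset_card_eq hd
    refine ⟨S, hS.trans (filter_subset _ _), hSc, ?_⟩
    exact blue_of_nbhd rsymm hJ hv (hS.trans (filter_subset _ _))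
      (fun a ha => (mem_filter.mp (hS ha)).2)
  · have h1 := card_filter_add_card_filter_not (s := J) (fun a => r v a)
    have h2 : ((J.filter (fun a => ¬ r v a)).erase v).card + 1 = (J.filter (fun a => ¬ r v a)).card :=
      card_erase_add_one (mem_filter.mpr ⟨hv, rirr v⟩)
    obtain ⟨S, hS, hSc, hSb⟩ := H ((J.filter (fun a => ¬ r v a)).erase v)
      (fun a ha b hb c hc => hJ a (mem_filter.mp (mem_of_mem_erase ha)).1 b
        (mem_filter.mp (mem_of_mem_erase hb)).1 c (mem_filter.mp (mem_of_mem_erase hc)).1) (by omega)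
    refine ⟨insert v S, ?_, ?_, ?_⟩
    · intro a ha
      rcases mem_insert.mp ha with rfl | ha
      · exact hv
      · exact (mem_filter.mp (mem_of_mem_erase (hS ha))).1
    · rw [card_insert_of_notMem, hSc]
      intro h; exact (ne_of_mem_erase (hS h)) rfl
    · exact blue_insert rsymm rirr hSb (fun a ha => (mem_filter.mp (mem_of_mem_erase (hS ha))).2)

lemma ramsey_two (rsymm : ∀ a b, r a b → r b a) (rirr : ∀ a, ¬ r a a) : RamseyHas r 3 2 :=
  ramsey_step rsymm rirr (ramsey_one rirr)

lemma ramsey_three (rsymm : ∀ a b, r a b → r b a) (rirr : ∀ a, ¬ r a a) : RamseyHas r 6 3 :=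
  ramsey_step rsymm rirr (ramsey_two rsymm rirr)

lemma ramsey_four (rsymm : ∀ a b, r a b → r b a) (rirr : ∀ a, ¬ r a a) : RamseyHas r 9 4 := by
  classical
  intro J0 hJ0 hc0
  obtain ⟨J, hJJ, hc⟩ := exists_subset_card_eq hc0
  have hJ : ∀ a ∈ J, ∀ b ∈ J, ∀ c ∈ J, r a b → r b c → r a c → False :=
    fun a ha b hb c hc => hJ0 a (hJJ ha) b (hJJ hb) c (hJJ hc)
  suffices ∃ S ⊆ J, S.card = 4 ∧ ∀ a ∈ S, ∀ b ∈ S, ¬ r a b by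
    obtain ⟨S, h1, h2⟩ := this
    exact ⟨S, h1.trans hJJ, h2⟩
  by_contra hno
  have hdeg : ∀ v ∈ J, (J.filter (fun a => r v a)).card = 3 := by
    intro v hv
    have h1 := card_filter_add_card_filter_not (s := J) (fun a => r v a)
    have h2 : ((J.filter (fun a => ¬ r v a)).erase v).card + 1 = (J.filter (fun a => ¬ r v a)).card :=
      card_erase_add_one (mem_filter.mpr ⟨hv, rirr v⟩)
    have h3 : (J.filter (fun a => r v a)).card < 4 := by
      by_contra hd
      push Not at hd
      obtain ⟨S, hS, hSc⟩ := exists_subset_card_eq hd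
      exact hno ⟨S, hS.trans (filter_subset _ _), hSc, blue_of_nbhd rsymm hJ hv (hS.trans (filter_subset _ _))
        (fun a ha => (mem_filter.mp (hS ha)).2)⟩
    have h4 : ((J.filter (fun a => ¬ r v a)).erase v).card < 6 := by
      by_contra hd
      push Not at hd
      obtain ⟨S, hS, hSc, hSb⟩ := ramsey_three rsymm rirr ((J.filter (fun a => ¬ r v a)).erase v)
        (fun a ha b hb c hc => hJ a (mem_filter.mp (mem_of_mem_erase ha)).1 b
        (mem_filter.mp (mem_of_mem_erase hb)).1 c (mem_filter.mp (mem_of_mem_erase hc)).1) hd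
      refine hno ⟨insert v S, ?_, ?_, ?_⟩
      · intro a ha
        rcases mem_insert.mp ha with rfl | ha
        · exact hv
        · exact (mem_filter.mp (mem_of_mem_erase (hS ha))).1
      · rw [card_insert_of_notMem, hSc]
        intro h; exact (ne_of_mem_erase (hS h)) rfl
      · exact blue_insert rsymm rirr hSb (fun a ha => (mem_filter.mp (mem_of_mem_erase (hS ha))).2)
    omega
  let G : SimpleGraph J := ⟨fun a b => r a b, ⟨fun a b h => rsymm _ _ h⟩, ⟨fun a => rirr _⟩⟩
  have hG : ∀ v : J, G.degree v = 3 := by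
    intro v
    rw [← hdeg v v.2, ← SimpleGraph.card_neighborFinset_eq_degree]
    have : (G.neighborFinset v).map (Function.Embedding.subtype _) = J.filter (fun a => r v a) := by
      ext a
      simp [G, and_comm]
    rw [← this, card_map]
  have := G.even_card_odd_degree_vertices
  simp only [hG] at this
  have h9 : (univ.filter (fun _ : J => Odd 3)).card = 9 := by
    rw [filter_true_of_mem (fun _ _ => by decide)]
    simp [hc]
  rw [h9] at this
  exact absurd this (by decide)

lemma ramsey_six (rsymm : ∀ a b, r a b → r b a) (rirr : ∀ a, ¬ r a a) : RamseyHas r 20 6 :=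
  ramsey_step rsymm rirr (ramsey_step rsymm rirr (ramsey_four rsymm rirr))
end ramsey

open Finset

section cfg
variable {V : Type*} {r h : V → V → Prop} {A : Finset V} {q : ℕ}

lemma RCfg.mono (C : RCfg r h A q) {B : Finset V} (hB : B ⊆ A) : RCfg r h B q :=
  ⟨C.rsymm, C.hsymm, C.rirr, C.hirr,
    fun a ha b hb c hc => C.notri a (hB ha) b (hB hb) c (hB hc),
    fun S T hT hS => C.clq S T hT (hS.trans hB)⟩

/-- pull back along an injection, enlarging the half relation -/
lemma RCfg.pull {W : Type*} [Fintype W] (C : RCfg r h A q) (e : W → V) (he : Function.Injective e)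
    (heA : ∀ w, e w ∈ A) (hp : W → W → Prop) (hps : ∀ a b, hp a b → hp b a) (hpi : ∀ a, ¬ hp a a)
    (hle : ∀ a b, h (e a) (e b) → hp a b) :
    RCfg (fun a b => r (e a) (e b)) hp univ q := by
  refine ⟨fun a b => C.rsymm _ _, hps, fun a => C.rirr _, hpi,
    fun a _ b _ c _ => C.notri _ (heA _) _ (heA _) _ (heA _), ?_⟩
  intro S T hT _ hS hTh
  have := C.clq (S.map ⟨e, he⟩) (T.map ⟨e, he⟩) (map_subset_map.mpr hT) ?_ ?_ ?_
  · simpa using this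
  · intro a ha
    obtain ⟨b, _, rfl⟩ := mem_map.mp ha
    exact heA b
  · intro a ha b hb
    obtain ⟨a, ha', rfl⟩ := mem_map.mp ha
    obtain ⟨b, hb', rfl⟩ := mem_map.mp hb
    exact hS a ha' b hb'
  · intro a ha b hb hab
    obtain ⟨a, ha', rfl⟩ := mem_map.mp ha
    obtain ⟨b, hb', rfl⟩ := mem_map.mp hb
    exact hTh a ha' b hb' (hle _ _ hab)

/-- no blue K₄ with a full triangle -/
lemma RCfg.a4 [DecidableEq V] (C : RCfg r h A 6) {a b c d : V} (ha : a ∈ A) (hb : b ∈ A) (hc : c ∈ A) (hd : d ∈ A)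
    (hab : a ≠ b) (hac : a ≠ c) (had : a ≠ d) (hbc : b ≠ c) (hbd : b ≠ d) (hcd : c ≠ d)
    (h1 : ¬ r a b) (h2 : ¬ r a c) (h3 : ¬ r a d) (h4 : ¬ r b c) (h5 : ¬ r b d) (h6 : ¬ r c d)
    (n1 : ¬ h a b) (n2 : ¬ h a c) (n3 : ¬ h b c) : False := by
  have s := C.rsymm
  have t := C.hsymm
  have i := C.rirr
  have j := C.hirr
  have := C.clq {a, b, c, d} {a, b, c} (by intro x; simp; tauto) (by
    intro x hx; simp at hx; rcases hx with rfl | rfl | rfl | rfl <;> assumption) (by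
    have := blue_insert s i (blue_insert s i (blue_insert s i (S := {d}) (by simpa using i d)
      (v := c) (by simpa using h6)) (v := b) (by simp; tauto)) (v := a) (by simp; tauto)
    exact this) (by
    have := blue_insert t j (blue_insert t j (S := {c}) (by simpa using j c)
      (v := b) (by simp; tauto)) (v := a) (by simp; tauto)
    exact this)
  rw [card_eq_of_equiv_fin (n := 4), card_eq_of_equiv_fin (n := 3)] at this
  · omega
  · exact (Finset.equivFinOfCardEq (by rw [card_insert_of_notMem, card_insert_of_notMem, card_singleton] <;> simp <;> tauto))
  · exact (Finset.equivFinOfCardEq (by rw [card_insert_of_notMem, card_insert_of_notMem, card_insert_of_notMem, card_singleton] <;> simp <;> tauto))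

end cfg

/-- the pattern of possible half edges on ten vertices:
0,1,2,3 = K (two pairs), 4,5,6,7 = two further pairs, 8, 9 = isolated -/
def hpS (i j : Fin 10) : Prop :=
  (i, j) ∈ ([(0,1),(1,0),(2,3),(3,2),(4,5),(5,4),(6,7),(7,6),(5,7),(7,5),(1,5),(5,1)] : List (Fin 10 × Fin 10))

instance : DecidableRel hpS := fun i j => by unfold hpS; infer_instance

section stage
variable {r : Fin 10 → Fin 10 → Prop}

lemma st4 (C : RCfg r hpS univ 6) (a b c d : Fin 10) (hab : (a ≠ b ∧ a ≠ c ∧ a ≠ d ∧ b ≠ c ∧ b ≠ d ∧ c ≠ d) ∧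
    (¬ hpS a b ∧ ¬ hpS a c ∧ ¬ hpS b c))
    (h1 : ¬ r a b) (h2 : ¬ r a c) (h3 : ¬ r a d) (h4 : ¬ r b c) (h5 : ¬ r b d) (h6 : ¬ r c d) : False := by
  obtain ⟨⟨i1, i2, i3, i4, i5, i6⟩, j1, j2, j3⟩ := hab
  exact C.a4 (mem_univ a) (mem_univ b) (mem_univ c) (mem_univ d) i1 i2 i3 i4 i5 i6 h1 h2 h3 h4 h5 h6 j1 j2 j3

lemma st3 (C : RCfg r hpS univ 6) (hK : ∀ x y : Fin 10, x < 4 → y < 4 → ¬ r x y) (v x y z : Fin 10)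
    (hv : 4 ≤ v) (hx : x < 4) (hy : y < 4) (hz : z < 4) (hxy : x ≠ y) (hxz : x ≠ z) (hyz : y ≠ z)
    (h1 : ¬ hpS v x) (h2 : ¬ hpS v y) (h3 : ¬ hpS x y) : r v x ∨ r v y ∨ r v z := by
  by_contra hc
  push Not at hc
  exact st4 C v x y z ⟨⟨by omega, by omega, by omega, hxy, hxz, hyz⟩, h1, h2, h3⟩ hc.1 hc.2.1 hc.2.2
    (hK _ _ hx hy) (hK _ _ hx hz) (hK _ _ hy hz)

lemma st3' (C : RCfg r hpS univ 6) (hK : ∀ x y : Fin 10, x < 4 → y < 4 → ¬ r x y) (v x y z : Fin 10)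
    (hv : 4 ≤ v) (hv5 : v ≠ 5) (hx : x < 4) (hy : y < 4) (hz : z < 4) (hxy : x ≠ y) (hxz : x ≠ z) (hyz : y ≠ z) :
    r v x ∨ r v y ∨ r v z := by
  have hn : ∀ v x : Fin 10, 4 ≤ v → v ≠ 5 → x < 4 → ¬ hpS v x := by decide
  have hn2 : ∀ x : Fin 10, x < 4 → ∀ y : Fin 10, y < 4 → ∀ z : Fin 10, z < 4 → x ≠ y → x ≠ z → y ≠ z →
      ¬ hpS x y ∨ ¬ hpS x z := by decide
  rcases hn2 x hx y hy z hz hxy hxz hyz with h | h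
  · exact st3 C hK v x y z hv hx hy hz hxy hxz hyz (hn _ _ hv hv5 hx) (hn _ _ hv hv5 hy) h
  · have := st3 C hK v x z y hv hx hz hy hxz hxy hyz.symm (hn _ _ hv hv5 hx) (hn _ _ hv hv5 hz) h
    tauto

lemma st_share (C : RCfg r hpS univ 6) (hK : ∀ x y : Fin 10, x < 4 → y < 4 → ¬ r x y) (u v v' : Fin 10)
    (hu : u < 4) (hv : 4 ≤ v) (hv' : 4 ≤ v') (hv5 : v ≠ 5) (hv5' : v' ≠ 5) (hr : r v v')
    (h1 : ¬ r v u) (h2 : ¬ r v' u) : False := by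
  have key : ∀ x, ¬ (r v x ∧ r v' x) := fun x hx =>
    C.notri v (mem_univ _) v' (mem_univ _) x (mem_univ _) hr hx.2 hx.1
  have hx : ∃ x y z : Fin 10, x < 4 ∧ y < 4 ∧ z < 4 ∧ x ≠ y ∧ x ≠ z ∧ y ≠ z ∧ u ≠ x ∧ u ≠ y ∧ u ≠ z := by
    have : ∀ u : Fin 10, u < 4 → ∃ x y z : Fin 10, x < 4 ∧ y < 4 ∧ z < 4 ∧ x ≠ y ∧ x ≠ z ∧ y ≠ z ∧ u ≠ x ∧ u ≠ y ∧ u ≠ z := by decide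
    exact this u hu
  obtain ⟨x, y, z, hx, hy, hz, hxy, hxz, hyz, hux, huy, huz⟩ := hx
  have a1 := st3' C hK v u x y hv hv5 hu hx hy hux huy hxy
  have a2 := st3' C hK v u x z hv hv5 hu hx hz hux huz hxz
  have a3 := st3' C hK v u y z hv hv5 hu hy hz huy huz hyz
  have b1 := st3' C hK v' u x y hv' hv5' hu hx hy hux huy hxy
  have b2 := st3' C hK v' u x z hv' hv5' hu hx hz hux huz hxz
  have b3 := st3' C hK v' u y z hv' hv5' hu hy hz huy huz hyz
  have k1 := key x
  have k2 := key y
  have k3 := key z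
  clear hK key
  generalize r v u = p0 at *
  generalize r v' u = p1 at *
  generalize r v x = p2 at *
  generalize r v' x = p3 at *
  generalize r v y = p4 at *
  generalize r v' y = p5 at *
  generalize r v z = p6 at *
  generalize r v' z = p7 at *
  clear hu hv hv' hv5 hv5' hr hx hy hz hxy hxz hyz hux huy huz C
  grind

lemma st_redpair (C : RCfg r hpS univ 6) (u w : Fin 10)
    (hu : u < 4) (hu1 : u ≠ 1) (hw : 8 ≤ w) (hr : r w u) :
    ∃ v v' : Fin 10, 4 ≤ v ∧ 4 ≤ v' ∧ v ≠ w ∧ v' ≠ w ∧ v ≠ v' ∧ r v v' ∧ ¬ r u v ∧ ¬ r u v' := by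
  classical
  have hn : ∀ w v : Fin 10, 8 ≤ w → ¬ hpS w v := by decide
  have hn2 : ∀ u v : Fin 10, u < 4 → u ≠ 1 → 4 ≤ v → ¬ hpS u v := by decide
  have hn3 : ∀ a : Fin 10, 4 ≤ a → ∀ b : Fin 10, 4 ≤ b → ∀ c : Fin 10, 4 ≤ c →
     ¬ hpS a b ∨ ¬ hpS a c ∨ ¬ hpS b c := by decide
  set W : Finset (Fin 10) := univ.filter (fun x => 4 ≤ x ∧ x ≠ w) with hW
  have hWc : W.card = 5 := by
    have : ∀ w : Fin 10, 8 ≤ w → (univ.filter (fun x : Fin 10 => 4 ≤ x ∧ x ≠ w)).card = 5 := by decide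
    exact this w hw
  have hWm : ∀ x ∈ W, 4 ≤ x ∧ x ≠ w := fun x hx => (mem_filter.mp hx).2
  have s := C.rsymm
  have hred : (W.filter (fun x => r u x)).card ≤ 2 := by
    by_contra hc
    push Not at hc
    obtain ⟨a, ha, b, hb, c, hc, hab, hac, hbc⟩ := two_lt_card.mp hc
    rw [mem_filter] at ha hb hc
    obtain ⟨ha4, haw⟩ := hWm a ha.1
    obtain ⟨hb4, hbw⟩ := hWm b hb.1
    obtain ⟨hc4, hcw⟩ := hWm c hc.1
    have nr : ∀ x y, r u x → r u y → ¬ r x y := fun x y h1 h2 h3 =>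
      C.notri u (mem_univ _) x (mem_univ _) y (mem_univ _) h1 h3 h2
    have hru := s _ _ hr
    have n1 := nr _ _ hru ha.2
    have n2 := nr _ _ hru hb.2
    have n3 := nr _ _ hru hc.2
    have n4 := nr _ _ ha.2 hb.2
    have n5 := nr _ _ ha.2 hc.2
    have n6 := nr _ _ hb.2 hc.2
    rcases hn3 a ha4 b hb4 c hc4 with h | h | h
    · exact st4 C w a b c ⟨⟨haw.symm, hbw.symm, hcw.symm, hab, hac, hbc⟩, hn _ _ hw, hn _ _ hw, h⟩ n1 n2 n3 n4 n5 n6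
    · exact st4 C w a c b ⟨⟨haw.symm, hcw.symm, hbw.symm, hac, hab, hbc.symm⟩, hn _ _ hw, hn _ _ hw, h⟩ n1 n3 n2 n5 n4 (fun h => n6 (s _ _ h))
    · exact st4 C w b c a ⟨⟨hbw.symm, hcw.symm, haw.symm, hbc, hab.symm, hac.symm⟩, hn _ _ hw, hn _ _ hw, h⟩ n2 n3 n1 n6 (fun h => n4 (s _ _ h)) (fun h => n5 (s _ _ h))
  have hsum := card_filter_add_card_filter_not (s := W) (fun a => r u a)
  obtain ⟨a, ha, b, hb, c, hc, hab, hac, hbc⟩ := two_lt_card.mp (show 2 < (W.filter (fun x => ¬ r u x)).card by omega)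
  rw [mem_filter] at ha hb hc
  obtain ⟨ha4, haw⟩ := hWm a ha.1
  obtain ⟨hb4, hbw⟩ := hWm b hb.1
  obtain ⟨hc4, hcw⟩ := hWm c hc.1
  by_contra hcon
  push Not at hcon
  have n4 : ¬ r a b := fun h => ha.2 (by
    by_contra h'; exact hb.2 (hcon a b ha4 hb4 haw hbw hab h h'))
  have n5 : ¬ r a c := fun h => ha.2 (by
    by_contra h'; exact hc.2 (hcon a c ha4 hc4 haw hcw hac h h'))
  have n6 : ¬ r b c := fun h => hb.2 (by
    by_contra h'; exact hc.2 (hcon b c hb4 hc4 hbw hcw hbc h h'))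
  have m : ∀ x : Fin 10, 4 ≤ x → u ≠ x := fun x hx => by omega
  rcases hn3 a ha4 b hb4 c hc4 with h | h | h
  · exact st4 C u a b c ⟨⟨m _ ha4, m _ hb4, m _ hc4, hab, hac, hbc⟩, hn2 _ _ hu hu1 ha4, hn2 _ _ hu hu1 hb4, h⟩ ha.2 hb.2 hc.2 n4 n5 n6
  · exact st4 C u a c b ⟨⟨m _ ha4, m _ hc4, m _ hb4, hac, hab, hbc.symm⟩, hn2 _ _ hu hu1 ha4, hn2 _ _ hu hu1 hc4, h⟩ ha.2 hc.2 hb.2 n5 n4 (fun h => n6 (s _ _ h))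
  · exact st4 C u b c a ⟨⟨m _ hb4, m _ hc4, m _ ha4, hbc, hab.symm, hac.symm⟩, hn2 _ _ hu hu1 hb4, hn2 _ _ hu hu1 hc4, h⟩ hb.2 hc.2 ha.2 n6 (fun h => n4 (s _ _ h)) (fun h => n5 (s _ _ h))

lemma st_five (C : RCfg r hpS univ 6) (hK : ∀ x y : Fin 10, x < 4 → y < 4 → ¬ r x y) (u w : Fin 10)
    (hu : u < 4) (hu1 : u ≠ 1) (hw : 8 ≤ w) (hr : r w u) :
    u ≠ 0 ∧ r 5 0 ∧ ¬ r 5 1 ∧ ¬ r 5 2 ∧ ¬ r 5 3 := by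
  have s := C.rsymm
  have main : ∃ v' : Fin 10, 4 ≤ v' ∧ v' ≠ 5 ∧ r 5 v' ∧ ¬ r u 5 ∧ ¬ r u v' := by
    obtain ⟨v, v', h1, h2, h3, h4, h5, h6, h7, h8⟩ := st_redpair C u w hu hu1 hw hr
    by_cases hv : v = 5
    · subst hv; exact ⟨v', h2, h5.symm, h6, h7, h8⟩
    by_cases hv' : v' = 5
    · subst hv'; exact ⟨v, h1, h5, s _ _ h6, h8, h7⟩
    exact (st_share C hK u v v' hu h1 h2 hv hv' h6 (fun h => h7 (s _ _ h)) (fun h => h8 (s _ _ h))).elim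
  obtain ⟨v, hv4, hv5, hr5, hu5, huv⟩ := main
  have hu5' : ¬ r 5 u := fun h => hu5 (s _ _ h)
  have huv' : ¬ r v u := fun h => huv (s _ _ h)
  have key : ∀ x, r v x → ¬ r 5 x := fun x hx h5 =>
    C.notri 5 (mem_univ _) v (mem_univ _) x (mem_univ _) hr5 hx h5
  have k0 := key 0
  have k1 := key 1
  have k2 := key 2
  have k3 := key 3
  have a1 := st3' C hK v 0 1 2 hv4 hv5 (by decide) (by decide) (by decide) (by decide) (by decide) (by decide)
  have a2 := st3' C hK v 0 1 3 hv4 hv5 (by decide) (by decide) (by decide) (by decide) (by decide) (by decide)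
  have a3 := st3' C hK v 0 2 3 hv4 hv5 (by decide) (by decide) (by decide) (by decide) (by decide) (by decide)
  have a4 := st3' C hK v 1 2 3 hv4 hv5 (by decide) (by decide) (by decide) (by decide) (by decide) (by decide)
  have b1 := st3 C hK 5 0 2 1 (by decide) (by decide) (by decide) (by decide) (by decide) (by decide) (by decide) (by decide) (by decide) (by decide)
  have b2 := st3 C hK 5 0 2 3 (by decide) (by decide) (by decide) (by decide) (by decide) (by decide) (by decide) (by decide) (by decide) (by decide)
  have b3 := st3 C hK 5 0 3 1 (by decide) (by decide) (by decide) (by decide) (by decide) (by decide) (by decide) (by decide) (by decide) (by decide)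
  have : u = 0 ∨ u = 2 ∨ u = 3 := by
    have : ∀ u : Fin 10, u < 4 → u ≠ 1 → u = 0 ∨ u = 2 ∨ u = 3 := by decide
    exact this u hu hu1
  clear key hK hr5 hv4 hv5 s C
  rcases this with rfl | rfl | rfl
  · exfalso; grind
  · refine ⟨by decide, ?_⟩; grind
  · refine ⟨by decide, ?_⟩; grind

lemma st_main (C : RCfg r hpS univ 6) (hK : ∀ x y : Fin 10, x < 4 → y < 4 → ¬ r x y) :
    (r 5 0 ∧ ¬ r 5 1 ∧ ¬ r 5 2 ∧ ¬ r 5 3) ∧ ¬ r 8 0 ∧ (r 4 0 ∧ r 6 0 ∧ r 7 0) := by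
  have s := C.rsymm
  have h5 : ∀ w : Fin 10, 8 ≤ w → ¬ r w 0 ∧ (r 5 0 ∧ ¬ r 5 1 ∧ ¬ r 5 2 ∧ ¬ r 5 3) := by
    intro w hw
    have h0 : ¬ r w 0 := fun h => (st_five C hK 0 w (by decide) (by decide) hw h).1 rfl
    refine ⟨h0, ?_⟩
    have := st3' C hK w 0 2 3 (le_trans (by decide) hw) (by rintro rfl; revert hw; decide) (by decide) (by decide) (by decide) (by decide) (by decide) (by decide)
    rcases this with h | h | h
    · exact absurd h h0
    · exact (st_five C hK 2 w (by decide) (by decide) hw h).2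
    · exact (st_five C hK 3 w (by decide) (by decide) hw h).2
  have e8 := h5 8 (by decide)
  have e9 := h5 9 (by decide)
  have sh := fun v v' h1 h2 h3 h4 => st_share C hK 0 v v' (by decide) h1 h2 h3 h4
  have h3 : ∀ v : Fin 10, v = 4 ∨ v = 6 ∨ v = 7 → r v 0 := by
    intro v hv
    have hv4 : 4 ≤ v := by rcases hv with rfl | rfl | rfl <;> decide
    have hv5 : v ≠ 5 := by rcases hv with rfl | rfl | rfl <;> decide
    by_contra hc
    have n1 : ¬ r 8 9 := fun h => sh 8 9 (by decide) (by decide) (by decide) (by decide) h e8.1 e9.1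
    have n2 : ¬ r 8 v := fun h => sh 8 v (by decide) hv4 (by decide) hv5 h e8.1 hc
    have n3 : ¬ r 9 v := fun h => sh 9 v (by decide) hv4 (by decide) hv5 h e9.1 hc
    exact st4 C 0 8 9 v (by rcases hv with rfl | rfl | rfl <;> decide) (fun h => e8.1 (s _ _ h)) (fun h => e9.1 (s _ _ h)) (fun h => hc (s _ _ h)) n1 n2 n3
  exact ⟨e8.2, e8.1, h3 4 (by decide), h3 6 (by decide), h3 7 (by decide)⟩
end stage

open Finset

/-- pattern for the EY lemma: 0..5 is the independent set, 6..9 private neighbours of 0..3,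
and 6,7 may be joined by a half edge -/
def hpE (i j : Fin 10) : Prop :=
  (i, j) ∈ ([(0,6),(6,0),(1,7),(7,1),(2,8),(8,2),(3,9),(9,3),(6,7),(7,6)] : List (Fin 10 × Fin 10))

instance : DecidableRel hpE := fun i j => by unfold hpE; infer_instance

section ey
variable {r : Fin 10 → Fin 10 → Prop}

lemma ey_blue (rsymm : ∀ a b, r a b → r b a) (rirr : ∀ a, ¬ r a a) (e : Fin 10 → Fin 10)
    (h : ¬ r (e 0) (e 1) ∧ ¬ r (e 0) (e 2) ∧ ¬ r (e 0) (e 3) ∧ ¬ r (e 1) (e 2) ∧ ¬ r (e 1) (e 3) ∧ ¬ r (e 2) (e 3)) :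
    ∀ x y : Fin 10, x < 4 → y < 4 → ¬ r (e x) (e y) := by
  have h4 : ∀ x : Fin 10, x < 4 → x = 0 ∨ x = 1 ∨ x = 2 ∨ x = 3 := by decide
  obtain ⟨h1, h2, h3, h4', h5, h6⟩ := h
  intro x y hx hy
  rcases h4 x hx with rfl | rfl | rfl | rfl <;> rcases h4 y hy with rfl | rfl | rfl | rfl <;>
  first
  | exact rirr _
  | assumption
  | (intro h; have := rsymm _ _ h; contradiction)

lemma ey_a4 (C : RCfg r hpE univ 6) (a b c d : Fin 10) (hab : (a ≠ b ∧ a ≠ c ∧ a ≠ d ∧ b ≠ c ∧ b ≠ d ∧ c ≠ d) ∧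
    (¬ hpE a b ∧ ¬ hpE a c ∧ ¬ hpE b c))
    (h1 : ¬ r a b) (h2 : ¬ r a c) (h3 : ¬ r a d) (h4 : ¬ r b c) (h5 : ¬ r b d) (h6 : ¬ r c d) : False := by
  obtain ⟨⟨i1, i2, i3, i4, i5, i6⟩, j1, j2, j3⟩ := hab
  exact C.a4 (mem_univ a) (mem_univ b) (mem_univ c) (mem_univ d) i1 i2 i3 i4 i5 i6 h1 h2 h3 h4 h5 h6 j1 j2 j3

lemma ey_link34 (C : RCfg r hpE univ 6)
    (h : ¬ r 2 8 ∧ ¬ r 2 3 ∧ ¬ r 2 9 ∧ ¬ r 8 3 ∧ ¬ r 8 9 ∧ ¬ r 3 9) : False := by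
  have C1 := C.pull ![2,8,3,9,0,6,1,7,4,5] (by decide) (fun _ => mem_univ _) hpS (by decide) (by decide) (by decide)
  have m := st_main C1 (ey_blue C.rsymm C.rirr _ h)
  obtain ⟨⟨_, m1, m2, m3⟩, _⟩ := m
  exact ey_a4 C 6 8 3 9 (by decide) m1 m2 m3 h.2.2.2.1 h.2.2.2.2.1 h.2.2.2.2.2

lemma ey_link13 (C : RCfg r hpE univ 6)
    (h : ¬ r 0 6 ∧ ¬ r 0 2 ∧ ¬ r 0 8 ∧ ¬ r 6 2 ∧ ¬ r 6 8 ∧ ¬ r 2 8) : False := by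
  have C1 := C.pull ![0,6,2,8,1,7,3,9,4,5] (by decide) (fun _ => mem_univ _) hpS (by decide) (by decide) (by decide)
  have K1 := ey_blue C.rsymm C.rirr ![0,6,2,8,1,7,3,9,4,5] h
  obtain ⟨⟨m1, _, _, _⟩, m2, m3, m4, m5⟩ := st_main C1 K1
  replace m1 : r 7 0 := m1
  replace m2 : ¬ r 4 0 := m2
  replace m3 : r 1 0 := m3
  replace m4 : r 3 0 := m4
  replace m5 : r 9 0 := m5
  have nb : ∀ v x y, r x v → r y v → ¬ r x y := fun v x y h1 h2 h3 =>
    C.notri x (mem_univ _) y (mem_univ _) v (mem_univ _) h3 h2 h1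
  have C2 := C.pull ![1,7,3,9,0,6,2,8,4,5] (by decide) (fun _ => mem_univ _) hpS (by decide) (by decide) (by decide)
  have h' : ¬ r 1 7 ∧ ¬ r 1 3 ∧ ¬ r 1 9 ∧ ¬ r 7 3 ∧ ¬ r 7 9 ∧ ¬ r 3 9 :=
    ⟨nb _ _ _ m3 m1, nb _ _ _ m3 m4, nb _ _ _ m3 m5, nb _ _ _ m1 m4, nb _ _ _ m1 m5, nb _ _ _ m4 m5⟩
  have K2 := ey_blue C.rsymm C.rirr ![1,7,3,9,0,6,2,8,4,5] h'
  obtain ⟨_, m6, _⟩ := st_main C2 K2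
  replace m6 : ¬ r 4 1 := m6
  have a1 : r 4 0 ∨ r 4 6 ∨ r 4 2 := st3' C1 K1 8 0 1 2 (by decide) (by decide) (by decide) (by decide) (by decide) (by decide) (by decide) (by decide)
  have a2 : r 4 0 ∨ r 4 6 ∨ r 4 8 := st3' C1 K1 8 0 1 3 (by decide) (by decide) (by decide) (by decide) (by decide) (by decide) (by decide) (by decide)
  have a3 : r 4 0 ∨ r 4 2 ∨ r 4 8 := st3' C1 K1 8 0 2 3 (by decide) (by decide) (by decide) (by decide) (by decide) (by decide) (by decide) (by decide)
  have b1 : r 4 1 ∨ r 4 7 ∨ r 4 3 := st3' C2 K2 8 0 1 2 (by decide) (by decide) (by decide) (by decide) (by decide) (by decide) (by decide) (by decide)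
  have b2 : r 4 1 ∨ r 4 7 ∨ r 4 9 := st3' C2 K2 8 0 1 3 (by decide) (by decide) (by decide) (by decide) (by decide) (by decide) (by decide) (by decide)
  have b3 : r 4 1 ∨ r 4 3 ∨ r 4 9 := st3' C2 K2 8 0 2 3 (by decide) (by decide) (by decide) (by decide) (by decide) (by decide) (by decide) (by decide)
  have nb4 : ∀ x y, r 4 x → r 4 y → ¬ r x y := fun x y h1 h2 => nb 4 x y (C.rsymm _ _ h1) (C.rsymm _ _ h2)
  have A : (r 4 6 ∧ r 4 2) ∨ (r 4 6 ∧ r 4 8) ∨ (r 4 2 ∧ r 4 8) := by clear K1 K2 nb nb4 b1 b2 b3; tauto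
  have B : (r 4 7 ∧ r 4 3) ∨ (r 4 7 ∧ r 4 9) ∨ (r 4 3 ∧ r 4 9) := by clear K1 K2 nb nb4 a1 a2 a3 A; tauto
  have fin : ∀ a b c d : Fin 10, (a ≠ b ∧ a ≠ c ∧ a ≠ d ∧ b ≠ c ∧ b ≠ d ∧ c ≠ d) ∧
    (¬ hpE a b ∧ ¬ hpE a c ∧ ¬ hpE b c) → r 4 a → r 4 b → r 4 c → r 4 d → False := by
    intro a b c d hh ha hb hc hd
    exact ey_a4 C a b c d hh (nb4 _ _ ha hb) (nb4 _ _ ha hc) (nb4 _ _ ha hd) (nb4 _ _ hb hc) (nb4 _ _ hb hd) (nb4 _ _ hc hd)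
  rcases A with ⟨x1, x2⟩ | ⟨x1, x2⟩ | ⟨x1, x2⟩ <;> rcases B with ⟨y1, y2⟩ | ⟨y1, y2⟩ | ⟨y1, y2⟩
  · exact fin 6 2 3 7 (by decide) x1 x2 y2 y1
  · exact fin 6 2 9 7 (by decide) x1 x2 y2 y1
  · exact fin 6 2 3 9 (by decide) x1 x2 y1 y2
  · exact fin 6 8 3 7 (by decide) x1 x2 y2 y1
  · exact fin 6 8 9 7 (by decide) x1 x2 y2 y1
  · exact fin 6 8 3 9 (by decide) x1 x2 y1 y2
  · exact fin 7 3 2 8 (by decide) y1 y2 x1 x2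
  · exact fin 7 9 2 8 (by decide) y1 y2 x1 x2
  · exact ey_link34 C ⟨nb4 _ _ x1 x2, nb4 _ _ x1 y1, nb4 _ _ x1 y2, nb4 _ _ x2 y1, nb4 _ _ x2 y2, nb4 _ _ y1 y2⟩

lemma ey_core (C : RCfg r hpE univ 6) : False := by
  obtain ⟨S, hS, hSc, hSb⟩ := ramsey_four C.rsymm C.rirr (univ.erase 7)
    (fun a ha b hb c hc => C.notri a (mem_univ _) b (mem_univ _) c (mem_univ _)) (by decide)
  have h7 : ∀ x ∈ S, x ≠ 7 := fun x hx => (mem_erase.mp (hS hx)).1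
  have pat : ∀ a b, hpE a b → a ≠ 7 → b ≠ 7 → (a = 0 ∧ b = 6) ∨ (a = 6 ∧ b = 0) ∨ (a = 2 ∧ b = 8) ∨ (a = 8 ∧ b = 2) ∨
    (a = 3 ∧ b = 9) ∨ (a = 9 ∧ b = 3) := by
    intro a b hab ha hb
    simp only [hpE, List.mem_cons, Prod.mk.injEq, List.not_mem_nil, or_false] at hab
    grind
  have go : ∀ x : Fin 10, (∃ a b, a ∈ S ∧ a ≠ x ∧ b ∈ S ∧ b ≠ x ∧ hpE a b) := by
    intro x
    by_contra hc
    have := C.clq S (S.erase x) (erase_subset _ _) (subset_univ _) hSb (by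
      intro a ha b hb hab
      rw [mem_erase] at ha hb
      exact hc ⟨a, b, ha.2, ha.1, hb.2, hb.1, hab⟩)
    have h3 := pred_card_le_card_erase (s := S) (a := x)
    omega
  have l1 : ¬ (0 ∈ S ∧ 6 ∈ S ∧ 2 ∈ S ∧ 8 ∈ S) := fun ⟨h1, h2, h3, h4⟩ =>
    ey_link13 C ⟨hSb _ h1 _ h2, hSb _ h1 _ h3, hSb _ h1 _ h4, hSb _ h2 _ h3, hSb _ h2 _ h4, hSb _ h3 _ h4⟩
  have l2 : ¬ (2 ∈ S ∧ 8 ∈ S ∧ 3 ∈ S ∧ 9 ∈ S) := fun ⟨h1, h2, h3, h4⟩ =>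
    ey_link34 C ⟨hSb _ h1 _ h2, hSb _ h1 _ h3, hSb _ h1 _ h4, hSb _ h2 _ h3, hSb _ h2 _ h4, hSb _ h3 _ h4⟩
  have l3 : ¬ (0 ∈ S ∧ 6 ∈ S ∧ 3 ∈ S ∧ 9 ∈ S) := fun ⟨h1, h2, h3, h4⟩ => by
    have C1 := C.pull ![0,1,3,2,4,5,6,7,9,8] (by decide) (fun _ => mem_univ _) hpE (by decide) (by decide) (by decide)
    exact ey_link13 C1 ⟨hSb _ h1 _ h2, hSb _ h1 _ h3, hSb _ h1 _ h4, hSb _ h2 _ h3, hSb _ h2 _ h4, hSb _ h3 _ h4⟩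
  have g : ∀ x : Fin 10, (0 ∈ S ∧ 6 ∈ S ∧ x ≠ 6) ∨ (2 ∈ S ∧ 8 ∈ S ∧ x ≠ 8) ∨ (3 ∈ S ∧ 9 ∈ S ∧ x ≠ 9) := by
    intro x
    obtain ⟨a, b, ha, hax, hb, hbx, hab⟩ := go x
    rcases pat a b hab (h7 a ha) (h7 b hb) with ⟨rfl, rfl⟩ | ⟨rfl, rfl⟩ | ⟨rfl, rfl⟩ | ⟨rfl, rfl⟩ | ⟨rfl, rfl⟩ | ⟨rfl, rfl⟩ <;>
    simp_all [eq_comm]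
  have g1 := g 6
  have g2 := g 8
  have g3 := g 9
  grind
end ey

section lem
variable {V : Type*} [DecidableEq V] {r h : V → V → Prop} {A : Finset V}

/-- EY lemma, with indexing -/
lemma ey_lemma (C : RCfg r h A 6) (e : Fin 10 → V) (he : Function.Injective e) (heA : ∀ w, e w ∈ A)
    (hle : ∀ a b, h (e a) (e b) → hpE a b) : False :=
  ey_core (C.pull e he heA hpE (by decide) (by decide) hle)

/-- K5 lemma -/
lemma k5_lemma (C : RCfg r h A 6) (K J : Finset V) (hK : K ⊆ A) (hJ : J ⊆ A) (hKc : K.card = 5) (hJc : J.card = 5)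
    (hKJ : Disjoint K J) (hKb : ∀ a ∈ K, ∀ b ∈ K, ¬ r a b)
    (hJh : ∀ a ∈ J, ∀ b ∈ J, ¬ h a b) (hKJh : ∀ a ∈ K, ∀ b ∈ J, ¬ h a b)  : False := by
  classical
  have s := C.rsymm
  have hs := C.hsymm
  have sumc : ∀ v, (K.filter (fun t => r v t)).card + (K.filter (fun t => ¬ r v t)).card = 5 := fun v => by
    rw [card_filter_add_card_filter_not, hKc]
  -- each v in J is red to at least two
  have h2 : ∀ v ∈ J, 2 ≤ (K.filter (fun t => r v t)).card := by
    intro v hv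
    by_contra hcon
    have hc : 4 ≤ (K.filter (fun t => ¬ r v t)).card := by have := sumc v; omega
    obtain ⟨t, ht⟩ := card_pos.mp (show 0 < (K.filter (fun t => ¬ r v t)).card by omega)
    have hvK : v ∉ K.filter (fun t => ¬ r v t) := fun h => (disjoint_left.mp hKJ (mem_filter.mp h).1 hv)
    have := C.clq (insert v (K.filter (fun t => ¬ r v t))) {v, t} (by
      intro x hx; rw [mem_insert, mem_singleton] at hx; rw [mem_insert]; rcases hx with rfl | rfl
      exacts [Or.inl rfl, Or.inr ht]) (by
      intro x hx; rw [mem_insert] at hx; rcases hx with rfl | hx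
      exacts [hJ hv, hK (mem_filter.mp hx).1]) (blue_insert s C.rirr
        (fun a ha b hb => hKb a (mem_filter.mp ha).1 b (mem_filter.mp hb).1) (fun a ha => (mem_filter.mp ha).2)) (by
        exact blue_insert hs C.hirr (S := {t}) (by simpa using C.hirr t) (by
          simp only [mem_singleton, forall_eq]; exact fun h => hKJh t (mem_filter.mp ht).1 v hv (hs _ _ h)))
    rw [card_insert_of_notMem hvK, card_pair (by rintro rfl; exact hvK ht)] at this
    omega
  have hdis : ∀ v ∈ J, ∀ w ∈ J, r v w → ∀ t ∈ K, r v t → ¬ r w t := fun v hv w hw hvw t ht h1 h2 =>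
    C.notri v (hJ hv) w (hJ hw) t (hK ht) hvw h2 h1
  -- red edge in J
  have hred : ∃ v ∈ J, ∃ w ∈ J, r v w := by
    by_contra hc
    push Not at hc
    have := C.clq J J subset_rfl hJ hc hJh
    omega
  obtain ⟨v, hv, hvc⟩ : ∃ v ∈ J, (K.filter (fun t => r v t)).card ≤ 2 := by
    obtain ⟨v, hv, w, hw, hvw⟩ := hred
    by_contra hc
    push Not at hc
    have h1 := hc v hv
    have h3 := hc w hw
    have : (K.filter (fun t => r w t)) ⊆ (K.filter (fun t => ¬ r v t)) := fun t ht => by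
      rw [mem_filter] at ht ⊢
      exact ⟨ht.1, fun h => hdis v hv w hw hvw t ht.1 h ht.2⟩
    have := card_le_card this
    have := sumc v
    omega
  set M := K.filter (fun t => ¬ r v t) with hM
  have hMc : M.card = 3 := by have h7 := sumc v; rw [← hM] at h7; have := h2 v hv; omega
  have hw2 : ∀ w ∈ J, w ≠ v → 2 ≤ (M.filter (fun t => r w t)).card := by
    intro w hw hne
    by_cases hvw : r v w
    · have : (K.filter (fun t => r w t)) ⊆ (M.filter (fun t => r w t)) := fun t ht => by
        rw [hM, mem_filter, mem_filter]
        rw [mem_filter] at ht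
        exact ⟨⟨ht.1, fun h => hdis v hv w hw hvw t ht.1 h ht.2⟩, ht.2⟩
      exact (h2 w hw).trans (card_le_card this)
    · by_contra hc
      have h3 : (M.filter (fun t => r w t)).card + (M.filter (fun t => ¬ r w t)).card = 3 := by
        rw [card_filter_add_card_filter_not, hMc]
      obtain ⟨t, ht, t', ht', htt⟩ := one_lt_card.mp (show 1 < (M.filter (fun t => ¬ r w t)).card by omega)
      rw [hM, mem_filter, mem_filter] at ht ht'
      have ne : ∀ x ∈ J, ∀ y ∈ K, x ≠ y := fun x hx y hy hxy => disjoint_left.mp hKJ hy (hxy ▸ hx)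
      exact C.a4 (hJ hv) (hJ hw) (hK ht.1.1) (hK ht'.1.1) hne.symm (ne _ hv _ ht.1.1) (ne _ hv _ ht'.1.1)
        (ne _ hw _ ht.1.1) (ne _ hw _ ht'.1.1) htt hvw ht.1.2 ht'.1.2 ht.2 ht'.2 (hKb _ ht.1.1 _ ht'.1.1)
        (hJh _ hv _ hw) (fun h => hKJh _ ht.1.1 _ hv (hs _ _ h)) (fun h => hKJh _ ht.1.1 _ hw (hs _ _ h))
  have := C.clq (J.erase v) (J.erase v) subset_rfl ((erase_subset _ _).trans hJ) (by
    intro a ha b hb hab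
    rw [mem_erase] at ha hb
    have h1 := hw2 a ha.2 ha.1
    have h3 := hw2 b hb.2 hb.1
    have : (M.filter (fun t => r b t)) ⊆ (M.filter (fun t => ¬ r a t)) := fun t ht => by
      rw [mem_filter] at ht ⊢
      refine ⟨ht.1, fun h => hdis a ha.2 b hb.2 hab t (mem_filter.mp ht.1).1 h ht.2⟩
    have h4 := card_le_card this
    have h5 : (M.filter (fun t => r a t)).card + (M.filter (fun t => ¬ r a t)).card = 3 := by
        rw [card_filter_add_card_filter_not, hMc]
    omega) (fun a ha b hb => hJh a (mem_erase.mp ha).2 b (mem_erase.mp hb).2)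
  rw [card_erase_of_mem hv, hJc] at this
  omega
end lem

open Finset

section kcs
open Classical
variable {V : Type*} {r h : V → V → Prop} {A : Finset V} {q : ℕ} {y : V → ℝ}

structure KCS (r h : V → V → Prop) (A : Finset V) (q : ℕ) (y : V → ℝ) (I P : Finset V) (own : V → V) : Prop where
  C : RCfg r h A q
  hb : ∀ a ∈ A, ∀ b ∈ A, h a b → ¬ r a b
  pos : ∀ a ∈ A, 0 < y a
  loss : ∀ a ∈ A, y a + 499/1000 * ∑ j ∈ A.filter (fun j => h a j), y j < 1
  IA : I ⊆ A
  Ih : ∀ a ∈ I, ∀ b ∈ I, ¬ h a b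
  PA : P ⊆ A
  PI : ∀ p ∈ P, p ∉ I
  ownI : ∀ p ∈ P, own p ∈ I
  ownh : ∀ p ∈ P, h p (own p)
  ownu : ∀ p ∈ P, ∀ i ∈ I, h p i → i = own p
  Pcl : ∀ p ∈ P, ∀ p' ∈ P, own p = own p' → p ≠ p' → h p p'
  ymax : ∀ p ∈ P, y p ≤ y (own p)
  massP : 2 * (∑ a ∈ A, y a) - I.card * (1000/499) ≤ ∑ p ∈ P, y p

set_option maxHeartbeats 1000000 in
lemma kcs_exists (C : RCfg r h A q) (hb : ∀ a ∈ A, ∀ b ∈ A, h a b → ¬ r a b)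
    (pos : ∀ a ∈ A, 0 < y a)
    (loss : ∀ a ∈ A, y a + 499/1000 * ∑ j ∈ A.filter (fun j => h a j), y j < 1) :
    ∃ I P own, KCS r h A q y I P own := by
  have hs := C.hsymm
  set F := A.powerset.filter (fun J => ∀ a ∈ J, ∀ b ∈ J, ¬ h a b) with hF
  have hFm : ∀ J, J ∈ F ↔ J ⊆ A ∧ ∀ a ∈ J, ∀ b ∈ J, ¬ h a b := by
    intro J; simp only [hF, mem_filter, mem_powerset]
  set Y := ∑ a ∈ A, y a with hY
  have hY0 : 0 ≤ Y := sum_nonneg fun a ha => (pos a ha).le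
  obtain ⟨I, hIF, hImax⟩ := exists_max_image F (fun J => (J.card : ℝ) * (Y + 1) + ∑ a ∈ J, y a)
    ⟨∅, by rw [hFm]; simp⟩
  obtain ⟨IA, Ih⟩ := (hFm I).mp hIF
  have hyle : ∀ J ⊆ A, ∑ a ∈ J, y a ≤ Y := fun J hJ =>
    sum_le_sum_of_subset_of_nonneg hJ (fun a ha _ => (pos a ha).le)
  have hy0 : ∀ J ⊆ A, 0 ≤ ∑ a ∈ J, y a := fun J hJ => sum_nonneg fun a ha => (pos a (hJ ha)).le
  have cmax : ∀ J ⊆ A, (∀ a ∈ J, ∀ b ∈ J, ¬ h a b) → J.card ≤ I.card := by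
    intro J hJ hJh
    have h1 := hImax J ((hFm J).mpr ⟨hJ, hJh⟩)
    have h2 := hyle I IA
    have h3 := hy0 J hJ
    by_contra hc
    have h4 : (I.card : ℝ) + 1 ≤ J.card := by exact_mod_cast (by omega)
    nlinarith
  have h1 : ∀ v ∈ A, v ∉ I → 1 ≤ (I.filter (fun i => h v i)).card := by
    intro v hv hvI
    by_contra hc
    have h0 : I.filter (fun i => h v i) = ∅ := by rw [← card_eq_zero]; omega
    have := cmax (insert v I) (by intro x hx; rw [mem_insert] at hx; rcases hx with rfl | hx; exacts [hv, IA hx])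
      (blue_insert hs C.hirr Ih (fun a ha hh => by
        have : a ∈ I.filter (fun i => h v i) := mem_filter.mpr ⟨ha, hh⟩
        rw [h0] at this; simp at this))
    rw [card_insert_of_notMem hvI] at this
    omega
  set P := A.filter (fun v => v ∉ I ∧ (I.filter (fun i => h v i)).card = 1) with hP
  have hPm : ∀ v, v ∈ P ↔ v ∈ A ∧ v ∉ I ∧ (I.filter (fun i => h v i)).card = 1 := by
    intro v; rw [hP, mem_filter]
  have hown : ∀ p, ∃ i, p ∈ P → I.filter (fun i => h p i) = {i} := by
    intro p
    by_cases hp : p ∈ P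
    · obtain ⟨i, hi⟩ := card_eq_one.mp ((hPm p).mp hp).2.2
      exact ⟨i, fun _ => hi⟩
    · exact ⟨p, fun h => absurd h hp⟩
  choose own hown using hown
  have ownI : ∀ p ∈ P, own p ∈ I ∧ h p (own p) := by
    intro p hp
    have : own p ∈ I.filter (fun i => h p i) := by rw [hown p hp]; simp
    exact mem_filter.mp this
  have ownu : ∀ p ∈ P, ∀ i ∈ I, h p i → i = own p := by
    intro p hp i hi hpi
    have : i ∈ I.filter (fun i => h p i) := mem_filter.mpr ⟨hi, hpi⟩
    rw [hown p hp] at this; simpa using this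
  have exch : ∀ p ∈ P, (∀ a ∈ insert p (I.erase (own p)), ∀ b ∈ insert p (I.erase (own p)), ¬ h a b) ∧
      insert p (I.erase (own p)) ⊆ A ∧ (insert p (I.erase (own p))).card = I.card := by
    intro p hp
    obtain ⟨hpA, hpI, _⟩ := (hPm p).mp hp
    refine ⟨blue_insert hs C.hirr (fun a ha b hb => Ih a (mem_of_mem_erase ha) b (mem_of_mem_erase hb)) ?_, ?_, ?_⟩
    · intro a ha hh
      rw [mem_erase] at ha
      exact ha.1 (ownu p hp a ha.2 hh)
    · intro x hx; rw [mem_insert] at hx; rcases hx with rfl | hx; exacts [hpA, IA (mem_of_mem_erase hx)]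
    · rw [card_insert_of_notMem (fun h => hpI (mem_of_mem_erase h)), card_erase_add_one (ownI p hp).1]
  refine ⟨I, P, own, C, hb, pos, loss, IA, Ih, filter_subset _ _, fun p hp => ((hPm p).mp hp).2.1,
    fun p hp => (ownI p hp).1, fun p hp => (ownI p hp).2, ownu, ?_, ?_, ?_⟩
  · intro p hp p' hp' he hne
    by_contra hh
    obtain ⟨e1, e2, e3⟩ := exch p hp
    have hp'' := (hPm p').mp hp'
    have := cmax (insert p' (insert p (I.erase (own p)))) (by
      intro x hx; rw [mem_insert] at hx; rcases hx with rfl | hx; exacts [hp''.1, e2 hx]) (by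
      refine blue_insert hs C.hirr e1 ?_
      intro a ha hpa
      rw [mem_insert] at ha
      rcases ha with rfl | ha
      · exact hh (hs _ _ hpa)
      · rw [mem_erase] at ha
        exact ha.1 (he ▸ ownu p' hp' a ha.2 hpa))
    rw [card_insert_of_notMem, e3] at this
    · omega
    · rw [mem_insert]; rintro (h | h)
      · exact hne h.symm
      · exact hp''.2.1 (mem_of_mem_erase h)
  · intro p hp
    obtain ⟨e1, e2, e3⟩ := exch p hp
    have := hImax _ ((hFm _).mpr ⟨e2, e1⟩)
    rw [e3, sum_insert (fun h => ((hPm p).mp hp).2.1 (mem_of_mem_erase h)), ← add_sum_erase _ _ (ownI p hp).1] at this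
    linarith
  · -- mass
    have e1 : ∑ i ∈ I, (y i + 499/1000 * ∑ j ∈ A.filter (fun j => h i j), y j) ≤ I.card := by
      calc _ ≤ ∑ i ∈ I, (1:ℝ) := sum_le_sum fun i hi => (loss i (IA hi)).le
        _ = _ := by simp
    rw [sum_add_distrib, ← mul_sum] at e1
    have e2 : ∑ i ∈ I, ∑ j ∈ A.filter (fun j => h i j), y j = ∑ j ∈ A, ((I.filter (fun i => h j i)).card : ℝ) * y j := by
      simp_rw [sum_filter]
      rw [sum_comm]
      refine sum_congr rfl fun j _ => ?_
      rw [card_filter, Nat.cast_sum, sum_mul]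
      refine sum_congr rfl fun i _ => ?_
      by_cases hij : h i j
      · rw [if_pos hij, if_pos (hs _ _ hij), Nat.cast_one, one_mul]
      · rw [if_neg hij, if_neg (fun h => hij (hs _ _ h)), Nat.cast_zero, zero_mul]
    have e3 : ∑ j ∈ A, (2 * y j - (if j ∈ I then 2 * y j else 0) - (if j ∈ P then y j else 0)) ≤
        ∑ j ∈ A, ((I.filter (fun i => h j i)).card : ℝ) * y j := by
      refine sum_le_sum fun j hj => ?_
      have hyj := pos j hj
      by_cases hjI : j ∈ I
      · have : j ∉ P := fun hp => ((hPm j).mp hp).2.1 hjI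
        simp only [hjI, this, if_true, if_false]
        have : 0 ≤ ((I.filter (fun i => h j i)).card : ℝ) * y j := by positivity
        linarith
      · by_cases hjP : j ∈ P
        · simp only [hjI, hjP, if_true, if_false]
          rw [((hPm j).mp hjP).2.2]
          push_cast; linarith
        · simp only [hjI, hjP, if_false]
          have h2 : 2 ≤ (I.filter (fun i => h j i)).card := by
            have := h1 j hj hjI
            have h3 : (I.filter (fun i => h j i)).card ≠ 1 := fun h => hjP ((hPm j).mpr ⟨hj, hjI, h⟩)
            omega
          have h2' : (2:ℝ) ≤ (I.filter (fun i => h j i)).card := by exact_mod_cast h2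
          nlinarith
    have e4 : ∑ j ∈ A, (if j ∈ I then 2 * y j else 0) = 2 * ∑ j ∈ I, y j := by
      rw [← sum_filter, filter_mem_eq_inter, inter_eq_right.mpr IA, mul_sum]
    have e5 : ∑ j ∈ A, (if j ∈ P then y j else 0) = ∑ j ∈ P, y j := by
      rw [← sum_filter, filter_mem_eq_inter, inter_eq_right.mpr (filter_subset _ _)]
    rw [sum_sub_distrib, sum_sub_distrib, e4, e5, ← mul_sum] at e3
    rw [e2] at e1
    have := hy0 I IA
    linarith
end kcs

open Finset

section kcs
open Classical
variable {V : Type*} {r h : V → V → Prop} {A : Finset V} {q : ℕ} {y : V → ℝ} {I P : Finset V} {own : V → V}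

lemma KCS.nb (K : KCS r h A q y I P own) {p : V} (hp : p ∈ P) :
    y p + 499/1000 * ∑ t ∈ P.filter (fun t => own t = own p ∨ h p t), y t < 1 := by
  have hl := K.loss p (K.PA hp)
  set B := P.filter (fun t => own t = own p ∨ h p t) with hB
  have hpB : p ∈ B := mem_filter.mpr ⟨hp, Or.inl rfl⟩
  have hoi := K.ownI p hp
  have hBP : B ⊆ P := filter_subset _ _
  have hno : own p ∉ B.erase p := fun hh => K.PI _ (hBP (mem_of_mem_erase hh)) hoi
  have hsub : insert (own p) (B.erase p) ⊆ A.filter (fun j => h p j) := by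
    intro x hx
    rw [mem_insert] at hx
    rw [mem_filter]
    rcases hx with rfl | hx
    · exact ⟨K.IA hoi, K.ownh p hp⟩
    · rw [mem_erase, hB, mem_filter] at hx
      refine ⟨K.PA hx.2.1, ?_⟩
      rcases hx.2.2 with h1 | h1
      · exact K.Pcl p hp x hx.2.1 h1.symm hx.1.symm
      · exact h1
  have h1 := sum_le_sum_of_subset_of_nonneg (f := y) hsub (fun a ha _ => (K.pos a (mem_filter.mp ha).1).le)
  rw [sum_insert hno] at h1
  have h2 := add_sum_erase _ y hpB
  have h3 := K.ymax p hp
  linarith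

lemma KCS.ybd (K : KCS r h A q y I P own) {p : V} (hp : p ∈ P) : 1499/1000 * y p ≤ 1 := by
  have h1 := K.nb hp
  have : y p ≤ ∑ t ∈ P.filter (fun t => own t = own p ∨ h p t), y t :=
    single_le_sum (f := y) (fun a ha => (K.pos a (K.PA (mem_filter.mp ha).1)).le) (mem_filter.mpr ⟨hp, Or.inl rfl⟩)
  linarith

lemma KCS.cls (K : KCS r h A q y I P own) (i : V) {s : ℕ} (hs : (P.filter (fun t => own t = i)).card ≤ s) :
    (∑ t ∈ P.filter (fun t => own t = i), y t) * (1 + 499/1000 * s) ≤ s := by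
  set B := P.filter (fun t => own t = i) with hB
  rcases B.eq_empty_or_nonempty with hE | hN
  · rw [hE, sum_empty, zero_mul]; positivity
  obtain ⟨p, hpB, hpm⟩ := exists_max_image B y hN
  have hp := (mem_filter.mp hpB).1
  have h1 := K.nb hp
  have h2 : ∑ t ∈ B, y t ≤ ∑ t ∈ P.filter (fun t => own t = own p ∨ h p t), y t := by
    refine sum_le_sum_of_subset_of_nonneg ?_ (fun a ha _ => (K.pos a (K.PA (mem_filter.mp ha).1)).le)
    intro t ht
    rw [hB, mem_filter] at ht
    exact mem_filter.mpr ⟨ht.1, Or.inl (ht.2.trans (mem_filter.mp hpB).2.symm)⟩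
  have h3 : ∑ t ∈ B, y t ≤ B.card * y p := by
    have := sum_le_card_nsmul B y (y p) hpm
    rwa [nsmul_eq_mul] at this
  have h4 : (B.card : ℝ) ≤ s := by exact_mod_cast hs
  have h5 := K.pos p (K.PA hp)
  nlinarith

lemma KCS.sumP (K : KCS r h A q y I P own) :
    ∑ i ∈ I, ∑ t ∈ P.filter (fun t => own t = i), y t = ∑ t ∈ P, y t :=
  sum_fiberwise_of_maps_to K.ownI y

lemma KCS.cardP (K : KCS r h A q y I P own) :
    ∑ i ∈ I, (P.filter (fun t => own t = i)).card = P.card :=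
  (card_eq_sum_card_fiberwise K.ownI).symm

lemma KCS.IP (K : KCS r h A q y I P own) {i p : V} (hi : i ∈ I) (hp : p ∈ P) (hne : i ≠ own p) : ¬ h i p :=
  fun hh => hne (K.ownu p hp i hi (K.C.hsymm _ _ hh))

lemma KCS.ne (K : KCS r h A q y I P own) {i p : V} (hi : i ∈ I) (hp : p ∈ P) : i ≠ p :=
  fun hh => K.PI p hp (hh ▸ hi)

lemma KCS.rb (K : KCS r h A q y I P own) {a b : V} (ha : a ∈ A) (hb : b ∈ A) (hh : h a b) : ¬ r a b := K.hb a ha b hb hh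

lemma KCS.clsblue (K : KCS r h A q y I P own) (i : V) (hi : i ∈ I) :
    (∀ a ∈ insert i (P.filter (fun t => own t = i)), ∀ b ∈ insert i (P.filter (fun t => own t = i)), ¬ r a b) ∧
    insert i (P.filter (fun t => own t = i)) ⊆ A ∧
    (insert i (P.filter (fun t => own t = i))).card = (P.filter (fun t => own t = i)).card + 1 := by
  refine ⟨blue_insert K.C.rsymm K.C.rirr ?_ ?_, ?_, ?_⟩
  · intro a ha b hb
    rw [mem_filter] at ha hb
    by_cases hab : a = b
    · subst hab; exact K.C.rirr _
    · exact K.rb (K.PA ha.1) (K.PA hb.1) (K.Pcl a ha.1 b hb.1 (ha.2.trans hb.2.symm) hab)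
  · intro a ha
    rw [mem_filter] at ha
    refine K.rb (K.IA hi) (K.PA ha.1) (K.C.hsymm _ _ ?_)
    rw [← ha.2]; exact K.ownh a ha.1
  · intro x hx; rw [mem_insert] at hx; rcases hx with rfl | hx
    exacts [K.IA hi, K.PA (mem_filter.mp hx).1]
  · rw [card_insert_of_notMem]
    intro hh; exact K.PI _ (mem_filter.mp hh).1 hi

lemma KCS.clscard (K : KCS r h A q y I P own) (i : V) (hi : i ∈ I) :
    (P.filter (fun t => own t = i)).card + 2 ≤ q := by
  obtain ⟨h1, h2, h3⟩ := K.clsblue i hi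
  have := K.C.clq _ {i} (by intro x hx; rw [mem_singleton] at hx; subst hx; exact mem_insert_self _ _) h2 h1
    (by simpa using K.C.hirr i)
  rw [h3, card_singleton] at this
  omega

/-- uniform bound over classes -/
lemma KCS.unif (K : KCS r h A q y I P own) {s : ℕ} (hs : ∀ i ∈ I, (P.filter (fun t => own t = i)).card ≤ s) :
    (∑ t ∈ P, y t) * (1 + 499/1000 * s) ≤ I.card * s := by
  rw [← K.sumP, sum_mul]
  calc _ ≤ ∑ i ∈ I, (s:ℝ) := sum_le_sum fun i hi => K.cls i (hs i hi)
    _ = _ := by simp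

lemma KCS.unifImage (K : KCS r h A q y I P own) {s : ℕ} (hs : ∀ i ∈ I, (P.filter (fun t => own t = i)).card ≤ s) :
    (∑ t ∈ P, y t) * (1 + 499/1000 * s) ≤ (P.image own).card * s := by
  rw [← sum_fiberwise_of_maps_to (fun p hp => mem_image_of_mem own hp) y, sum_mul]
  calc _ ≤ ∑ i ∈ P.image own, (s:ℝ) := sum_le_sum fun i hi => K.cls i (hs i (by
            obtain ⟨p, hp, rfl⟩ := mem_image.mp hi; exact K.ownI p hp))
    _ = _ := by simp

lemma KCS.cardbd (K : KCS r h A q y I P own) : 1499/1000 * (∑ t ∈ P, y t) ≤ P.card := by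
  rw [mul_sum]
  calc _ ≤ ∑ t ∈ P, (1:ℝ) := sum_le_sum fun t ht => K.ybd ht
    _ = _ := by simp

lemma KCS.AI (K : KCS r h A q y I P own) (hA : A ⊆ I) : ∑ a ∈ A, y a ≤ I.card := by
  have : A = I := subset_antisymm hA K.IA
  calc _ ≤ ∑ a ∈ A, (1:ℝ) := sum_le_sum fun a ha => by
          have h1 := K.loss a ha
          have : 0 ≤ ∑ j ∈ A.filter (fun j => h a j), y j := sum_nonneg fun j hj => (K.pos j (mem_filter.mp hj).1).le
          linarith
    _ = _ := by simp [this]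

lemma KCS.Icard (K : KCS r h A q y I P own) {n t : ℕ} (H : RamseyHas r n t) (ht : q < 2 * t) : I.card < n := by
  by_contra hc
  obtain ⟨S, hS, hSc, hSb⟩ := H I (fun a ha b hb c hc => K.C.notri a (K.IA ha) b (K.IA hb) c (K.IA hc)) (by omega)
  have := K.C.clq S S subset_rfl (hS.trans K.IA) hSb (fun a ha b hb => K.Ih a (hS ha) b (hS hb))
  omega

lemma KCS.Iinsert (K : KCS r h A q y I P own) {n t : ℕ} (H : RamseyHas r n t) (ht : q < t + (t - 1)) (hc : n ≤ I.card + 1) :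
    A ⊆ I := by
  intro w hw
  by_contra hwI
  have hsub : insert w I ⊆ A := by
    intro x hx; rw [mem_insert] at hx; rcases hx with rfl | hx; exacts [hw, K.IA hx]
  obtain ⟨S, hS, hSc, hSb⟩ := H (insert w I) (fun a ha b hb c hc => K.C.notri a (hsub ha) b (hsub hb) c (hsub hc))
    (by rw [card_insert_of_notMem hwI]; omega)
  have := K.C.clq S (S.erase w) (erase_subset _ _) (hS.trans hsub) hSb (by
    intro a ha b hb
    rw [mem_erase] at ha hb
    refine K.Ih a ?_ b ?_
    · have := hS ha.2; rw [mem_insert] at this; tauto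
    · have := hS hb.2; rw [mem_insert] at this; tauto)
  have h3 := pred_card_le_card_erase (s := S) (a := w)
  omega

lemma KCS.q3 (K : KCS r h A 3 y I P own) : ∑ a ∈ A, y a < 5 := by
  by_contra hc
  push Not at hc
  have h1 := K.Icard (ramsey_two K.C.rsymm K.C.rirr) (by omega)
  have h2 := K.unif (s := 1) (fun i hi => by have := K.clscard i hi; omega)
  have h3 := K.massP
  have h4 : (I.card : ℝ) ≤ 2 := by exact_mod_cast (by omega)
  push_cast at h2
  linarith

lemma KCS.q4 (K : KCS r h A 4 y I P own) : ∑ a ∈ A, y a < 6 := by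
  by_contra hc
  push Not at hc
  have H3 := ramsey_three K.C.rsymm K.C.rirr
  have h1 := K.Icard H3 (by omega)
  have hcl : ∀ i ∈ I, (P.filter (fun t => own t = i)).card ≤ 2 := fun i hi => by have := K.clscard i hi; omega
  have h2 := K.unif hcl
  have h3 := K.massP
  have h5 : I.card ≠ 5 := by
    intro h5
    have := K.AI (K.Iinsert H3 (by omega) (by omega))
    rw [h5] at this; push_cast at this; linarith
  have h6 : I.card ≠ 4 := by
    intro h4
    have hi1 : (P.image own).card ≤ 1 := by
      rw [card_le_one]
      intro a ha b hb
      obtain ⟨p, hp, rfl⟩ := mem_image.mp ha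
      obtain ⟨t, ht, rfl⟩ := mem_image.mp hb
      by_contra hne
      have hpt : p ≠ t := fun h => hne (h ▸ rfl)
      have hsub : insert p (insert t I) ⊆ A := by
        intro x hx; rw [mem_insert, mem_insert] at hx; rcases hx with rfl | rfl | hx
        exacts [K.PA hp, K.PA ht, K.IA hx]
      obtain ⟨S, hS, hSc, hSb⟩ := H3 _ (fun a ha b hb c hc => K.C.notri a (hsub ha) b (hsub hb) c (hsub hc))
        (show 6 ≤ (insert p (insert t I)).card by
          rw [card_insert_of_notMem, card_insert_of_notMem (K.PI t ht), h4]
          rw [mem_insert]; rintro (h | h); exacts [hpt h, K.PI p hp h])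
      have hall : ∀ a ∈ S, ∀ b ∈ S, a ≠ b → h a b := by
        intro a ha b hb hab
        by_contra hh
        have := K.C.clq S {a, b} (by
          intro x hx; rw [mem_insert, mem_singleton] at hx; rcases hx with rfl | rfl <;> assumption) (hS.trans hsub) hSb
          (blue_insert K.C.hsymm K.C.hirr (S := {b}) (by simpa using K.C.hirr b) (by simpa using hh))
        rw [card_pair hab] at this; omega
      have hSI : (S ∩ I).card ≤ 1 := by
        rw [card_le_one]
        intro a ha b hb
        rw [mem_inter] at ha hb
        by_contra hab
        exact K.Ih a ha.2 b hb.2 (hall a ha.1 b hb.1 hab)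
      have hSs : S ⊆ insert p (insert t (S ∩ I)) := by
        intro x hx
        have := hS hx
        simp only [mem_insert, mem_inter] at this ⊢
        tauto
      have hSI1 : 0 < (S ∩ I).card := by
        have := card_le_card hSs
        have := card_insert_le p (insert t (S ∩ I))
        have := card_insert_le t (S ∩ I)
        omega
      obtain ⟨x, hx⟩ := card_pos.mp hSI1
      rw [mem_inter] at hx
      have hpS : p ∈ S := by
        by_contra hh
        have h9 : S ⊆ insert t (S ∩ I) := by
          intro z hz
          have := hSs hz
          rw [mem_insert] at this
          rcases this with rfl | h; exacts [absurd hz hh, h]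
        have := card_le_card h9
        have := card_insert_le t (S ∩ I)
        omega
      have htS : t ∈ S := by
        by_contra hh
        have h9 : S ⊆ insert p (S ∩ I) := by
          intro z hz
          have := hSs hz
          rw [mem_insert, mem_insert] at this
          rw [mem_insert]
          rcases this with h | rfl | h; exacts [Or.inl h, absurd hz hh, Or.inr h]
        have := card_le_card h9
        have := card_insert_le p (S ∩ I)
        omega
      have e1 := K.ownu p hp x hx.2 (hall _ hpS _ hx.1 (K.ne hx.2 hp).symm)
      have e2 := K.ownu t ht x hx.2 (hall _ htS _ hx.1 (K.ne hx.2 ht).symm)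
      exact hne (e1.symm.trans e2)
    have h7 := K.unifImage hcl
    have h8 : ((P.image own).card : ℝ) ≤ 1 := by exact_mod_cast hi1
    rw [h4] at h3
    push_cast at h7 h3
    linarith
  have h4 : (I.card : ℝ) ≤ 3 := by exact_mod_cast (by omega)
  push_cast at h2
  linarith
end kcs

open Finset

section kcs
open Classical
variable {V : Type*} {r h : V → V → Prop} {A : Finset V} {q : ℕ} {y : V → ℝ} {I P : Finset V} {own : V → V}

lemma exists_trans (own : V → V) (P : Finset V) {n : ℕ} (hn : n ≤ (P.image own).card) :
    ∃ Q ⊆ P, Q.card = n ∧ ∀ a ∈ Q, ∀ b ∈ Q, own a = own b → a = b := by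
  obtain ⟨J, hJ, hJc⟩ := exists_subset_card_eq hn
  have : ∀ j, ∃ p, j ∈ J → p ∈ P ∧ own p = j := by
    intro j
    by_cases hj : j ∈ J
    · obtain ⟨p, hp, hpj⟩ := mem_image.mp (hJ hj)
      exact ⟨p, fun _ => ⟨hp, hpj⟩⟩
    · exact ⟨j, fun h => absurd h hj⟩
  choose f hf using this
  refine ⟨J.image f, ?_, ?_, ?_⟩
  · intro x hx
    obtain ⟨j, hj, rfl⟩ := mem_image.mp hx
    exact (hf j hj).1
  · rw [card_image_of_injOn, hJc]
    intro a ha b hb hab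
    have := (hf a ha).2
    rw [hab, (hf b hb).2] at this
    exact this.symm
  · intro a ha b hb hab
    obtain ⟨j, hj, rfl⟩ := mem_image.mp ha
    obtain ⟨k, hk, rfl⟩ := mem_image.mp hb
    rw [(hf j hj).2, (hf k hk).2] at hab
    rw [hab]

lemma KCS.q5 (K : KCS r h A 5 y I P own) : ∑ a ∈ A, y a < 7 := by
  by_contra hc
  push Not at hc
  have H3 := ramsey_three K.C.rsymm K.C.rirr
  have H4 := ramsey_four K.C.rsymm K.C.rirr
  have h1 := K.Icard H3 (by omega)
  have hcl : ∀ i ∈ I, (P.filter (fun t => own t = i)).card ≤ 3 := fun i hi => by have := K.clscard i hi; omega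
  have h2 := K.unif hcl
  have h3 := K.massP
  have h5 : I.card ≠ 5 := by
    intro h5
    by_cases him : (P.image own).card ≤ 3
    · have h7 := K.unifImage hcl
      have h8 : ((P.image own).card : ℝ) ≤ 3 := by exact_mod_cast him
      rw [h5] at h3
      push_cast at h7 h3
      linarith
    by_cases hPc : P.card ≤ 4
    · have h7 := K.cardbd
      have h8 : (P.card : ℝ) ≤ 4 := by exact_mod_cast hPc
      rw [h5] at h3
      push_cast at h3
      linarith
    obtain ⟨Q0, hQ0, hQ0c, hQ0i⟩ := exists_trans own P (show 4 ≤ (P.image own).card by omega)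
    obtain ⟨p, hp, hpQ⟩ : ∃ p ∈ P, p ∉ Q0 := by
      by_contra hh
      push Not at hh
      have := card_le_card (show P ⊆ Q0 from hh)
      omega
    set Q := insert p Q0 with hQ
    have hQP : Q ⊆ P := by
      intro x hx; rw [hQ, mem_insert] at hx; rcases hx with rfl | hx; exacts [hp, hQ0 hx]
    have hQc : Q.card = 5 := by rw [hQ, card_insert_of_notMem hpQ, hQ0c]
    have hQ' : ∀ Q' ⊆ Q, Q'.card = 4 → ∀ a ∈ Q', ∀ b ∈ Q', ¬ r a b := by
      intro Q' hQ'Q hQ'c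
      have hd : Disjoint I Q' := disjoint_left.mpr fun a ha hb => K.PI a (hQP (hQ'Q hb)) ha
      have hsub : I ∪ Q' ⊆ A := union_subset K.IA ((hQ'Q.trans hQP).trans K.PA)
      obtain ⟨S, hS, hSc, hSb⟩ := H4 _ (fun a ha b hb c hc => K.C.notri a (hsub ha) b (hsub hb) c (hsub hc))
        (show 9 ≤ (I ∪ Q').card by rw [card_union_of_disjoint hd]; omega)
      have hall : ∀ a ∈ S, ∀ b ∈ S, a ≠ b → h a b := by
        intro a ha b hb hab
        by_contra hh
        have := K.C.clq S {a, b} (by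
          intro x hx; rw [mem_insert, mem_singleton] at hx; rcases hx with rfl | rfl <;> assumption) (hS.trans hsub) hSb
          (blue_insert K.C.hsymm K.C.hirr (S := {b}) (by simpa using K.C.hirr b) (by simpa using hh))
        rw [card_pair hab] at this; omega
      have hSQ : S ⊆ Q' := by
        intro x hx
        rcases mem_union.mp (hS hx) with hxI | hxQ
        swap
        · exact hxQ
        exfalso
        have hP' : ∀ z ∈ S.erase x, z ∈ Q' ∧ own z = x := by
          intro z hz
          rw [mem_erase] at hz
          have hh := hall z hz.2 x hx hz.1
          rcases mem_union.mp (hS hz.2) with hzI | hzQ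
          · exact absurd hh (K.Ih z hzI x hxI)
          · exact ⟨hzQ, (K.ownu z (hQP (hQ'Q hzQ)) x hxI hh).symm⟩
        have hc3 : (S.erase x).card = 3 := by rw [card_erase_of_mem hx, hSc]
        have hc2 : 1 < ((S.erase x).erase p).card := by
          have := pred_card_le_card_erase (s := S.erase x) (a := p)
          omega
        obtain ⟨a, ha, b, hb, hab⟩ := one_lt_card.mp hc2
        have aux : ∀ a ∈ (S.erase x).erase p, a ∈ Q0 ∧ own a = x := by
          intro a ha
          rw [mem_erase] at ha
          have := hP' a ha.2
          have h9 := hQ'Q this.1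
          rw [hQ, mem_insert] at h9
          rcases h9 with h9 | h9; exacts [absurd h9 ha.1, ⟨h9, this.2⟩]
        exact hab (hQ0i a (aux a ha).1 b (aux b hb).1 ((aux a ha).2.trans (aux b hb).2.symm))
      have : S = Q' := eq_of_subset_of_card_le hSQ (by omega)
      rw [← this]; exact hSb
    have hQb : ∀ a ∈ Q, ∀ b ∈ Q, ¬ r a b := by
      intro a ha b hb
      obtain ⟨c, hcQ, hcab⟩ : ∃ c ∈ Q, c ∉ ({a, b} : Finset V) := by
        by_contra hh
        push Not at hh
        have := card_le_card (show Q ⊆ {a, b} from hh)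
        have : ({a, b} : Finset V).card ≤ 2 := card_le_two
        omega
      rw [mem_insert, mem_singleton] at hcab
      push Not at hcab
      exact hQ' (Q.erase c) (erase_subset _ _) (by rw [card_erase_of_mem hcQ, hQc]) a (mem_erase.mpr ⟨hcab.1.symm, ha⟩)
        b (mem_erase.mpr ⟨hcab.2.symm, hb⟩)
    have := K.C.clq Q {p} (by rw [singleton_subset_iff]; exact mem_insert_self _ _) (hQP.trans K.PA) hQb (by simpa using K.C.hirr p)
    rw [hQc, card_singleton] at this
    omega
  have h4 : (I.card : ℝ) ≤ 4 := by exact_mod_cast (by omega)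
  push_cast at h2
  linarith

/-- q = 6, seven independent vertices -/
lemma KCS.q6k7 (K : KCS r h A 6 y I P own) (hk : I.card = 7) : (P.image own).card ≤ 1 ∨ P.card ≤ 2 := by
  have H4 := ramsey_four K.C.rsymm K.C.rirr
  have s := K.C.rsymm
  -- two different classes give a blue K4
  have hlink : ∀ p ∈ P, ∀ t ∈ P, own p ≠ own t → 
      (¬ r (own p) (own t) ∧ ¬ r (own p) t ∧ ¬ r p (own t) ∧ ¬ r p t) := by
    intro p hp t ht hne
    have hpt : p ≠ t := fun h => hne (h ▸ rfl)
    have hsub : insert p (insert t I) ⊆ A := by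
      intro x hx; rw [mem_insert, mem_insert] at hx; rcases hx with rfl | rfl | hx
      exacts [K.PA hp, K.PA ht, K.IA hx]
    obtain ⟨S, hS, hSc, hSb⟩ := H4 _ (fun a ha b hb c hc => K.C.notri a (hsub ha) b (hsub hb) c (hsub hc))
      (show 9 ≤ (insert p (insert t I)).card by
        rw [card_insert_of_notMem, card_insert_of_notMem (K.PI t ht), hk]
        rw [mem_insert]; rintro (h | h); exacts [hpt h, K.PI p hp h])
    have hmem : ∀ x ∈ S, x = p ∨ x = t ∨ x ∈ I := by
      intro x hx; have := hS hx; rwa [mem_insert, mem_insert] at this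
    -- removing any vertex leaves a half edge
    have go : ∀ x, ∃ a ∈ S, ∃ b ∈ S, a ≠ x ∧ b ≠ x ∧ h a b := by
      intro x
      by_contra hcon
      push Not at hcon
      have := K.C.clq S (S.erase x) (erase_subset _ _) (hS.trans hsub) hSb (by
        intro a ha b hb
        rw [mem_erase] at ha hb
        exact hcon a ha.2 b hb.2 ha.1 hb.1)
      have h3 := pred_card_le_card_erase (s := S) (a := x)
      omega
    have g1 : p ∈ S ∧ own p ∈ S := by
      obtain ⟨a, ha, b, hb, hat, hbt, hab⟩ := go t
      rcases hmem a ha with rfl | rfl | haI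
      · rcases hmem b hb with rfl | rfl | hbI
        · exact absurd hab (K.C.hirr _)
        · exact absurd rfl hbt
        · exact ⟨ha, K.ownu _ hp b hbI hab ▸ hb⟩
      · exact absurd rfl hat
      · rcases hmem b hb with rfl | rfl | hbI
        · exact ⟨hb, K.ownu _ hp a haI (K.C.hsymm _ _ hab) ▸ ha⟩
        · exact absurd rfl hbt
        · exact absurd hab (K.Ih _ haI _ hbI)
    have g2 : t ∈ S ∧ own t ∈ S := by
      obtain ⟨a, ha, b, hb, hat, hbt, hab⟩ := go p
      rcases hmem a ha with rfl | rfl | haI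
      · exact absurd rfl hat
      · rcases hmem b hb with rfl | rfl | hbI
        · exact absurd rfl hbt
        · exact absurd hab (K.C.hirr _)
        · exact ⟨ha, K.ownu _ ht b hbI hab ▸ hb⟩
      · rcases hmem b hb with rfl | rfl | hbI
        · exact absurd rfl hbt
        · exact ⟨hb, K.ownu _ ht a haI (K.C.hsymm _ _ hab) ▸ ha⟩
        · exact absurd hab (K.Ih _ haI _ hbI)
    exact ⟨hSb _ g1.2 _ g2.2, hSb _ g1.2 _ g2.1, hSb _ g1.1 _ g2.2, hSb _ g1.1 _ g2.1⟩
  by_contra hcon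
  push Not at hcon
  obtain ⟨hc1, hc2⟩ := hcon
  obtain ⟨a, ha, b, hb, hab⟩ := one_lt_card.mp hc1
  obtain ⟨p, hp, rfl⟩ := mem_image.mp ha
  obtain ⟨t, ht, rfl⟩ := mem_image.mp hb
  obtain ⟨u, hu, hupt⟩ : ∃ u ∈ P, u ∉ ({p, t} : Finset V) := by
    by_contra hh
    push Not at hh
    have := card_le_card (show P ⊆ {p, t} from hh)
    have : ({p, t} : Finset V).card ≤ 2 := card_le_two
    omega
  rw [mem_insert, mem_singleton] at hupt
  push Not at hupt
  -- generic: all of Z = {p,t,u} ∪ own is blue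
  have hblue : ∀ a ∈ ({p, t, u} : Finset V) ∪ ({p, t, u} : Finset V).image own, 
      ∀ b ∈ ({p, t, u} : Finset V) ∪ ({p, t, u} : Finset V).image own, ¬ r a b := by
    have hZ : ∀ z ∈ ({p, t, u} : Finset V), z ∈ P := by
      intro z hz; simp only [mem_insert, mem_singleton] at hz; rcases hz with rfl | rfl | rfl <;> assumption
    have c1 : ∀ z ∈ P, ∀ w ∈ P, ¬ r z w ∧ ¬ r (own z) w ∧ ¬ r z (own w) ∧ ¬ r (own z) (own w) := by
      intro z hz w hw
      by_cases hzw : own z = own w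
      · have e1 : ¬ r z (own z) := K.rb (K.PA hz) (K.IA (K.ownI z hz)) (K.ownh z hz)
        have e2 : ¬ r w (own w) := K.rb (K.PA hw) (K.IA (K.ownI w hw)) (K.ownh w hw)
        refine ⟨?_, ?_, ?_, ?_⟩
        · by_cases hh : z = w
          · subst hh; exact K.C.rirr _
          · exact K.rb (K.PA hz) (K.PA hw) (K.Pcl z hz w hw hzw hh)
        · rw [hzw]; exact fun h => e2 (s _ _ h)
        · rw [← hzw]; exact e1
        · rw [hzw]; exact K.C.rirr _
      · obtain ⟨d1, d2, d3, d4⟩ := hlink z hz w hw hzw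
        exact ⟨d4, d2, d3, d1⟩
    intro a ha b hb
    rw [mem_union, mem_image] at ha hb
    rcases ha with ha | ⟨a, ha, rfl⟩ <;> rcases hb with hb | ⟨b, hb, rfl⟩
    · exact (c1 a (hZ a ha) b (hZ b hb)).1
    · exact (c1 a (hZ a ha) b (hZ b hb)).2.2.1
    · exact (c1 a (hZ a ha) b (hZ b hb)).2.1
    · exact (c1 a (hZ a ha) b (hZ b hb)).2.2.2
  have hZ : ({p, t, u} : Finset V) ⊆ P := by
    intro z hz; simp only [mem_insert, mem_singleton] at hz; rcases hz with rfl | rfl | rfl <;> assumption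
  have hZI : ({p, t, u} : Finset V).image own ⊆ I := by
    intro z hz; obtain ⟨w, hw, rfl⟩ := mem_image.mp hz; exact K.ownI w (hZ hw)
  have hZc : ({p, t, u} : Finset V).card = 3 := by
    rw [card_eq_three]; exact ⟨p, t, u, fun h => hab (h ▸ rfl), hupt.1.symm, hupt.2.symm, rfl⟩
  have hIm : 2 ≤ (({p, t, u} : Finset V).image own).card := by
    refine one_lt_card.mpr ⟨own p, mem_image_of_mem _ (by simp), own t, mem_image_of_mem _ (by simp), hab⟩
  have := K.C.clq _ (({p, t, u} : Finset V).image own) subset_union_right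
    (union_subset (hZ.trans K.PA) (hZI.trans K.IA)) hblue (fun a ha b hb => K.Ih a (hZI ha) b (hZI hb))
  rw [card_union_of_disjoint (disjoint_left.mpr fun z hz hz' => K.PI z (hZ hz) (hZI hz')), hZc] at this
  omega
end kcs

open Finset

section kcs
open Classical
variable {V : Type*} {r h : V → V → Prop} {A : Finset V} {q : ℕ} {y : V → ℝ} {I P : Finset V} {own : V → V}

lemma KCS.ey (K : KCS r h A 6 y I P own) (hk : I.card = 6) {a b c d : V} (ha : a ∈ P) (hb : b ∈ P) (hc : c ∈ P)
    (hd : d ∈ P) (oab : own a ≠ own b) (oac : own a ≠ own c) (oad : own a ≠ own d) (obc : own b ≠ own c)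
    (obd : own b ≠ own d) (ocd : own c ≠ own d) (nac : ¬ h a c) (nad : ¬ h a d) (nbc : ¬ h b c) (nbd : ¬ h b d)
    (ncd : ¬ h c d) : False := by
  have ia := K.ownI a ha
  have ib := K.ownI b hb
  have ic := K.ownI c hc
  have id' := K.ownI d hd
  have hc2 : (I \ {own a, own b, own c, own d}).card = 2 := by
    rw [card_sdiff_of_subset, hk]
    · rw [card_insert_of_notMem, card_insert_of_notMem, card_insert_of_notMem, card_singleton]
      all_goals simp only [mem_insert, mem_singleton]; tauto
    · intro x hx; simp only [mem_insert, mem_singleton] at hx; rcases hx with rfl | rfl | rfl | rfl <;> assumption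
  obtain ⟨x, z, hxz, he⟩ := card_eq_two.mp hc2
  have hx : x ∈ I \ {own a, own b, own c, own d} := by rw [he]; simp
  have hz : z ∈ I \ {own a, own b, own c, own d} := by rw [he]; simp
  simp only [mem_sdiff, mem_insert, mem_singleton, not_or] at hx hz
  have hs := K.C.hsymm
  have ss : ∀ {u v}, ¬ h u v → ¬ h v u := fun hh h' => hh (hs _ _ h')
  have hAll : ∀ i ∈ I, ∀ p ∈ P, i ≠ own p → ¬ h i p ∧ ¬ h p i ∧ i ≠ p := fun i hi p hp hne =>
    ⟨K.IP hi hp hne, ss (K.IP hi hp hne), K.ne hi hp⟩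
  obtain ⟨hxI, xa, xb, xc, xd⟩ := hx
  obtain ⟨hzI, za, zb, zc, zd⟩ := hz
  have nab : a ≠ b := fun h => oab (h ▸ rfl)
  have nac' : a ≠ c := fun h => oac (h ▸ rfl)
  have nad' : a ≠ d := fun h => oad (h ▸ rfl)
  have nbc' : b ≠ c := fun h => obc (h ▸ rfl)
  have nbd' : b ≠ d := fun h => obd (h ▸ rfl)
  have ncd' : c ≠ d := fun h => ocd (h ▸ rfl)
  have hI : ∀ i ∈ I, ∀ p ∈ P, i ≠ p := fun i hi p hp => K.ne hi hp
  let f : Fin 6 → V := ![own a, own b, own c, own d, x, z]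
  let g : Fin 4 → V := ![a, b, c, d]
  have fI : ∀ i, f i ∈ I := by intro i; fin_cases i <;> assumption
  have gP : ∀ i, g i ∈ P := by intro i; fin_cases i <;> assumption
  have finj : ∀ i j, i ≠ j → f i ≠ f j := by
    intro i j hij
    fin_cases i <;> fin_cases j <;> first
      | exact absurd rfl hij
      | assumption
      | (apply Ne.symm; assumption)
  have ginj : ∀ i j, i ≠ j → g i ≠ g j := by
    intro i j hij
    fin_cases i <;> fin_cases j <;> first
      | exact absurd rfl hij
      | assumption
      | (apply Ne.symm; assumption)
  have gown : ∀ (i : Fin 4) (j : Fin 6), h (f j) (g i) → j = ⟨i.1, by omega⟩ := by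
    intro i j hij
    have h1 := K.ownu (g i) (gP i) (f j) (fI j) (hs _ _ hij)
    have h2 : own (g i) = f ⟨i.1, by omega⟩ := by fin_cases i <;> rfl
    by_contra hne
    exact finj _ _ hne (h1.trans h2)
  have gg : ∀ i j : Fin 4, h (g i) (g j) → (i = 0 ∧ j = 1) ∨ (i = 1 ∧ j = 0) := by
    intro i j hij
    fin_cases i <;> fin_cases j <;> first
      | exact absurd hij (K.C.hirr _)
      | (simp; done)
      | (exfalso; revert hij; assumption)
      | (exfalso; revert hij; apply ss; assumption)
  let e : Fin 10 → V := fun i => if hi : i.1 < 6 then f ⟨i.1, hi⟩ else g ⟨i.1 - 6, by omega⟩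
  have e1 : ∀ i : Fin 10, (hi : i.1 < 6) → e i = f ⟨i.1, hi⟩ := fun i hi => dif_pos hi
  have e2 : ∀ i : Fin 10, (hi : ¬ i.1 < 6) → e i = g ⟨i.1 - 6, by omega⟩ := fun i hi => dif_neg hi
  refine ey_lemma K.C e ?_ ?_ ?_
  · intro i j hij
    by_cases hi : i.1 < 6 <;> by_cases hj : j.1 < 6
    · rw [e1 i hi, e1 j hj] at hij
      by_contra hne
      exact finj _ _ (by intro h; apply hne; simpa [Fin.ext_iff] using h) hij
    · rw [e1 i hi, e2 j hj] at hij
      exact absurd hij (hI _ (fI _) _ (gP _))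
    · rw [e2 i hi, e1 j hj] at hij
      exact absurd hij.symm (hI _ (fI _) _ (gP _))
    · rw [e2 i hi, e2 j hj] at hij
      by_contra hne
      exact ginj _ _ (by intro h; apply hne; simp [Fin.ext_iff] at h ⊢; omega) hij
  · intro i
    by_cases hi : i.1 < 6
    · rw [e1 i hi]; exact K.IA (fI _)
    · rw [e2 i hi]; exact K.PA (gP _)
  · have p1 : ∀ i j : Fin 10, i.1 < 6 → ¬ j.1 < 6 → i.1 = j.1 - 6 → hpE i j ∧ hpE j i := by decide
    have p2 : ∀ i j : Fin 10, ((i = 6 ∧ j = 7) ∨ (i = 7 ∧ j = 6)) → hpE i j := by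
      rintro i j (⟨rfl, rfl⟩ | ⟨rfl, rfl⟩) <;> decide
    intro i j hij
    by_cases hi : i.1 < 6 <;> by_cases hj : j.1 < 6
    · rw [e1 i hi, e1 j hj] at hij
      exact absurd hij (K.Ih _ (fI _) _ (fI _))
    · rw [e1 i hi, e2 j hj] at hij
      have := gown _ _ hij
      exact (p1 i j hi hj (by simpa [Fin.ext_iff] using this)).1
    · rw [e2 i hi, e1 j hj] at hij
      have := gown _ _ (hs _ _ hij)
      exact (p1 j i hj hi (by simpa [Fin.ext_iff] using this)).2
    · rw [e2 i hi, e2 j hj] at hij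
      have := gg _ _ hij
      refine p2 i j ?_
      simp only [Fin.ext_iff] at this ⊢
      simp at this ⊢
      omega

lemma KCS.q6k6 (K : KCS r h A 6 y I P own) (hk : I.card = 6) (hM : 3975/1000 ≤ ∑ t ∈ P, y t) : False := by
  have hcl : ∀ i ∈ I, (P.filter (fun t => own t = i)).card ≤ 3 := by
    intro i hi
    by_contra hc
    obtain ⟨b1, b2, b3⟩ := K.clsblue i hi
    obtain ⟨W, hW, hWc⟩ := exists_subset_card_eq (show 4 ≤ (P.filter (fun t => own t = i)).card by omega)
    have hWs : insert i W ⊆ insert i (P.filter (fun t => own t = i)) := insert_subset_insert _ hW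
    have hWP : ∀ w ∈ W, w ∈ P ∧ own w = i := fun w hw => mem_filter.mp (hW hw)
    refine k5_lemma K.C (insert i W) (I.erase i) (hWs.trans b2) ((erase_subset _ _).trans K.IA) ?_ ?_ ?_ ?_ ?_ ?_
    · rw [card_insert_of_notMem, hWc]
      exact fun h => K.PI i (hWP i h).1 hi
    · rw [card_erase_of_mem hi, hk]
    · rw [disjoint_left]
      intro x hx hx'
      rw [mem_erase] at hx'
      rcases mem_insert.mp hx with rfl | hx
      · exact hx'.1 rfl
      · exact K.PI x (hWP x hx).1 hx'.2
    · exact fun a ha b hb => b1 a (hWs ha) b (hWs hb)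
    · exact fun a ha b hb => K.Ih a (mem_of_mem_erase ha) b (mem_of_mem_erase hb)
    · intro a ha b hb hab
      rw [mem_erase] at hb
      rcases mem_insert.mp ha with rfl | ha
      · exact K.Ih a hi b hb.2 hab
      · exact hb.1 ((K.ownu a (hWP a ha).1 b hb.2 hab).trans (hWP a ha).2)
  have hPc : P.card ≤ 18 := by
    rw [← K.cardP]
    calc _ ≤ ∑ i ∈ I, 3 := sum_le_sum hcl
      _ = 18 := by rw [sum_const, hk]; rfl
  have hPne : P.Nonempty := by
    rw [nonempty_iff_ne_empty]; rintro rfl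
    rw [sum_empty] at hM; norm_num at hM
  obtain ⟨p, hp, hpm⟩ := exists_max_image P y hPne
  have hMlow : 22/100 ≤ y p := by
    have := sum_le_card_nsmul P y (y p) hpm
    rw [nsmul_eq_mul] at this
    have h18 : (P.card : ℝ) ≤ 18 := by exact_mod_cast hPc
    have := K.pos p (K.PA hp)
    nlinarith
  -- splitting P by a vertex
  have split : ∀ t ∈ P, ∀ B ⊆ P, ∑ x ∈ B, y x - (1 - y t) * (1000/499) ≤
      ∑ x ∈ B.filter (fun x => ¬ (own x = own t ∨ h t x)), y x := by
    intro t ht B hB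
    have h1 := K.nb ht
    have h2 := sum_filter_add_sum_filter_not B (fun x => own x = own t ∨ h t x) y
    have h3 : ∑ x ∈ B.filter (fun x => (own x = own t ∨ h t x)), y x ≤ ∑ x ∈ P.filter (fun x => (own x = own t ∨ h t x)), y x :=
      sum_le_sum_of_subset_of_nonneg (filter_subset_filter _ hB) (fun a ha _ => (K.pos a (K.PA (mem_filter.mp ha).1)).le)
    linarith
  set A' := P.filter (fun x => ¬ (own x = own p ∨ h p x)) with hA'
  have hA'P : A' ⊆ P := filter_subset _ _
  have hA'm : ∀ x ∈ A', own x ≠ own p ∧ ¬ h p x := fun x hx => not_or.mp (mem_filter.mp hx).2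
  have hA's := split p hp P subset_rfl
  rw [← hA'] at hA's
  -- the set of members of cross-class nonadjacent pairs
  set R := A'.filter (fun x => ∃ t ∈ A', own t ≠ own x ∧ ¬ h x t) with hR
  have hA'ne : A'.Nonempty := by
    rw [nonempty_iff_ne_empty]; intro h0
    rw [h0, sum_empty] at hA's
    linarith
  have hRne : R.Nonempty := by
    by_contra hR0
    rw [not_nonempty_iff_eq_empty] at hR0
    obtain ⟨t, ht⟩ := hA'ne
    have h1 := split t (hA'P ht) A' hA'P
    have h2 : A'.filter (fun x => ¬ (own x = own t ∨ h t x)) = ∅ := by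
      rw [filter_eq_empty_iff]
      intro x hx hh
      rw [not_or] at hh
      have : t ∈ R := mem_filter.mpr ⟨ht, x, hx, hh.1, hh.2⟩
      rw [hR0] at this; simp at this
    rw [h2, sum_empty] at h1
    have := K.pos t (K.PA (hA'P ht))
    linarith
  obtain ⟨u, huR, hum⟩ := exists_max_image R y hRne
  obtain ⟨huA', w, hwA', hwu, hnuw⟩ := mem_filter.mp huR
  have h1 := split u (hA'P huA') A' hA'P
  set B := A'.filter (fun x => ¬ (own x = own u ∨ h u x)) with hB
  have hBm : ∀ x ∈ B, x ∈ A' ∧ own x ≠ own u ∧ ¬ h u x := fun x hx => ⟨(mem_filter.mp hx).1, not_or.mp (mem_filter.mp hx).2⟩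
  have hBcls : B ⊆ P.filter (fun t => own t = own w) := by
    intro x hx
    obtain ⟨hxA, hxu, hux⟩ := hBm x hx
    refine mem_filter.mpr ⟨hA'P hxA, ?_⟩
    by_contra hne
    have sy := K.C.hsymm
    exact K.ey hk (hA'P hwA') (hA'P hxA) hp (hA'P huA') (fun h => hne h.symm) (hA'm w hwA').1 hwu (hA'm x hxA).1 hxu
      (hA'm u huA').1.symm (fun h => (hA'm w hwA').2 (sy _ _ h)) (fun h => hnuw (sy _ _ h)) (fun h => (hA'm x hxA).2 (sy _ _ h))
      (fun h => hux (sy _ _ h)) (hA'm u huA').2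
  have hBc : B.card ≤ 3 := (card_le_card hBcls).trans (hcl _ (K.ownI w (hA'P hwA')))
  have hBy : ∀ x ∈ B, y x ≤ y u := by
    intro x hx
    obtain ⟨hxA, hxu, hux⟩ := hBm x hx
    exact hum x (mem_filter.mpr ⟨hxA, u, huA', hxu.symm, fun h => hux (K.C.hsymm _ _ h)⟩)
  have h2 := sum_le_card_nsmul B y (y u) hBy
  rw [nsmul_eq_mul] at h2
  have h3 : (B.card : ℝ) ≤ 3 := by exact_mod_cast hBc
  have h4 := K.pos u (K.PA (hA'P huA'))
  have h5 := hpm u (hA'P huA')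
  have h6 : (B.card : ℝ) * y u ≤ 3 * y u := by nlinarith
  linarith

lemma KCS.q6 (K : KCS r h A 6 y I P own) : ∑ a ∈ A, y a < 8 := by
  by_contra hc
  push Not at hc
  have H4 := ramsey_four K.C.rsymm K.C.rirr
  have H6 := ramsey_six K.C.rsymm K.C.rirr
  have h1 := K.Icard H4 (by omega)
  have hcl : ∀ i ∈ I, (P.filter (fun t => own t = i)).card ≤ 4 := fun i hi => by have := K.clscard i hi; omega
  have h2 := K.unif hcl
  have h3 := K.massP
  have h8 : I.card ≠ 8 := by
    intro h8
    have hAI := K.Iinsert H4 (by omega) (by omega)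
    have hAe : A = I := subset_antisymm hAI K.IA
    have : ∑ a ∈ A, y a < ∑ a ∈ A, (1:ℝ) := by
      refine sum_lt_sum_of_nonempty ?_ fun a ha => ?_
      · rw [hAe, ← card_pos]; omega
      · have h1 := K.loss a ha
        have : 0 ≤ ∑ j ∈ A.filter (fun j => h a j), y j := sum_nonneg fun j hj => (K.pos j (mem_filter.mp hj).1).le
        linarith
    rw [sum_const, nsmul_eq_mul, hAe, h8] at this
    rw [hAe] at hc
    norm_num at this
    linarith
  have h7 : I.card ≠ 7 := by
    intro h7
    rw [h7] at h3
    push_cast at h3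
    rcases K.q6k7 h7 with hh | hh
    · have h9 := K.unifImage hcl
      have h8 : ((P.image own).card : ℝ) ≤ 1 := by exact_mod_cast hh
      push_cast at h9
      linarith
    · have h9 := K.cardbd
      have h8 : (P.card : ℝ) ≤ 2 := by exact_mod_cast hh
      linarith
  have h6 : I.card ≠ 6 := by
    intro h6
    rw [h6] at h3
    push_cast at h3
    exact K.q6k6 h6 (by linarith)
  have h5 : I.card ≠ 5 := by
    intro h5
    rw [h5] at h3
    push_cast at h3
    have hA19 : A.card ≤ 19 := by
      by_contra hA
      obtain ⟨S, hS, hSc, hSb⟩ := H6 A (K.C.notri) (by omega)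
      obtain ⟨x, hx⟩ := card_pos.mp (show 0 < S.card by omega)
      have := K.C.clq S {x} (by simpa using hx) hS hSb (by simpa using K.C.hirr x)
      rw [card_singleton] at this; omega
    have hP14 : P.card ≤ 14 := by
      have : (I ∪ P).card ≤ A.card := card_le_card (union_subset K.IA K.PA)
      rw [card_union_of_disjoint (disjoint_left.mpr fun z hz hz' => K.PI z hz' hz)] at this
      omega
    have hlin : ∀ i ∈ I, ∑ t ∈ P.filter (fun t => own t = i), y t ≤
        12015/10000 + 16/100 * (((P.filter (fun t => own t = i)).card : ℝ) - 3) := by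
      intro i hi
      have hc4 := hcl i hi
      have := K.cls i le_rfl
      generalize (P.filter (fun t => own t = i)).card = s at *
      interval_cases s <;> norm_num at this ⊢ <;> linarith
    have := sum_le_sum hlin
    rw [K.sumP, sum_add_distrib, ← mul_sum, sum_sub_distrib, ← Nat.cast_sum, K.cardP, sum_const, sum_const, h5] at this
    have h14 : (P.card : ℝ) ≤ 14 := by exact_mod_cast hP14
    norm_num at this
    linarith
  have h4 : (I.card : ℝ) ≤ 4 := by exact_mod_cast (by omega)
  push_cast at h2
  linarith

theorem kc_main (hq : q ≤ 6) (C : RCfg r h A q) (hb : ∀ a ∈ A, ∀ b ∈ A, h a b → ¬ r a b)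
    (pos : ∀ a ∈ A, 0 < y a)
    (loss : ∀ a ∈ A, y a + 499/1000 * ∑ j ∈ A.filter (fun j => h a j), y j < 1) :
    ∑ a ∈ A, y a < q + 2 := by
  have small : ∀ q, q ≤ 2 → RCfg r h A q → A.card ≤ q := by
    intro q hq C
    by_contra hc
    by_cases hq2 : q = 2
    · subst hq2
      obtain ⟨S, hS, hSc, hSb⟩ := ramsey_two C.rsymm C.rirr A C.notri (by omega)
      obtain ⟨x, hx⟩ := card_pos.mp (show 0 < S.card by omega)
      have := C.clq S {x} (by simpa using hx) hS hSb (by simpa using C.hirr x)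
      rw [card_singleton] at this; omega
    · obtain ⟨x, hx⟩ := card_pos.mp (show 0 < A.card by omega)
      have := C.clq {x} {x} subset_rfl (by simpa using hx) (by simpa using C.rirr x) (by simpa using C.hirr x)
      rw [card_singleton] at this; omega
  by_cases h2 : q ≤ 2
  · have h1 := small q h2 C
    have : ∑ a ∈ A, y a ≤ ∑ a ∈ A, (1:ℝ) := by
      refine sum_le_sum fun a ha => ?_
      have h1 := loss a ha
      have : 0 ≤ ∑ j ∈ A.filter (fun j => h a j), y j := sum_nonneg fun j hj => (pos j (mem_filter.mp hj).1).le
      linarith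
    rw [sum_const, nsmul_eq_mul, mul_one] at this
    have h1' : (A.card : ℝ) ≤ q := by exact_mod_cast h1
    linarith
  obtain ⟨I, P, own, K⟩ := kcs_exists C hb pos loss
  have : q = 3 ∨ q = 4 ∨ q = 5 ∨ q = 6 := by omega
  rcases this with rfl | rfl | rfl | rfl
  · have := K.q3; push_cast; linarith
  · have := K.q4; push_cast; linarith
  · have := K.q5; push_cast; linarith
  · have := K.q6; push_cast; linarith
end kcs

open Finset

section lag
open Classical
variable {V : Type*} [Fintype V]

/-- reduced coloured structure -/
structure RedS (e r h : V → V → Prop) (Rt : V → Prop) : Prop where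
  esymm : ∀ a b, e a b → e b a
  rsymm : ∀ a b, r a b → r b a
  hsymm : ∀ a b, h a b → h b a
  eirr : ∀ a, ¬ e a a
  re : ∀ a b, r a b → e a b
  he : ∀ a b, h a b → e a b
  hr : ∀ a b, h a b → ¬ r a b
  rR : ∀ a b, r a b → ¬ Rt a
  hR : ∀ a b, h a b → ¬ Rt a
  notri : ∀ a b c, r a b → r b c → r a c → False
  clq : ∀ S T : Finset V, T ⊆ S → (∀ a ∈ S, ∀ b ∈ S, a ≠ b → e a b ∧ ¬ r a b) →
    (∀ a ∈ T, ¬ Rt a) → (∀ a ∈ T, ∀ b ∈ T, ¬ h a b) → S.card + T.card ≤ 6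

variable {e r h : V → V → Prop} {Rt : V → Prop}

lemma RedS.rirr (D : RedS e r h Rt) (a : V) : ¬ r a a := fun hh => D.eirr a (D.re _ _ hh)
lemma RedS.hirr (D : RedS e r h Rt) (a : V) : ¬ h a a := fun hh => D.eirr a (D.he _ _ hh)

lemma RedS.kc (D : RedS e r h Rt) (A : Finset V) (hA : ∀ a ∈ A, ∀ b ∈ A, a ≠ b → e a b) (y : V → ℝ)
    (pos : ∀ a ∈ A, 0 < y a)
    (loss : ∀ a ∈ A, y a + 499/1000 * ∑ j ∈ A.filter (fun j => h a j), y j < 1) :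
    ∑ a ∈ A, y a < 8 := by
  set AR := A.filter (fun a => Rt a) with hAR
  set AB := A.filter (fun a => ¬ Rt a) with hAB
  have mR : ∀ a ∈ AR, a ∈ A ∧ Rt a := fun a ha => mem_filter.mp ha
  have mB : ∀ a ∈ AB, a ∈ A ∧ ¬ Rt a := fun a ha => mem_filter.mp ha
  have hdisj : ∀ S ⊆ AB, Disjoint AR S := fun S hS => disjoint_left.mpr fun a ha hb => (mB a (hS hb)).2 (mR a ha).2
  have key : ∀ S T : Finset V, T ⊆ S → S ⊆ AB → (∀ a ∈ S, ∀ b ∈ S, ¬ r a b) →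
      (∀ a ∈ T, ∀ b ∈ T, ¬ h a b) → AR.card + S.card + T.card ≤ 6 := by
    intro S T hTS hSB hS hT
    rw [← card_union_of_disjoint (hdisj S hSB)]
    refine D.clq _ T (hTS.trans subset_union_right) ?_ (fun a ha => (mB a (hSB (hTS ha))).2) hT
    intro a ha b hb hab
    rw [mem_union] at ha hb
    refine ⟨hA a ?_ b ?_ hab, ?_⟩
    · exact ha.elim (fun h => (mR a h).1) (fun h => (mB a (hSB h)).1)
    · exact hb.elim (fun h => (mR b h).1) (fun h => (mB b (hSB h)).1)
    · intro hr
      rcases ha with ha | ha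
      · exact D.rR _ _ hr (mR a ha).2
      rcases hb with hb | hb
      · exact D.rR _ _ (D.rsymm _ _ hr) (mR b hb).2
      exact hS a ha b hb hr
  have hRc : AR.card ≤ 6 := by
    have := key ∅ ∅ subset_rfl (empty_subset _) (by simp) (by simp)
    simpa using this
  have C : RCfg r h AB (6 - AR.card) :=
    ⟨D.rsymm, D.hsymm, D.rirr, D.hirr, fun a _ b _ c _ => D.notri a b c, fun S T h1 h2 h3 h4 => by
      have := key S T h1 h2 h3 h4; omega⟩
  have h1 := kc_main (y := y) (by omega) C (fun a _ b _ => D.hr a b) (fun a ha => pos a (mB a ha).1) (by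
    intro a ha
    refine lt_of_le_of_lt ?_ (loss a (mB a ha).1)
    have : ∑ j ∈ AB.filter (fun j => h a j), y j ≤ ∑ j ∈ A.filter (fun j => h a j), y j :=
      sum_le_sum_of_subset_of_nonneg (filter_subset_filter _ (filter_subset _ _))
        (fun j hj _ => (pos j (mem_filter.mp hj).1).le)
    linarith)
  have h2 : ∑ a ∈ AR, y a ≤ ∑ a ∈ AR, (1:ℝ) := by
    refine sum_le_sum fun a ha => ?_
    have h1 := loss a (mR a ha).1
    have : 0 ≤ ∑ j ∈ A.filter (fun j => h a j), y j := sum_nonneg fun j hj => (pos j (mem_filter.mp hj).1).le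
    linarith
  rw [sum_const, nsmul_eq_mul, mul_one] at h2
  have h3 := sum_filter_add_sum_filter_not A (fun a => Rt a) y
  rw [Nat.cast_sub hRc] at h1
  rw [← h3]
  push_cast at h1
  linarith

noncomputable def wt (e h : V → V → Prop) (i j : V) : ℝ := if e i j then (if h i j then 501/1000 else 1) else 0

lemma RedS.lag_simplex (D : RedS e r h Rt) (x : V → ℝ) (hx : x ∈ stdSimplex ℝ V) :
    ∑ i, ∑ j, wt e h i j * (x i * x j) ≤ 7/8 := by
  set M : Matrix V V ℝ := wt e h with hMdef
  have Msymm : ∀ i j, M i j = M j i := by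
    intro i j
    have he : e i j ↔ e j i := ⟨D.esymm _ _, D.esymm _ _⟩
    have hh : h i j ↔ h j i := ⟨D.hsymm _ _, D.hsymm _ _⟩
    simp only [hMdef, wt, he, hh]
  have M1 : ∀ i j, 0 ≤ M i j ∧ M i j ≤ 1 := by
    intro i j; simp only [hMdef, wt]; split_ifs <;> norm_num
  have Mii : ∀ i, M i i = 0 := fun i => by simp only [hMdef, wt, if_neg (D.eirr i)]
  set f : (V → ℝ) → ℝ := fun x => x ⬝ᵥ (M.mulVec x) with hf
  have ff : ∀ x : V → ℝ, f x = ∑ i, ∑ j, wt e h i j * (x i * x j) := by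
    intro x
    simp only [hf, dotProduct, Matrix.mulVec, mul_sum]
    refine sum_congr rfl fun i _ => sum_congr rfl fun j _ => ?_
    rw [hMdef]; ring
  rw [← ff]
  have hcont : Continuous f := by
    have : f = fun x => ∑ i, ∑ j, wt e h i j * (x i * x j) := funext ff
    rw [this]; fun_prop
  obtain ⟨x0, hx0, hx0max⟩ := (isCompact_stdSimplex ℝ V).exists_isMaxOn ⟨x, hx⟩ hcont.continuousOn
  -- choose a maximizer with minimal support
  have hex : ∃ n : ℕ, ∃ z ∈ stdSimplex ℝ V, (∀ w ∈ stdSimplex ℝ V, f w ≤ f z) ∧ (univ.filter (fun i => 0 < z i)).card = n :=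
    ⟨_, x0, hx0, fun w hw => hx0max hw, rfl⟩
  obtain ⟨z, hz, hzmax, hzn⟩ := Nat.find_spec hex
  have hzmin : ∀ z' ∈ stdSimplex ℝ V, (∀ w ∈ stdSimplex ℝ V, f w ≤ f z') →
      (univ.filter (fun i => 0 < z i)).card ≤ (univ.filter (fun i => 0 < z' i)).card := by
    intro z' h1 h2
    rw [hzn]
    exact Nat.find_min' hex ⟨z', h1, h2, rfl⟩
  refine (hzmax x hx).trans ?_
  by_contra hcon
  push Not at hcon
  have hz0 : ∀ i, 0 ≤ z i := hz.1
  have hz1 : ∑ i, z i = 1 := hz.2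
  -- shifting
  have shift : ∀ i j, ∀ t : ℝ, i ≠ j → f (z + (Pi.single i t - Pi.single j t)) =
      f z + 2 * t * (M.mulVec z i - M.mulVec z j) - 2 * t^2 * M i j := by
    intro i j t hij
    have comm : ∀ u : V → ℝ, z ⬝ᵥ (M.mulVec u) = u ⬝ᵥ (M.mulVec z) := by
      intro u
      have hT : M.transpose = M := by ext a b; exact Msymm b a
      rw [Matrix.dotProduct_mulVec, ← Matrix.mulVec_transpose, hT, dotProduct_comm]
    simp only [hf]
    rw [Matrix.mulVec_add, add_dotProduct, dotProduct_add, dotProduct_add]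
    have e1 : (Pi.single i t - Pi.single j t : V → ℝ) ⬝ᵥ (M.mulVec z) = t * (M.mulVec z i - M.mulVec z j) := by
      rw [sub_dotProduct, single_dotProduct, single_dotProduct]; ring
    have e2 : (Pi.single i t - Pi.single j t : V → ℝ) ⬝ᵥ (M.mulVec (Pi.single i t - Pi.single j t)) = - 2 * t^2 * M i j := by
      rw [sub_dotProduct, single_dotProduct, single_dotProduct, Matrix.mulVec_sub]
      have ms : ∀ k i : V, M.mulVec (Pi.single i t) k = M k i * t := by
        intro k i
        show (fun j => M k j) ⬝ᵥ (Pi.single i t) = _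
        rw [dotProduct_single]
      rw [Pi.sub_apply, Pi.sub_apply, ms, ms, ms, ms, Mii, Mii, Msymm j i]; ring
    have e3 := comm (Pi.single i t - Pi.single j t)
    erw [e3, e1, e2]; ring
  have inS : ∀ i j, ∀ t : ℝ, i ≠ j → 0 ≤ t → t ≤ z j → z + (Pi.single i t - Pi.single j t) ∈ stdSimplex ℝ V := by
    intro i j t hij ht htj
    refine ⟨fun k => ?_, ?_⟩
    · have := hz0 k
      simp only [Pi.add_apply, Pi.sub_apply, Pi.single_apply]
      split_ifs with h1 h2 h2
      · exact absurd (h1.symm.trans h2) hij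
      · linarith
      · subst h2; linarith
      · linarith
    · simp only [Pi.add_apply, Pi.sub_apply, sum_add_distrib, sum_sub_distrib, hz1]
      simp
  have hgrad : ∀ i j, 0 < z j → M.mulVec z i ≤ M.mulVec z j := by
    intro i j hj
    by_contra hc
    push Not at hc
    have hij : i ≠ j := by rintro rfl; exact lt_irrefl _ hc
    set Dd := M.mulVec z i - M.mulVec z j with hDd
    have hDpos : 0 < Dd := by rw [hDd]; linarith
    have hmin : 0 < min (z j) (Dd / 2) := lt_min hj (by linarith)
    have h1 := hzmax _ (inS i j (min (z j) (Dd/2)) hij hmin.le (min_le_left _ _))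
    rw [shift i j _ hij] at h1
    have h2 := min_le_right (z j) (Dd/2)
    have h3 := (M1 i j).2
    have h4 := (M1 i j).1
    set t := min (z j) (Dd/2)
    have h5 : t * M i j ≤ t * 1 := mul_le_mul_of_nonneg_left h3 hmin.le
    have : 0 < 2 * t * (Dd - t * M i j) := by
      apply mul_pos (by linarith); linarith
    nlinarith
  set A := univ.filter (fun i => 0 < z i) with hA
  have hAm : ∀ i, i ∈ A ↔ 0 < z i := fun i => by rw [hA, mem_filter]; simp
  have hzA : ∀ i, i ∉ A → z i = 0 := fun i hi => le_antisymm (not_lt.mp (fun h => hi ((hAm i).mpr h))) (hz0 i)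
  have hclq : ∀ a ∈ A, ∀ b ∈ A, a ≠ b → e a b := by
    intro a ha b hb hab
    by_contra hne
    have hM0 : M a b = 0 := by simp only [hMdef, wt, if_neg hne]
    have heq := le_antisymm (hgrad a b ((hAm b).mp hb)) (hgrad b a ((hAm a).mp ha))
    have hval := shift a b (z b) hab
    rw [hM0, heq] at hval
    have hval' : f (z + (Pi.single a (z b) - Pi.single b (z b))) = f z := by rw [hval]; ring
    have hle := hzmin _ (inS a b (z b) hab (hz0 b) le_rfl) (fun w hw => hval' ▸ hzmax w hw)
    have hsub : univ.filter (fun i => 0 < (z + (Pi.single a (z b) - Pi.single b (z b)) : V → ℝ) i) ⊆ A.erase b := by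
      intro k hk
      rw [mem_filter] at hk
      have hk := hk.2
      simp only [Pi.add_apply, Pi.sub_apply, Pi.single_apply] at hk
      rw [mem_erase, hAm]
      by_cases hkb : k = b
      · subst hkb
        rw [if_neg hab.symm, if_pos rfl] at hk
        linarith
      · refine ⟨hkb, ?_⟩
        by_cases hka : k = a
        · subst hka; exact (hAm _).mp ha
        · rw [if_neg hka, if_neg hkb] at hk; linarith
    have := card_le_card hsub
    rw [card_erase_of_mem hb] at this
    have hpos : 0 < A.card := card_pos.mpr ⟨b, hb⟩
    omega
  have hval : ∀ a ∈ A, M.mulVec z a = f z := by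
    intro a ha
    have : f z = ∑ i, z i * M.mulVec z a := by
      simp only [hf, dotProduct]
      refine sum_congr rfl fun i _ => ?_
      by_cases hi : i ∈ A
      · rw [le_antisymm (hgrad i a ((hAm a).mp ha)) (hgrad a i ((hAm i).mp hi))]
      · rw [hzA i hi, zero_mul, zero_mul]
    rw [this, ← sum_mul, hz1, one_mul]
  have hsumA : ∑ i ∈ A, z i = 1 := by
    rw [← hz1]
    exact sum_subset (subset_univ _) (fun i _ hi => hzA i hi)
  have hfin := D.kc A hclq (fun i => 8 * z i) (fun a ha => by have := (hAm a).mp ha; linarith) (by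
    intro a ha
    have h1 := hval a ha
    have h2 : M.mulVec z a = ∑ j ∈ A, M a j * z j := by
      simp only [Matrix.mulVec, dotProduct]
      exact (sum_subset (subset_univ _) (fun i _ hi => by rw [hzA i hi, mul_zero])).symm
    have h3 : ∑ j ∈ A, M a j * z j = ∑ j ∈ A, (z j - (if j = a then z j else 0) - (if h a j then 499/1000 * z j else 0)) := by
      refine sum_congr rfl fun j hj => ?_
      by_cases hja : j = a
      · subst hja; rw [Mii, if_pos rfl, if_neg (D.hirr j)]; ring
      · have hE := hclq a ha j hj (fun h => hja h.symm)
        rw [if_neg hja]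
        simp only [hMdef, wt, if_pos hE]
        split_ifs <;> ring
    rw [h2, h3, sum_sub_distrib, sum_sub_distrib, hsumA, sum_ite_eq' A a, if_pos ha, ← sum_filter, ← mul_sum] at h1
    rw [← mul_sum]
    linarith)
  rw [← mul_sum, hsumA] at hfin
  linarith

lemma RedS.lag (D : RedS e r h Rt) (x : V → ℝ) (hx : ∀ i, 0 ≤ x i) :
    ∑ i, ∑ j, wt e h i j * (x i * x j) ≤ 7/8 * (∑ i, x i)^2 := by
  have hs : 0 ≤ ∑ i, x i := sum_nonneg fun i _ => hx i
  rcases hs.eq_or_lt with h0 | hpos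
  · have : ∀ i, x i = 0 := fun i => (sum_eq_zero_iff_of_nonneg (fun i _ => hx i)).mp h0.symm i (mem_univ i)
    simp [this]
  · set s := ∑ i, x i with hs'
    have h1 := D.lag_simplex (fun i => x i / s) ⟨fun i => div_nonneg (hx i) hs, by rw [← sum_div, ← hs', div_self hpos.ne']⟩
    have h2 : ∑ i, ∑ j, wt e h i j * (x i / s * (x j / s)) = (∑ i, ∑ j, wt e h i j * (x i * x j)) / s^2 := by
      rw [sum_div]
      refine sum_congr rfl fun i _ => ?_
      rw [sum_div]
      refine sum_congr rfl fun j _ => ?_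
      field_simp
    rw [h2, div_le_iff₀ (by positivity)] at h1
    exact h1
end lag

open Finset

section furedi
open Classical

/-- ordered pair count -/
noncomputable def pc {V : Type*} (X Y : Finset V) (P : V → V → Prop) : ℕ :=
  ∑ u ∈ X, ∑ v ∈ Y, if P u v then 1 else 0

variable {V : Type*}

lemma pc_union {X Y : Finset V} (hd : Disjoint X Y) (P : V → V → Prop) :
    pc (X ∪ Y) (X ∪ Y) P = pc X X P + pc X Y P + pc Y X P + pc Y Y P := by
  unfold pc
  rw [sum_union hd]
  simp only [sum_union hd, sum_add_distrib]
  ring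

lemma pc_congr {X Y : Finset V} {P Q : V → V → Prop} (h : ∀ u ∈ X, ∀ v ∈ Y, (P u v ↔ Q u v)) :
    pc X Y P = pc X Y Q := by
  unfold pc
  exact sum_congr rfl fun u hu => sum_congr rfl fun v hv => by simp only [h u hu v hv]

lemma pc_le {X Y : Finset V} {P Q : V → V → Prop} (h : ∀ u ∈ X, ∀ v ∈ Y, P u v → Q u v) :
    pc X Y P ≤ pc X Y Q := by
  unfold pc
  refine sum_le_sum fun u hu => sum_le_sum fun v hv => ?_
  by_cases hp : P u v
  · simp [hp, h u hu v hv hp]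
  · simp [hp]

lemma pc_all {X Y : Finset V} {P : V → V → Prop} (h : ∀ u ∈ X, ∀ v ∈ Y, P u v) :
    pc X Y P = X.card * Y.card := by
  unfold pc
  rw [sum_congr rfl fun u hu => sum_congr rfl fun v hv => if_pos (h u hu v hv)]
  simp

lemma pc_none {X Y : Finset V} {P : V → V → Prop} (h : ∀ u ∈ X, ∀ v ∈ Y, ¬ P u v) :
    pc X Y P = 0 := by
  unfold pc
  rw [sum_congr rfl fun u hu => sum_congr rfl fun v hv => if_neg (h u hu v hv)]
  simp

lemma pc_comm {X Y : Finset V} {P : V → V → Prop} (h : ∀ u v, P u v → P v u) :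
    pc X Y P = pc Y X P := by
  unfold pc
  rw [sum_comm]
  refine sum_congr rfl fun u hu => sum_congr rfl fun v hv => ?_
  have : P v u ↔ P u v := ⟨h _ _, h _ _⟩
  simp only [this]

lemma furedi (adj : V → V → Prop) (hs : ∀ u v, adj u v → adj v u) (hirr : ∀ u, ¬ adj u u) :
    ∀ (p : ℕ) (A : Finset V), (∀ S ⊆ A, (∀ u ∈ S, ∀ v ∈ S, u ≠ v → adj u v) → S.card ≤ p) →
    ∃ c : V → ℕ, (∀ v ∈ A, c v < p) ∧
      pc A A adj + pc A A (fun u v => adj u v ∧ c u = c v) ≤ pc A A (fun u v => c u ≠ c v) := by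
  intro p
  induction p with
  | zero =>
    intro A hA
    have : A = ∅ := by
      by_contra hne
      obtain ⟨a, ha⟩ := nonempty_iff_ne_empty.mpr hne
      have := hA {a} (by simpa using ha) (by simp)
      simp at this
    subst this
    exact ⟨fun _ => 0, by simp, by simp [pc]⟩
  | succ p ih =>
    intro A hA
    rcases A.eq_empty_or_nonempty with rfl | hne
    · exact ⟨fun _ => 0, by simp, by simp [pc]⟩
    obtain ⟨v0, hv0, hmax⟩ := exists_max_image A (fun u => (A.filter (fun v => adj u v)).card) hne
    set B := A.filter (fun v => adj v0 v) with hB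
    set C := A.filter (fun v => ¬ adj v0 v) with hC
    have hAu : A = B ∪ C := (filter_union_filter_not_eq _ _).symm
    have hd : Disjoint B C := disjoint_filter_filter_not _ _ _
    obtain ⟨c0, hc0, hle⟩ := ih B (by
      intro S hS hcl
      have hv : v0 ∉ S := fun h => hirr _ (mem_filter.mp (hS h)).2
      have := hA (insert v0 S) (insert_subset hv0 (hS.trans (filter_subset _ _))) (by
        intro u hu v hv huv
        rw [mem_insert] at hu hv
        rcases hu with rfl | hu <;> rcases hv with rfl | hv
        · exact absurd rfl huv
        · exact (mem_filter.mp (hS hv)).2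
        · exact hs _ _ (mem_filter.mp (hS hu)).2
        · exact hcl u hu v hv huv)
      rw [card_insert_of_notMem hv] at this
      omega)
    refine ⟨fun v => if v ∈ C then p else c0 v, ?_, ?_⟩
    · intro v hv
      show (if v ∈ C then p else c0 v) < p + 1
      split_ifs with h
      · omega
      · rw [hAu, mem_union] at hv
        have := hc0 v (hv.resolve_right h)
        omega
    set c : V → ℕ := fun v => if v ∈ C then p else c0 v with hc
    have cC : ∀ v ∈ C, c v = p := fun v hv => if_pos hv
    have cB : ∀ v ∈ B, c v = c0 v := fun v hv => if_neg (disjoint_left.mp hd hv)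
    have cBlt : ∀ v ∈ B, c v < p := fun v hv => by rw [cB v hv]; exact hc0 v hv
    rw [hAu, pc_union hd, pc_union hd, pc_union hd]
    have e1 : pc B B (fun u v => adj u v ∧ c u = c v) = pc B B (fun u v => adj u v ∧ c0 u = c0 v) :=
      pc_congr fun u hu v hv => by rw [cB u hu, cB v hv]
    have e2 : pc B B (fun u v => c u ≠ c v) = pc B B (fun u v => c0 u ≠ c0 v) :=
      pc_congr fun u hu v hv => by rw [cB u hu, cB v hv]
    have e3 : pc B C (fun u v => adj u v ∧ c u = c v) = 0 := pc_none fun u hu v hv h => by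
      have := cBlt u hu; have := cC v hv; omega
    have e4 : pc C B (fun u v => adj u v ∧ c u = c v) = 0 := pc_none fun u hu v hv h => by
      have := cBlt v hv; have := cC u hu; omega
    have e5 : pc C C (fun u v => adj u v ∧ c u = c v) = pc C C adj :=
      pc_congr fun u hu v hv => by rw [cC u hu, cC v hv]; simp
    have e6 : pc B C (fun u v => c u ≠ c v) = B.card * C.card := pc_all fun u hu v hv h => by
      have := cBlt u hu; have := cC v hv; omega
    have e7 : pc C B (fun u v => c u ≠ c v) = C.card * B.card := pc_all fun u hu v hv h => by
      have := cBlt v hv; have := cC u hu; omega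
    have e8 : pc B C adj = pc C B adj := pc_comm hs
    have e9 : pc C B adj + pc C C adj ≤ C.card * B.card := by
      unfold pc
      rw [← sum_add_distrib, ← smul_eq_mul]
      refine sum_le_card_nsmul _ _ _ fun u hu => ?_
      rw [← sum_union hd, ← hAu, ← card_filter]
      exact hmax u (mem_filter.mp hu).1
    rw [e1, e2, e3, e4, e5, e6, e7, e8]
    have : B.card * C.card = C.card * B.card := mul_comm _ _
    omega
end furedi

section align
open Classical
variable {V : Type*} [Fintype V] {κ : Type*} [Fintype κ] [DecidableEq κ]

lemma align (c c' : V → κ) : ∃ σ : V ≃ V,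
    (univ.filter (fun u => c' (σ u) ≠ c u)).card ≤
      ∑ k, ((univ.filter (fun u => c u = k)).card - (univ.filter (fun u => c' u = k)).card) := by
  obtain ⟨σ, -, hσ⟩ := exists_min_image (univ : Finset (V ≃ V)) (fun σ => (univ.filter (fun u => c' (σ u) ≠ c u)).card) ⟨Equiv.refl V, mem_univ _⟩
  refine ⟨σ, ?_⟩
  rw [card_eq_sum_card_fiberwise (f := c) (t := univ) (by intro; simp)]
  refine sum_le_sum fun k _ => ?_
  have hcard' : (univ.filter (fun u => c' u = k)).card = (univ.filter (fun u => c' (σ u) = k)).card := by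
    symm
    refine card_bij (fun u _ => σ u) ?_ ?_ ?_
    · intro u hu; simpa using hu
    · intro u _ v _ h; exact σ.injective h
    · intro v hv; exact ⟨σ.symm v, by simpa using hv, by simp⟩
  rw [hcard']
  by_cases hne : (filter (fun u => c u = k) (univ.filter (fun u => c' (σ u) ≠ c u))) = ∅
  · rw [hne]; simp
  obtain ⟨u, hu⟩ := nonempty_iff_ne_empty.mpr hne
  simp only [mem_filter, mem_univ, true_and] at hu
  have hall : ∀ v, c' (σ v) = k → c v = k := by
    intro v hv
    by_contra hvk
    have huv : u ≠ v := by rintro rfl; exact hvk hu.2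
    have := hσ ((Equiv.swap u v).trans σ) (mem_univ _)
    refine absurd this (not_le.mpr (card_lt_card ?_))
    rw [ssubset_iff_of_subset]
    · refine ⟨u, by simpa using hu.1, ?_⟩
      rw [mem_filter]
      rintro ⟨-, h⟩
      rw [Equiv.trans_apply, Equiv.swap_apply_left, hv, hu.2] at h
      exact h rfl
    · intro w hw
      rw [mem_filter] at hw ⊢
      refine ⟨mem_univ _, ?_⟩
      have hw := hw.2
      rw [Equiv.trans_apply] at hw
      by_cases hwu : w = u
      · subst hwu; exact hu.1
      by_cases hwv : w = v
      · subst hwv; rw [hv]; exact fun h => hvk h.symm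
      rwa [Equiv.swap_apply_of_ne_of_ne hwu hwv] at hw
  have hsub : univ.filter (fun u => c' (σ u) = k) ⊆ univ.filter (fun u => c u = k) := by
    intro v hv
    simp only [mem_filter, mem_univ, true_and] at hv ⊢
    exact hall v hv
  rw [← card_sdiff_of_subset hsub]
  refine card_le_card fun w hw => ?_
  simp only [mem_filter, mem_univ, true_and, mem_sdiff] at hw ⊢
  exact ⟨hw.2, fun h => hw.1 (h.trans hw.2.symm)⟩
end align

open Finset

section final
open Classical

lemma pc_or {V : Type*} {X Y : Finset V} (P Q : V → V → Prop) :
    pc X Y (fun u v => P u v ∨ Q u v) ≤ pc X Y P + pc X Y Q := by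
  unfold pc
  rw [← sum_add_distrib]
  refine sum_le_sum fun u _ => ?_
  rw [← sum_add_distrib]
  refine sum_le_sum fun v _ => ?_
  by_cases h1 : P u v <;> by_cases h2 : Q u v <;> simp [h1, h2]

lemma pc_not {V : Type*} {X Y : Finset V} (P : V → V → Prop) :
    pc X Y P + pc X Y (fun u v => ¬ P u v) = X.card * Y.card := by
  unfold pc
  rw [← sum_add_distrib, ← smul_eq_mul, ← sum_const]
  refine sum_congr rfl fun u _ => ?_
  rw [← sum_add_distrib, card_eq_sum_ones]
  refine sum_congr rfl fun v _ => ?_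
  by_cases h1 : P u v <;> simp [h1]

lemma pc_edge {n : ℕ} (H : SimpleGraph (Fin n)) : pc univ univ H.Adj = 2 * H.edgeSet.ncard := by
  have h1 := H.sum_degrees_eq_twice_card_edges
  rw [← SimpleGraph.coe_edgeFinset, Set.ncard_coe_finset, ← h1]
  unfold pc
  refine sum_congr rfl fun u _ => ?_
  rw [← card_filter, ← SimpleGraph.card_neighborFinset_eq_degree, SimpleGraph.neighborFinset_eq_filter]

lemma pc_perm {V : Type*} [Fintype V] (σ : V ≃ V) (P : V → V → Prop) :
    pc univ univ P = pc univ univ (fun u v => P (σ u) (σ v)) := by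
  unfold pc
  rw [← Equiv.sum_comp σ]
  refine sum_congr rfl fun u _ => ?_
  rw [← Equiv.sum_comp σ]

lemma pc_left {V : Type*} [Fintype V] (P : V → Prop) [DecidablePred P] :
    pc univ univ (fun u _ => P u) = (univ.filter P).card * Fintype.card V := by
  unfold pc
  rw [card_filter, sum_mul]
  refine sum_congr rfl fun u _ => ?_
  by_cases h : P u <;> simp [h]

lemma pc_right {V : Type*} [Fintype V] (P : V → Prop) [DecidablePred P] :
    pc univ univ (fun _ v => P v) = (univ.filter P).card * Fintype.card V := by
  rw [← pc_left]
  unfold pc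
  exact sum_comm

/-- the property that G is close to 8-partite -/
def Close8 {n : ℕ} (η : ℝ) (G : SimpleGraph (Fin n)) : Prop :=
  ∃ c : Fin n → Fin 8, (pc univ univ (fun u v => ¬ (G.Adj u v ↔ c u ≠ c v)) : ℝ) ≤ η * n^2

lemma bal {n : ℕ} {η θ : ℝ} (hθ : 0 ≤ θ) (hη : 3 * η ≤ θ^2) (G : SimpleGraph (Fin n)) (c : Fin n → Fin 8)
    (hc : (pc univ univ (fun u v => ¬ (G.Adj u v ↔ c u ≠ c v)) : ℝ) ≤ η * n^2)
    (hG : (7/16 - η) * n^2 ≤ (G.edgeSet.ncard : ℝ)) (k : Fin 8) :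
    |((univ.filter (fun u => c u = k)).card : ℝ) - n/8| ≤ θ * n := by
  have h1 := pc_edge G
  have h2 : pc univ univ G.Adj ≤ pc univ univ (fun u v => c u ≠ c v) + pc univ univ (fun u v => ¬ (G.Adj u v ↔ c u ≠ c v)) := by
    refine le_trans (pc_le ?_) (pc_or _ _)
    intro u _ v _ h; tauto
  have h3 : pc univ univ (fun u v => c u = c v) + pc univ univ (fun u v => c u ≠ c v) = n * n := by
    have := pc_not (X := univ) (Y := univ) (fun u v => c u = c v)
    simpa using this
  have h4 : pc univ univ (fun u v => c u = c v) = ∑ k, (univ.filter (fun u => c u = k)).card^2 := by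
    have : ∀ k, (univ.filter (fun u => c u = k)).card^2 = ∑ u, ∑ v, if (c u = k ∧ c v = k) then 1 else 0 := by
      intro k
      rw [sq, card_filter, sum_mul_sum]
      refine sum_congr rfl fun u _ => sum_congr rfl fun v _ => ?_
      by_cases h1 : c u = k <;> by_cases h2 : c v = k <;> simp [h1, h2]
    simp only [this]
    rw [sum_comm]
    unfold pc
    refine sum_congr rfl fun u _ => ?_
    rw [sum_comm]
    refine sum_congr rfl fun v _ => ?_
    by_cases h : c u = c v
    · simp [h]
    · rw [if_neg h, eq_comm]
      refine sum_eq_zero fun k _ => if_neg ?_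
      rintro ⟨a, b⟩; exact h (a.trans b.symm)
  have h5 : ∑ k, (univ.filter (fun u => c u = k)).card = n := by
    rw [← card_eq_sum_card_fiberwise (f := c) (t := univ) (by intro; simp)]; simp
  have h4' : (pc univ univ (fun u v => c u = c v) : ℝ) = ∑ k, ((univ.filter (fun u => c u = k)).card : ℝ)^2 := by
    rw [h4]; push_cast; rfl
  have h5' : ∑ k, ((univ.filter (fun u => c u = k)).card : ℝ) = n := by exact_mod_cast h5
  have h2' : (pc univ univ G.Adj : ℝ) ≤ pc univ univ (fun u v => c u ≠ c v) + pc univ univ (fun u v => ¬ (G.Adj u v ↔ c u ≠ c v)) := by exact_mod_cast h2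
  have h3' : (pc univ univ (fun u v => c u = c v) : ℝ) + pc univ univ (fun u v => c u ≠ c v) = n * n := by exact_mod_cast h3
  have h1' : (pc univ univ G.Adj : ℝ) = 2 * G.edgeSet.ncard := by exact_mod_cast h1
  have h6 : ∑ k, (((univ.filter (fun u => c u = k)).card : ℝ) - n/8)^2 ≤ (θ * n)^2 := by
    have : ∀ k, (((univ.filter (fun u => c u = k)).card : ℝ) - n/8)^2 = ((univ.filter (fun u => c u = k)).card : ℝ)^2 - n/4 * ((univ.filter (fun u => c u = k)).card : ℝ) + n^2/64 := by
      intro k; ring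
    simp only [this]
    rw [sum_add_distrib, sum_sub_distrib, ← mul_sum, h5', ← h4', sum_const, card_univ, Fintype.card_fin]
    have : 3 * η * n^2 ≤ θ^2 * n^2 := mul_le_mul_of_nonneg_right hη (sq_nonneg _)
    simp only [nsmul_eq_mul]
    push_cast
    nlinarith
  have h7 := (single_le_sum (f := fun k => (((univ.filter (fun u => c u = k)).card : ℝ) - n/8)^2) (fun k _ => sq_nonneg _) (mem_univ k)).trans h6
  exact abs_le_of_sq_le_sq h7 (by positivity)

lemma close_pair {n : ℕ} {ε η θ : ℝ} (hθ : 0 ≤ θ) (hη : 3 * η ≤ θ^2) (hε : η + 16 * θ ≤ ε) (G G' : SimpleGraph (Fin n))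
    (hG : (7/16 - η) * n^2 ≤ (G.edgeSet.ncard : ℝ)) (hG' : (7/16 - η) * n^2 ≤ (G'.edgeSet.ncard : ℝ))
    (h : Close8 η G) (h' : Close8 η G') : ∃ σ : Fin n ≃ Fin n,
          ((symmDiff G'.edgeSet (Sym2.map σ '' G.edgeSet)).ncard : ℝ) ≤ ε * n ^ 2 := by
  obtain ⟨c, hc⟩ := h
  obtain ⟨c', hc'⟩ := h'
  have b := bal hθ hη G c hc hG
  have b' := bal hθ hη G' c' hc' hG'
  obtain ⟨σ, hσ⟩ := align c c'
  refine ⟨σ, ?_⟩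
  have hσ' : ((univ.filter (fun u => c' (σ u) ≠ c u)).card : ℝ) ≤ 16 * (θ * n) := by
    have : ((univ.filter (fun u => c' (σ u) ≠ c u)).card : ℝ) ≤ ∑ k, (((univ.filter (fun u => c u = k)).card - (univ.filter (fun u => c' u = k)).card : ℕ) : ℝ) := by exact_mod_cast hσ
    refine this.trans ?_
    have h2 : ∀ k ∈ (univ : Finset (Fin 8)), (((univ.filter (fun u => c u = k)).card - (univ.filter (fun u => c' u = k)).card : ℕ) : ℝ) ≤ 2 * (θ * n) := by
      intro k _
      have h1 := abs_le.mp (b k)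
      have h2 := abs_le.mp (b' k)
      rcases le_total (univ.filter (fun u => c u = k)).card (univ.filter (fun u => c' u = k)).card with hle | hle
      · rw [Nat.sub_eq_zero_of_le hle]; push_cast; positivity
      · rw [Nat.cast_sub hle]; linarith
    have h3 := sum_le_card_nsmul _ _ _ h2
    refine h3.trans ?_
    simp only [card_univ, Fintype.card_fin, nsmul_eq_mul]; push_cast; linarith
  have hset : symmDiff G'.edgeSet (Sym2.map σ '' G.edgeSet) = (symmDiff G' (G.map σ.toEmbedding)).edgeSet := by
    rw [symmDiff_def, symmDiff_def, SimpleGraph.edgeSet_sup, SimpleGraph.edgeSet_sdiff, SimpleGraph.edgeSet_sdiff, SimpleGraph.edgeSet_map]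
    rfl
  rw [hset]
  have h1 := pc_edge (symmDiff G' (G.map σ.toEmbedding))
  rw [pc_perm σ] at h1
  have hle : pc univ univ (fun u v => (symmDiff G' (G.map σ.toEmbedding)).Adj (σ u) (σ v)) ≤
      pc univ univ (fun u v => ¬ (G.Adj u v ↔ c u ≠ c v)) + pc univ univ (fun u v => ¬ (G'.Adj u v ↔ c' u ≠ c' v))
      + (univ.filter (fun u => c' (σ u) ≠ c u)).card * n + (univ.filter (fun u => c' (σ u) ≠ c u)).card * n := by
    have e1 := pc_left (fun u => c' (σ u) ≠ c u)
    have e2 := pc_right (fun u => c' (σ u) ≠ c u)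
    rw [Fintype.card_fin] at e1 e2
    nth_rw 1 [← e1]
    rw [← e2, pc_perm σ (fun u v => ¬ (G'.Adj u v ↔ c' u ≠ c' v))]
    refine le_trans (pc_le (Q := fun u v => ((¬ (G.Adj u v ↔ c u ≠ c v) ∨ ¬ (G'.Adj (σ u) (σ v) ↔ c' (σ u) ≠ c' (σ v))) ∨ c' (σ u) ≠ c u) ∨ c' (σ v) ≠ c v) ?_)
      ((pc_or _ _).trans (Nat.add_le_add_right ((pc_or _ _).trans (Nat.add_le_add_right (pc_or _ _) _)) _))
    intro u _ v _ hd
    have hm : (G.map σ.toEmbedding).Adj (σ u) (σ v) ↔ G.Adj u v := SimpleGraph.map_adj_apply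
    rw [symmDiff_def, SimpleGraph.sup_adj, SimpleGraph.sdiff_adj, SimpleGraph.sdiff_adj, hm] at hd
    by_contra hcon
    simp only [not_or, not_not] at hcon
    obtain ⟨⟨⟨q1, q2⟩, q3⟩, q4⟩ := hcon
    rw [q3, q4] at q2
    tauto
  have hle' : (pc univ univ (fun u v => (symmDiff G' (G.map σ.toEmbedding)).Adj (σ u) (σ v)) : ℝ) ≤
      pc univ univ (fun u v => ¬ (G.Adj u v ↔ c u ≠ c v)) + pc univ univ (fun u v => ¬ (G'.Adj u v ↔ c' u ≠ c' v))
      + (univ.filter (fun u => c' (σ u) ≠ c u)).card * n + (univ.filter (fun u => c' (σ u) ≠ c u)).card * n := by exact_mod_cast hle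
  rw [h1] at hle'
  push_cast at hle'
  have hn : (0:ℝ) ≤ n := Nat.cast_nonneg n
  have h9 := mul_le_mul_of_nonneg_right hσ' hn
  have h10 : (η + 16 * θ) * n^2 ≤ ε * n^2 := mul_le_mul_of_nonneg_right hε (sq_nonneg _)
  nlinarith

/-- admissible graphs -/
structure Adm {n : ℕ} (δ : ℝ) (G : SimpleGraph (Fin n)) : Prop where
  ind : ∀ s : Finset (Fin n), (∀ x ∈ s, ∀ y ∈ s, x ≠ y → ¬ G.Adj x y) → (s.card : ℝ) ≤ δ * n
  col : ∃ E₁ E₂ : SimpleGraph (Fin n), E₁ ⊔ E₂ = G ∧ E₁ ⊓ E₂ = ⊥ ∧ E₁.CliqueFree 3 ∧ E₂.CliqueFree 7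
  edge : (7 / 16 - δ) * n ^ 2 ≤ (G.edgeSet.ncard : ℝ)

theorem main_of_close (H : ∀ η : ℝ, 0 < η → ∃ δ : ℝ, 0 < δ ∧ δ ≤ η ∧ ∃ N : ℕ, 0 < N ∧ ∀ n : ℕ, N ≤ n →
    ∀ G : SimpleGraph (Fin n), Adm δ G → Close8 η G) :
    ∀ ε : ℝ, 0 < ε → ∃ δ : ℝ, 0 < δ ∧ ∃ N : ℕ, 0 < N ∧
      ∀ n : ℕ, N ≤ n → ∀ G G' : SimpleGraph (Fin n), Adm δ G → Adm δ G' →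
        ∃ σ : Fin n ≃ Fin n,
          ((symmDiff G'.edgeSet (Sym2.map σ '' G.edgeSet)).ncard : ℝ) ≤ ε * n ^ 2 := by
  intro ε hε
  set θ := min (ε/17) 1 with hθ
  have hθ0 : 0 < θ := lt_min (by positivity) one_pos
  have hθ1 : θ ≤ 1 := min_le_right _ _
  have hθ2 : θ ≤ ε/17 := min_le_left _ _
  obtain ⟨δ, hδ, hδη, N, hN, hH⟩ := H (θ^2/3) (by positivity)
  refine ⟨δ, hδ, N, hN, fun n hn G G' hG hG' => ?_⟩
  have hmono : (7/16 - θ^2/3) * (n:ℝ)^2 ≤ (7/16 - δ) * n^2 := mul_le_mul_of_nonneg_right (by linarith) (sq_nonneg _)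
  exact close_pair hθ0.le (by linarith) (by nlinarith) G G' (hmono.trans hG.edge) (hmono.trans hG'.edge) (hH n hn G hG) (hH n hn G' hG')

end final

open Finset

section counting
open Classical

/-- cell of a colouring -/
noncomputable def cell {V ι : Type*} [Fintype V] (π : V → ι) (i : ι) : Finset V := univ.filter (fun u => π u = i)

lemma mem_cell {V ι : Type*} [Fintype V] {π : V → ι} {i : ι} {u : V} : u ∈ cell π i ↔ π u = i := by
  simp [cell]

lemma pc_cells {V ι : Type*} [Fintype V] [Fintype ι] (π : V → ι) (P : V → V → Prop) :
    pc univ univ P = ∑ i, ∑ j, pc (cell π i) (cell π j) P := by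
  unfold pc cell
  rw [← sum_fiberwise univ π (fun u => ∑ v, if P u v then 1 else 0)]
  refine sum_congr rfl fun i _ => ?_
  conv_rhs => rw [sum_comm]
  refine sum_congr rfl fun u _ => ?_
  exact (sum_fiberwise univ π (fun v => if P u v then 1 else 0)).symm

lemma pc_le_card {V : Type*} {X Y : Finset V} (P : V → V → Prop) : pc X Y P ≤ X.card * Y.card := by
  rw [← pc_not P]; omega

lemma card_cells {V ι : Type*} [Fintype V] [Fintype ι] (π : V → ι) : ∑ i, (cell π i).card = Fintype.card V := by
  unfold cell
  rw [← card_eq_sum_card_fiberwise (f := π) (t := univ) (by intro; simp)]; simp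

lemma pc_split {V : Type*} {X Y : Finset V} (P Q : V → V → Prop) :
    pc X Y P = pc X Y (fun u v => P u v ∧ Q u v) + pc X Y (fun u v => P u v ∧ ¬ Q u v) := by
  unfold pc
  rw [← sum_add_distrib]
  refine sum_congr rfl fun u _ => ?_
  rw [← sum_add_distrib]
  refine sum_congr rfl fun v _ => ?_
  by_cases h1 : P u v <;> by_cases h2 : Q u v <;> simp [h1, h2]

lemma pc_diff8 {n : ℕ} (c : Fin n → ℕ) (hc : ∀ v, c v < 8) :
    (pc univ univ (fun u v => c u ≠ c v) : ℝ) ≤ 7/8 * n^2 := by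
  obtain ⟨c', hc'⟩ : ∃ c' : Fin n → Fin 8, ∀ v, (c' v).val = c v := ⟨fun v => ⟨c v, hc v⟩, fun v => rfl⟩
  have h1 := pc_not (X := univ) (Y := univ) (fun u v => c u = c v)
  have h2 := pc_cells c' (fun u v => c u = c v)
  have h3 : ∑ i, (cell c' i).card ^ 2 ≤ pc univ univ (fun u v => c u = c v) := by
    rw [h2]
    refine sum_le_sum fun i _ => ?_
    refine le_trans (le_of_eq ?_) (single_le_sum (f := fun j => pc (cell c' i) (cell c' j) (fun u v => c u = c v)) (fun j _ => Nat.zero_le _) (mem_univ i))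
    rw [sq]
    refine (pc_all fun u hu v hv => ?_).symm
    rw [mem_cell] at hu hv
    have := hu.trans hv.symm
    rw [← hc', ← hc', this]
  have h4 := card_cells c'
  rw [Fintype.card_fin] at h4
  have h5 := sq_sum_le_card_mul_sum_sq (s := univ) (f := fun i => ((cell c' i).card : ℝ))
  have h4' : ∑ i, ((cell c' i).card : ℝ) = n := by exact_mod_cast h4
  have h3' : ∑ i, ((cell c' i).card : ℝ)^2 ≤ pc univ univ (fun u v => c u = c v) := by exact_mod_cast h3
  simp only [card_univ, Fintype.card_fin] at h1 h5
  rw [h4'] at h5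
  have h1' : (pc univ univ (fun u v => c u = c v) : ℝ) + pc univ univ (fun u v => ¬ c u = c v) = n * n := by exact_mod_cast h1
  push_cast at h5
  have h6 : (n:ℝ) * n = n^2 := by ring
  have h7 : (pc univ univ (fun u v => ¬ c u = c v) : ℝ) ≤ 7/8 * n^2 := by linarith
  exact h7

theorem close_of_reduced {n k : ℕ} (G : SimpleGraph (Fin n)) (π : Fin n → Fin k)
    {e r h : Fin k → Fin k → Prop} {Rt : Fin k → Prop} (D : RedS e r h Rt) {κ : ℝ} (hκ0 : 0 ≤ κ) (hκ : κ ≤ 1/2000)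
    (hbad : (pc univ univ (fun u v => G.Adj u v ∧ ¬ e (π u) (π v)) : ℝ) ≤ κ * n^2)
    (hh : ∀ i j, h i j → (pc (cell π i) (cell π j) G.Adj : ℝ) ≤ (1/2 + κ) * ((cell π i).card * (cell π j).card))
    (hG : (7/16 - κ) * n^2 ≤ (G.edgeSet.ncard : ℝ)) : Close8 (40000 * κ) G := by
  set F : Fin n → Fin n → Prop := fun u v => e (π u) (π v) ∧ ¬ h (π u) (π v) with hF
  set x : Fin k → ℝ := fun i => ((cell π i).card : ℝ) with hx
  have hxs : ∑ i, x i = n := by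
    have := card_cells π
    rw [Fintype.card_fin] at this
    simp only [hx]; exact_mod_cast this
  have hx0 : ∀ i, 0 ≤ x i := fun i => Nat.cast_nonneg _
  have lag := D.lag x hx0
  rw [hxs] at lag
  have pcG : (pc univ univ G.Adj : ℝ) = 2 * G.edgeSet.ncard := by exact_mod_cast pc_edge G
  -- half mass
  set hm : ℝ := ∑ i, ∑ j, (if h i j then x i * x j else 0) with hhm
  have hmh : (pc univ univ (fun u v => h (π u) (π v)) : ℝ) = hm := by
    rw [pc_cells π]; push_cast
    refine sum_congr rfl fun i _ => sum_congr rfl fun j _ => ?_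
    split_ifs with hij
    · rw [pc_all]; · push_cast; rfl
      intro u hu v hv; rw [mem_cell] at hu hv; rwa [hu, hv]
    · rw [pc_none]; · simp
      intro u hu v hv; rw [mem_cell] at hu hv; rwa [hu, hv]
  have hm0 : 0 ≤ hm := by rw [← hmh]; positivity
  have s1 := pc_split (X := univ) (Y := univ) G.Adj (fun u v => e (π u) (π v))
  have s2 : (pc univ univ (fun u v => G.Adj u v ∧ e (π u) (π v)) : ℝ) ≤ 7/8 * n^2 - (1/2000) * hm := by
    have : (pc univ univ (fun u v => G.Adj u v ∧ e (π u) (π v)) : ℝ) ≤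
        ∑ i, ∑ j, (wt e h i j * (x i * x j) - 1/2000 * (if h i j then x i * x j else 0)) := by
      rw [pc_cells π]; push_cast
      refine sum_le_sum fun i _ => sum_le_sum fun j _ => ?_
      have hxx : 0 ≤ x i * x j := mul_nonneg (hx0 i) (hx0 j)
      unfold wt
      split_ifs with h1 h2 h2
      · have h3 := hh i j h2
        have h4 : (pc (cell π i) (cell π j) (fun u v => G.Adj u v ∧ e (π u) (π v)) : ℝ) ≤ pc (cell π i) (cell π j) G.Adj := by
          exact Nat.cast_le.mpr (pc_le fun u _ v _ hh => hh.1)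
        have h5 : κ * (x i * x j) ≤ 1/2000 * (x i * x j) := mul_le_mul_of_nonneg_right hκ hxx
        have h6 : (pc (cell π i) (cell π j) G.Adj : ℝ) ≤ (1/2 + κ) * (x i * x j) := h3
        linarith
      · have h4 : (pc (cell π i) (cell π j) (fun u v => G.Adj u v ∧ e (π u) (π v)) : ℝ) ≤ x i * x j := by
          have := pc_le_card (X := cell π i) (Y := cell π j) (fun u v => G.Adj u v ∧ e (π u) (π v))
          simp only [hx]; exact_mod_cast this
        linarith
      · exact absurd (D.he _ _ h2) h1
      · rw [pc_none]; · simp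
        intro u hu v hv; rw [mem_cell] at hu hv; rw [hu, hv]; tauto
    refine this.trans ?_
    simp only [sum_sub_distrib, ← mul_sum]
    linarith
  have s1' : (pc univ univ G.Adj : ℝ) = pc univ univ (fun u v => G.Adj u v ∧ e (π u) (π v)) + pc univ univ (fun u v => G.Adj u v ∧ ¬ e (π u) (π v)) := by exact_mod_cast s1
  have hmle : hm ≤ 6000 * κ * n^2 := by nlinarith
  have gnf : (pc univ univ (fun u v => G.Adj u v ∧ ¬ F u v) : ℝ) ≤ 6001 * κ * n^2 := by
    have : (pc univ univ (fun u v => G.Adj u v ∧ ¬ F u v) : ℝ) ≤ pc univ univ (fun u v => G.Adj u v ∧ ¬ e (π u) (π v)) + pc univ univ (fun u v => h (π u) (π v)) := by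
      have := (pc_le (P := fun u v => G.Adj u v ∧ ¬ F u v) (Q := fun u v => (G.Adj u v ∧ ¬ e (π u) (π v)) ∨ h (π u) (π v)) (X := univ) (Y := univ) (fun u _ v _ hu => by
        simp only [hF] at hu; tauto)).trans (pc_or _ _)
      exact_mod_cast this
    rw [hmh] at this
    linarith
  have s3 : (pc univ univ G.Adj : ℝ) = pc univ univ (fun u v => G.Adj u v ∧ F u v) + pc univ univ (fun u v => G.Adj u v ∧ ¬ F u v) := by
    exact_mod_cast pc_split (X := univ) (Y := univ) G.Adj F
  have s4 : (pc univ univ F : ℝ) = pc univ univ (fun u v => F u v ∧ G.Adj u v) + pc univ univ (fun u v => F u v ∧ ¬ G.Adj u v) := by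
    exact_mod_cast pc_split (X := univ) (Y := univ) F G.Adj
  have s5 : pc univ univ (fun u v => F u v ∧ G.Adj u v) = pc univ univ (fun u v => G.Adj u v ∧ F u v) := pc_congr fun u _ v _ => and_comm
  rw [s5] at s4
  obtain ⟨c, hc, hcF⟩ := furedi F (fun u v huv => ⟨D.esymm _ _ huv.1, fun hh => huv.2 (D.hsymm _ _ hh)⟩) (fun u hu => D.eirr _ hu.1) 8 univ (by
    intro S _ hS
    by_contra hcon
    push Not at hcon
    obtain ⟨S', hS'S, hS'⟩ := exists_subset_card_eq (Nat.succ_le_of_lt hcon)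
    have hinj : Set.InjOn π S' := by
      intro u hu v hv huv
      by_contra hne
      have := (hS u (hS'S hu) v (hS'S hv) hne).1
      rw [huv] at this
      exact D.eirr _ this
    set T := S'.image π with hT
    have hTc : T.card = 9 := by rw [hT, card_image_of_injOn hinj, hS']
    have l := D.lag (fun i => if i ∈ T then 1 else 0) (fun i => by split_ifs <;> norm_num)
    have e1 : ∑ i, (if i ∈ T then (1:ℝ) else 0) = 9 := by
      rw [← sum_filter]; simp [hTc]
    rw [e1] at l
    have e2 : ∑ i, ∑ j, wt e h i j * ((if i ∈ T then (1:ℝ) else 0) * (if j ∈ T then (1:ℝ) else 0)) = 72 := by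
      have : ∀ i j, wt e h i j * ((if i ∈ T then (1:ℝ) else 0) * (if j ∈ T then (1:ℝ) else 0)) = if i ∈ T then (if j ∈ T then (if i = j then 0 else 1) else 0) else 0 := by
        intro i j
        by_cases hi : i ∈ T <;> by_cases hj : j ∈ T <;> simp only [hi, hj, if_true, if_false, mul_zero, mul_one, zero_mul]
        obtain ⟨u, hu, rfl⟩ := mem_image.mp hi
        obtain ⟨v, hv, rfl⟩ := mem_image.mp hj
        split_ifs with huv
        · unfold wt; rw [huv, if_neg (D.eirr _)]
        · have := hS u (hS'S hu) v (hS'S hv) (fun h => huv (by rw [h]))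
          unfold wt; rw [if_pos this.1, if_neg this.2]
      simp only [this]
      have h9 : ∀ i, (∑ j, if i ∈ T then (if j ∈ T then (if i = j then (0:ℝ) else 1) else 0) else 0) = if i ∈ T then 8 else 0 := by
        intro i
        by_cases hi : i ∈ T
        swap
        · simp [hi]
        simp only [hi, if_true]
        have : ∀ j, (if j ∈ T then (if i = j then (0:ℝ) else 1) else 0) = (if j ∈ T then 1 else 0) - (if j = i then 1 else 0) := by
          intro j
          by_cases hj : j = i
          · subst hj; simp [hi]
          · have hj' : ¬ i = j := fun h => hj h.symm
            simp [hj, hj']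
        simp only [this, sum_sub_distrib, e1, sum_ite_eq', mem_univ, if_true]
        norm_num
      simp only [h9]
      rw [← sum_filter]
      simp [hTc]; norm_num
    rw [e2] at l
    norm_num at l)
  have hcF' : (pc univ univ F : ℝ) + pc univ univ (fun u v => F u v ∧ c u = c v) ≤ pc univ univ (fun u v => c u ≠ c v) := by exact_mod_cast hcF
  have d8 := pc_diff8 c (fun v => hc v (mem_univ v))
  have s6 : (pc univ univ F : ℝ) = pc univ univ (fun u v => F u v ∧ c u = c v) + pc univ univ (fun u v => F u v ∧ ¬ c u = c v) := by
    exact_mod_cast pc_split (X := univ) (Y := univ) F (fun u v => c u = c v)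
  have s7 : (pc univ univ (fun u v => c u ≠ c v) : ℝ) = pc univ univ (fun u v => c u ≠ c v ∧ F u v) + pc univ univ (fun u v => c u ≠ c v ∧ ¬ F u v) := by
    exact_mod_cast pc_split (X := univ) (Y := univ) (fun u v => c u ≠ c v) F
  have s8 : pc univ univ (fun u v => c u ≠ c v ∧ F u v) = pc univ univ (fun u v => F u v ∧ ¬ c u = c v) := pc_congr fun u _ v _ => and_comm
  rw [s8] at s7
  have q1 : (0:ℝ) ≤ pc univ univ (fun u v => F u v ∧ c u = c v) := Nat.cast_nonneg _
  refine ⟨fun v => ⟨c v, hc v (mem_univ v)⟩, ?_⟩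
  have fin : (pc univ univ (fun u v => ¬ (G.Adj u v ↔ (⟨c u, hc u (mem_univ u)⟩ : Fin 8) ≠ ⟨c v, hc v (mem_univ v)⟩)) : ℝ) ≤
      pc univ univ (fun u v => G.Adj u v ∧ ¬ F u v) + pc univ univ (fun u v => F u v ∧ c u = c v) + pc univ univ (fun u v => c u ≠ c v ∧ ¬ F u v) + pc univ univ (fun u v => F u v ∧ ¬ G.Adj u v) := by
    have := le_trans (pc_le (X := univ) (Y := univ) (P := fun u v => ¬ (G.Adj u v ↔ (⟨c u, hc u (mem_univ u)⟩ : Fin 8) ≠ ⟨c v, hc v (mem_univ v)⟩)) (Q := fun u v => (((G.Adj u v ∧ ¬ F u v) ∨ (F u v ∧ c u = c v)) ∨ (c u ≠ c v ∧ ¬ F u v)) ∨ (F u v ∧ ¬ G.Adj u v)) (by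
        intro u _ v _ hd
        rw [Ne, Fin.mk.injEq] at hd
        tauto)) ((pc_or _ _).trans (Nat.add_le_add_right ((pc_or _ _).trans (Nat.add_le_add_right (pc_or _ _) _)) _))
    exact_mod_cast this
  refine fin.trans ?_
  have hn2 : 0 ≤ κ * (n:ℝ)^2 := by positivity
  nlinarith
end counting

open Finset

section embedding
open Classical
variable {V ι : Type*}

/-- neighbours of u in C -/
noncomputable def nb (S : V → V → Prop) (u : V) (C : Finset V) : Finset V := C.filter (fun v => S u v)

/-- the typical vertices -/
lemma typical (S : V → V → Prop) (I : Finset ι) (C0 : Finset V) (C : ι → Finset V) (s0 : ℝ) (ρ : ι → ℝ)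
    (hs0 : 0 < s0)
    (H : ∀ b ∈ I, ∀ X ⊆ C0, s0 ≤ (X.card : ℝ) → ρ b * (X.card * (C b).card) ≤ (pc X (C b) S : ℝ)) :
    (C0.card : ℝ) - I.card * s0 ≤ ((C0.filter (fun u => ∀ b ∈ I, ρ b * (C b).card ≤ ((nb S u (C b)).card : ℝ))).card : ℝ) := by
  have hb : ∀ b ∈ I, ((C0.filter (fun u => ((nb S u (C b)).card : ℝ) < ρ b * (C b).card)).card : ℝ) ≤ s0 := by
    intro b hb
    by_contra hcon
    push Not at hcon
    set X := C0.filter (fun u => ((nb S u (C b)).card : ℝ) < ρ b * (C b).card) with hX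
    have h1 := H b hb X (filter_subset _ _) hcon.le
    have h2 : (pc X (C b) S : ℝ) = ∑ u ∈ X, ((nb S u (C b)).card : ℝ) := by
      unfold pc nb
      push_cast
      refine sum_congr rfl fun u _ => ?_
      rw [card_filter]; push_cast; rfl
    have hne : X.Nonempty := by
      rw [← card_pos]
      have : (0:ℝ) < X.card := hs0.trans hcon
      exact_mod_cast this
    have h3 : ∑ u ∈ X, ((nb S u (C b)).card : ℝ) < ∑ u ∈ X, ρ b * (C b).card :=
      sum_lt_sum_of_nonempty hne fun u hu => (mem_filter.mp hu).2
    rw [sum_const, nsmul_eq_mul] at h3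
    linarith
  have hsub : C0 ⊆ (C0.filter (fun u => ∀ b ∈ I, ρ b * (C b).card ≤ ((nb S u (C b)).card : ℝ))) ∪ I.biUnion (fun b => C0.filter (fun u => ((nb S u (C b)).card : ℝ) < ρ b * (C b).card)) := by
    intro u hu
    rw [mem_union, mem_filter, mem_biUnion]
    by_cases h : ∀ b ∈ I, ρ b * (C b).card ≤ ((nb S u (C b)).card : ℝ)
    · exact Or.inl ⟨hu, h⟩
    · push Not at h
      obtain ⟨b, hb, h⟩ := h
      exact Or.inr ⟨b, hb, mem_filter.mpr ⟨hu, h⟩⟩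
  have h1 := (card_le_card hsub).trans (card_union_le _ _)
  have h2 : ((I.biUnion (fun b => C0.filter (fun u => ((nb S u (C b)).card : ℝ) < ρ b * (C b).card))).card : ℝ) ≤ I.card * s0 := by
    have := card_biUnion_le (s := I) (t := fun b => C0.filter (fun u => ((nb S u (C b)).card : ℝ) < ρ b * (C b).card))
    refine (Nat.cast_le.mpr this).trans ?_
    push_cast
    rw [← nsmul_eq_mul]
    exact sum_le_card_nsmul _ _ _ hb
  have h1' : (C0.card : ℝ) ≤ ((C0.filter (fun u => ∀ b ∈ I, ρ b * (C b).card ≤ ((nb S u (C b)).card : ℝ))).card : ℝ) + ((I.biUnion (fun b => C0.filter (fun u => ((nb S u (C b)).card : ℝ) < ρ b * (C b).card))).card : ℝ) := by exact_mod_cast h1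
  linarith

lemma emb (S : V → V → Prop) (hS : ∀ u v, S u v → S v u) (hirr : ∀ u, ¬ S u u) (s : ι → ℝ) {β : ℝ} (hβ0 : 0 < β) (hβ1 : β ≤ 1) :
    ∀ (m : ℕ) (I J : Finset ι) (C : ι → Finset V), m ≤ 7 → Disjoint I J → I.card + J.card = m →
    (∀ a ∈ I ∪ J, 0 < s a) →
    (∀ a ∈ I ∪ J, 10 * s a ≤ β^m * (C a).card) →
    (∀ a ∈ I ∪ J, ∀ b ∈ I ∪ J, a ≠ b → ∀ X ⊆ C a, ∀ Y ⊆ C b, s a ≤ (X.card : ℝ) → s b ≤ (Y.card : ℝ) →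
      β * (X.card * Y.card) ≤ (pc X Y S : ℝ)) →
    (∀ a ∈ J, ∀ b ∈ J, a ≠ b → ∀ X ⊆ C a, ∀ Y ⊆ C b, s a ≤ (X.card : ℝ) → s b ≤ (Y.card : ℝ) →
      (1+β)/2 * (X.card * Y.card) ≤ (pc X Y S : ℝ)) →
    (∀ a ∈ J, ∀ X ⊆ C a, s a ≤ (X.card : ℝ) → ∃ u ∈ X, ∃ v ∈ X, S u v) →
    ∃ Q : Finset V, Q.card = I.card + 2 * J.card ∧ (∀ u ∈ Q, ∃ a ∈ I ∪ J, u ∈ C a) ∧ ∀ u ∈ Q, ∀ v ∈ Q, u ≠ v → S u v := by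
  intro m
  induction m with
  | zero =>
    intro I J C _ _ hc _ _ _ _ _
    exact ⟨∅, by simp; omega, by simp, by simp⟩
  | succ m ih =>
    intro I J C hm hd hc hs hsz hden hden2 hdbl
    have hbm : β^(m+1) ≤ 1 := pow_le_one₀ hβ0.le hβ1
    have hsz1 : ∀ a ∈ I ∪ J, 10 * s a ≤ (C a).card := fun a ha => by
      have h1 := hsz a ha
      have h2 : β^(m+1) * ((C a).card : ℝ) ≤ 1 * (C a).card := mul_le_mul_of_nonneg_right hbm (Nat.cast_nonneg _)
      linarith
    have hm' : (m : ℝ) + 1 ≤ 7 := by exact_mod_cast hm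
    have next : ∀ (D : ι → Finset V) (K : Finset ι), K ⊆ I ∪ J → (∀ b ∈ K, D b ⊆ C b) →
        (∀ b ∈ K, β * (C b).card ≤ ((D b).card : ℝ)) → ∀ b ∈ K, 10 * s b ≤ β^m * (D b).card := by
      intro D K hK hDC hD b hb
      refine (hsz b (hK hb)).trans ?_
      rw [pow_succ, mul_assoc]
      exact mul_le_mul_of_nonneg_left (hD b hb) (by positivity)
    rcases I.eq_empty_or_nonempty with rfl | ⟨a, ha⟩
    · -- double step
      simp only [empty_union, card_empty, zero_add] at *
      have hJne : J.Nonempty := by rw [← card_pos]; omega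
      obtain ⟨a, ha⟩ := hJne
      have hcard : (J.erase a).card = m := by rw [card_erase_of_mem ha]; omega
      have hmem : ∀ b ∈ J.erase a, b ∈ J ∧ a ≠ b := fun b hb => ⟨mem_of_mem_erase hb, (ne_of_mem_erase hb).symm⟩
      have hty := typical S (J.erase a) (C a) C (s a) (fun _ => (1+β)/2) (hs a ha) (by
        intro b hb X hX hsX
        obtain ⟨hbJ, hab⟩ := hmem b hb
        refine hden2 a ha b hbJ hab X hX (C b) subset_rfl hsX ?_
        have := hsz1 b hbJ; have := hs b hbJ; linarith)
      rw [hcard] at hty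
      obtain ⟨u, hu, v, hv, huv⟩ := hdbl a ha _ (filter_subset _ _) (le_trans (by
        have h1 := hsz1 a ha; have h2 := hs a ha
        nlinarith) hty)
      rw [mem_filter] at hu hv
      have hcap : ∀ b ∈ J.erase a, β * (C b).card ≤ ((nb S u (nb S v (C b))).card : ℝ) := by
        intro b hb
        have h1 := hu.2 b hb
        have h2 := hv.2 b hb
        have h3 : nb S u (nb S v (C b)) = nb S u (C b) ∩ nb S v (C b) := by
          ext w; simp only [nb, mem_filter, mem_inter]; tauto
        have h4 := card_union_add_card_inter (nb S u (C b)) (nb S v (C b))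
        have h5 : (nb S u (C b) ∪ nb S v (C b)).card ≤ (C b).card := card_le_card (union_subset (filter_subset _ _) (filter_subset _ _))
        rw [h3]
        have h4' : ((nb S u (C b) ∪ nb S v (C b)).card : ℝ) + ((nb S u (C b) ∩ nb S v (C b)).card : ℝ) = (nb S u (C b)).card + (nb S v (C b)).card := by exact_mod_cast h4
        have h5' : ((nb S u (C b) ∪ nb S v (C b)).card : ℝ) ≤ (C b).card := by exact_mod_cast h5
        linarith
      have hsub : ∀ b, nb S u (nb S v (C b)) ⊆ C b := fun b => (filter_subset _ _).trans (filter_subset _ _)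
      obtain ⟨Q, hQ1, hQ2, hQ3⟩ := ih ∅ (J.erase a) (fun b => nb S u (nb S v (C b))) (by omega) (by simp) (by simpa using hcard)
        (fun b hb => hs b (hmem b (by simpa using hb)).1)
        (next _ _ (by rw [empty_union]; exact erase_subset _ _) (fun b _ => hsub b) (by simpa using hcap))
        (fun b hb c hc hbc X hX Y hY => hden b (hmem b (by simpa using hb)).1 c (hmem c (by simpa using hc)).1 hbc X (hX.trans (hsub _)) Y (hY.trans (hsub _)))
        (fun b hb c hc hbc X hX Y hY => hden2 b (hmem b hb).1 c (hmem c hc).1 hbc X (hX.trans (hsub _)) Y (hY.trans (hsub _)))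
        (fun b hb X hX => hdbl b (hmem b hb).1 X (hX.trans (hsub _)))
      have hQadj : ∀ w ∈ Q, S u w ∧ S v w := by
        intro w hw
        obtain ⟨b, _, hb⟩ := hQ2 w hw
        simp only [nb, mem_filter] at hb
        exact ⟨hb.2, hb.1.2⟩
      have hne : u ≠ v := by rintro rfl; exact hirr _ huv
      have hvQ : v ∉ Q := fun h => hirr _ (hQadj v h).2
      have huQ : u ∉ insert v Q := by
        rw [mem_insert]; rintro (h | h)
        · exact hne h
        · exact hirr _ (hQadj u h).1
      refine ⟨insert u (insert v Q), ?_, ?_, ?_⟩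
      · rw [card_insert_of_notMem huQ, card_insert_of_notMem hvQ, hQ1, hcard, hc, card_empty]; omega
      · intro w hw
        rw [mem_insert, mem_insert] at hw
        rcases hw with rfl | rfl | hw
        · exact ⟨a, ha, hu.1⟩
        · exact ⟨a, ha, hv.1⟩
        · obtain ⟨b, hb, hwb⟩ := hQ2 w hw
          exact ⟨b, (hmem b (by simpa using hb)).1, hsub b hwb⟩
      · intro w hw z hz hwz
        rw [mem_insert, mem_insert] at hw hz
        rcases hw with rfl | rfl | hw <;> rcases hz with rfl | rfl | hz
        · exact absurd rfl hwz
        · exact huv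
        · exact (hQadj z hz).1
        · exact hS _ _ huv
        · exact absurd rfl hwz
        · exact (hQadj z hz).2
        · exact hS _ _ (hQadj w hw).1
        · exact hS _ _ (hQadj w hw).2
        · exact hQ3 w hw z hz hwz
    · -- single step
      have haIJ : a ∈ I ∪ J := mem_union_left _ ha
      have haJ : a ∉ J := disjoint_left.mp hd ha
      set K := I.erase a ∪ J with hK
      have hdd : Disjoint (I.erase a) J := hd.mono_left (erase_subset _ _)
      have hIc : (I.erase a).card + 1 = I.card := by rw [card_erase_of_mem ha]; have := card_pos.mpr ⟨a, ha⟩; omega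
      have hcard : K.card = m := by rw [hK, card_union_of_disjoint hdd]; omega
      have hmem : ∀ b ∈ K, b ∈ I ∪ J ∧ a ≠ b := fun b hb => by
        rw [hK, mem_union] at hb
        rcases hb with hb | hb
        · exact ⟨mem_union_left _ (mem_of_mem_erase hb), (ne_of_mem_erase hb).symm⟩
        · exact ⟨mem_union_right _ hb, fun h => haJ (h ▸ hb)⟩
      have hty := typical S K (C a) C (s a) (fun _ => β) (hs a haIJ) (by
        intro b hb X hX hsX
        obtain ⟨hbJ, hab⟩ := hmem b hb
        refine hden a haIJ b hbJ hab X hX (C b) subset_rfl hsX ?_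
        have := hsz1 b hbJ; have := hs b hbJ; linarith)
      rw [hcard] at hty
      have hpos : (0:ℝ) < ((C a).filter (fun u => ∀ b ∈ K, β * (C b).card ≤ ((nb S u (C b)).card : ℝ))).card := by
        refine lt_of_lt_of_le ?_ hty
        have h1 := hsz1 a haIJ; have h2 := hs a haIJ
        nlinarith
      have hpos' : 0 < ((C a).filter (fun u => ∀ b ∈ K, β * (C b).card ≤ ((nb S u (C b)).card : ℝ))).card := by exact_mod_cast hpos
      obtain ⟨u, hu⟩ := card_pos.mp hpos'
      rw [mem_filter] at hu
      have hsub : ∀ b, nb S u (C b) ⊆ C b := fun b => filter_subset _ _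
      obtain ⟨Q, hQ1, hQ2, hQ3⟩ := ih (I.erase a) J (fun b => nb S u (C b)) (by omega) hdd (by omega)
        (fun b hb => hs b (hmem b hb).1)
        (next _ _ (fun b hb => (hmem b hb).1) (fun b _ => hsub b) hu.2)
        (fun b hb c hc hbc X hX Y hY => hden b (hmem b hb).1 c (hmem c hc).1 hbc X (hX.trans (hsub _)) Y (hY.trans (hsub _)))
        (fun b hb c hc hbc X hX Y hY => hden2 b hb c hc hbc X (hX.trans (hsub _)) Y (hY.trans (hsub _)))
        (fun b hb X hX => hdbl b hb X (hX.trans (hsub _)))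
      have hQadj : ∀ w ∈ Q, S u w := by
        intro w hw
        obtain ⟨b, _, hb⟩ := hQ2 w hw
        simp only [nb, mem_filter] at hb
        exact hb.2
      have huQ : u ∉ Q := fun h => hirr _ (hQadj u h)
      refine ⟨insert u Q, ?_, ?_, ?_⟩
      · rw [card_insert_of_notMem huQ, hQ1]; omega
      · intro w hw
        rw [mem_insert] at hw
        rcases hw with rfl | hw
        · exact ⟨a, haIJ, hu.1⟩
        · obtain ⟨b, hb, hwb⟩ := hQ2 w hw
          exact ⟨b, (hmem b hb).1, hsub b hwb⟩
      · intro w hw z hz hwz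
        rw [mem_insert] at hw hz
        rcases hw with rfl | hw <;> rcases hz with rfl | hz
        · exact absurd rfl hwz
        · exact hQadj z hz
        · exact hS _ _ (hQadj w hw)
        · exact hQ3 w hw z hz hwz
end embedding

open Finset

section proj
open Classical
variable {Ω K K' : Type*} [Fintype Ω]

/-- conditional average -/
noncomputable def avg (p : Ω → K) (f : Ω → ℝ) (w : Ω) : ℝ :=
  (∑ z ∈ univ.filter (fun z => p z = p w), f z) / ((univ.filter (fun z => p z = p w)).card : ℝ)

lemma avg_congr (p : Ω → K) (f : Ω → ℝ) {w w' : Ω} (h : p w = p w') : avg p f w = avg p f w' := by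
  unfold avg; rw [h]

lemma avg_ortho (p : Ω → K) (f φ : Ω → ℝ) (hφ : ∀ w w', p w = p w' → φ w = φ w') :
    ∑ w, avg p f w * φ w = ∑ w, f w * φ w := by
  have h1 : ∀ w, avg p f w * φ w = ∑ z, (if p z = p w then f z * φ z / ((univ.filter (fun y => p y = p z)).card : ℝ) else 0) := by
    intro w
    unfold avg
    rw [sum_filter, sum_div, sum_mul]
    refine sum_congr rfl fun z _ => ?_
    split_ifs with h
    · rw [hφ z w h, h]; ring
    · ring
  simp only [h1]
  rw [sum_comm]
  refine sum_congr rfl fun z _ => ?_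
  rw [← sum_filter, sum_const, nsmul_eq_mul]
  have h2 : univ.filter (fun w => p z = p w) = univ.filter (fun y => p y = p z) := filter_congr fun y _ => eq_comm
  rw [h2]
  have h3 : ((univ.filter (fun y => p y = p z)).card : ℝ) ≠ 0 := by
    have : 0 < (univ.filter (fun y => p y = p z)).card := card_pos.mpr ⟨z, by simp⟩
    positivity
  field_simp

lemma avg_pyth (p : Ω → K) (p' : Ω → K') (f : Ω → ℝ) (href : ∀ w w', p' w = p' w' → p w = p w') :
    ∑ w, avg p' f w ^ 2 = ∑ w, avg p f w ^ 2 + ∑ w, (avg p' f w - avg p f w)^2 := by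
  have h1 := avg_ortho p' f (avg p f) (fun w w' h => avg_congr p f (href w w' h))
  have h2 := avg_ortho p f (avg p f) (fun w w' h => avg_congr p f h)
  have h3 : ∀ w, (avg p' f w - avg p f w)^2 = avg p' f w ^ 2 - 2 * (avg p' f w * avg p f w) + avg p f w * avg p f w := fun w => by ring
  have h4 : ∀ w, avg p f w ^ 2 = avg p f w * avg p f w := fun w => by ring
  simp only [h3, sum_add_distrib, sum_sub_distrib, ← mul_sum]
  simp only [h4]
  rw [h1, h2]; ring

lemma avg_le (p : Ω → K) (f : Ω → ℝ) (h0 : ∀ w, 0 ≤ f w) (h1 : ∀ w, f w ≤ 1) :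
    ∑ w, avg p f w ^ 2 ≤ Fintype.card Ω := by
  have : ∀ w ∈ (univ : Finset Ω), avg p f w ^ 2 ≤ 1 := by
    intro w _
    have ha : 0 ≤ avg p f w := div_nonneg (sum_nonneg fun z _ => h0 z) (Nat.cast_nonneg _)
    have hb : avg p f w ≤ 1 := by
      unfold avg
      refine div_le_one_of_le₀ ?_ (Nat.cast_nonneg _)
      refine (sum_le_sum fun z _ => h1 z).trans ?_
      simp
    exact pow_le_one₀ ha hb
  refine (sum_le_card_nsmul _ _ _ this).trans ?_
  simp
end proj

section reg
open Classical
variable {V : Type*} [Fintype V]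

noncomputable def edens (R : V → V → Prop) (A B : Finset V) : ℝ := (pc A B R : ℝ) / (A.card * B.card)

def OneReg (ε : ℝ) (R : V → V → Prop) (A B : Finset V) : Prop :=
  ∀ X ⊆ A, ∀ Y ⊆ B, ε * A.card ≤ (X.card : ℝ) → ε * B.card ≤ (Y.card : ℝ) →
    (edens R A B - ε) * (X.card * Y.card) ≤ (pc X Y R : ℝ)

noncomputable def ind (R : V → V → Prop) (w : V × V) : ℝ := if R w.1 w.2 then 1 else 0

def pp {K : Type*} (π : V → K) (w : V × V) : K × K := (π w.1, π w.2)

noncomputable def En {K : Type*} (R : V → V → Prop) (π : V → K) : ℝ := ∑ w, avg (pp π) (ind R) w ^ 2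

lemma pc_eq_sum (R : V → V → Prop) (X Y : Finset V) : (pc X Y R : ℝ) = ∑ w ∈ X ×ˢ Y, ind R w := by
  rw [sum_product]
  unfold pc ind
  push_cast; rfl

lemma avg_dens {K : Type*} (R : V → V → Prop) (π : V → K) (w : V × V) :
    avg (pp π) (ind R) w = edens R (cell π (π w.1)) (cell π (π w.2)) := by
  have : @Finset.filter _ (fun z => pp π z = pp π w) (fun _ => Classical.propDecidable _) univ = cell π (π w.1) ×ˢ cell π (π w.2) := by
    ext z; simp [pp, mem_cell, Prod.ext_iff]
  unfold avg edens
  rw [this, pc_eq_sum, card_product]; push_cast; rfl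

lemma En_nonneg {K : Type*} (R : V → V → Prop) (π : V → K) : 0 ≤ En R π := sum_nonneg fun _ _ => sq_nonneg _

lemma En_le {K : Type*} (R : V → V → Prop) (π : V → K) : En R π ≤ (Fintype.card V : ℝ)^2 := by
  refine (avg_le _ _ ?_ ?_).trans ?_
  · intro w; unfold ind; split_ifs <;> norm_num
  · intro w; unfold ind; split_ifs <;> norm_num
  · rw [Fintype.card_prod]; push_cast; exact le_of_eq (sq _).symm

lemma En_gain {K K' : Type*} [Fintype K] (R : V → V → Prop) (π : V → K) (π' : V → K') {ε : ℝ} (hε : 0 < ε)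
    (href : ∀ u v, π' u = π' v → π u = π v) (X Y : K → K → Finset V)
    (hX : ∀ i j, X i j ⊆ cell π i) (hY : ∀ i j, Y i j ⊆ cell π j)
    (mX : ∀ i j u v, π' u = π' v → u ∈ X i j → v ∈ X i j)
    (mY : ∀ i j u v, π' u = π' v → u ∈ Y i j → v ∈ Y i j)
    (hXY : ∀ i j, ¬ OneReg ε R (cell π i) (cell π j) →
      ε * (cell π i).card ≤ ((X i j).card : ℝ) ∧ ε * (cell π j).card ≤ ((Y i j).card : ℝ) ∧
      (pc (X i j) (Y i j) R : ℝ) < (edens R (cell π i) (cell π j) - ε) * ((X i j).card * (Y i j).card)) :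
    En R π + ε^4 * pc univ univ (fun u v => ¬ OneReg ε R (cell π (π u)) (cell π (π v))) ≤ En R π' := by
  unfold En
  rw [avg_pyth (pp π) (pp π') (ind R) (by
    intro w w' h
    simp only [pp, Prod.mk.injEq] at h ⊢
    exact ⟨href _ _ h.1, href _ _ h.2⟩)]
  refine add_le_add le_rfl ?_
  set g : V × V → ℝ := fun w => avg (pp π') (ind R) w - avg (pp π) (ind R) w with hg
  have e1 : ∑ w, g w ^ 2 = ∑ i, ∑ j, ∑ w ∈ cell π i ×ˢ cell π j, g w ^ 2 := by
    rw [← sum_fiberwise univ (pp π) (fun w => g w ^ 2), Fintype.sum_prod_type]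
    refine sum_congr rfl fun i _ => sum_congr rfl fun j _ => sum_congr ?_ fun _ _ => rfl
    ext z; simp [pp, mem_cell]
  have e1' : ∑ w, (avg (pp π') (ind R) w - avg (pp π) (ind R) w)^2 = ∑ w, g w ^ 2 := rfl
  rw [e1', e1, pc_cells π]
  push_cast
  rw [mul_sum]
  refine sum_le_sum fun i _ => ?_
  rw [mul_sum]
  refine sum_le_sum fun j _ => ?_
  by_cases hreg : OneReg ε R (cell π i) (cell π j)
  · rw [pc_none]
    · simp only [Nat.cast_zero, mul_zero]; exact sum_nonneg fun _ _ => sq_nonneg _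
    · intro u hu v hv; rw [mem_cell] at hu hv; rw [hu, hv]; exact not_not.mpr hreg
  rw [pc_all (by intro u hu v hv; rw [mem_cell] at hu hv; rw [hu, hv]; exact hreg)]
  obtain ⟨h1, h2, h3⟩ := hXY i j hreg
  set Z := X i j ×ˢ Y i j with hZ
  have hZsub : Z ⊆ cell π i ×ˢ cell π j := product_subset_product (hX i j) (hY i j)
  have s1 : ∑ w ∈ Z, g w = pc (X i j) (Y i j) R - edens R (cell π i) (cell π j) * ((X i j).card * (Y i j).card) := by
    rw [hg, sum_sub_distrib]
    congr 1
    · have ho := avg_ortho (pp π') (ind R) (fun w => if w ∈ Z then 1 else 0) (by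
        intro w w' hw
        simp only [pp, Prod.mk.injEq] at hw
        have : w ∈ Z ↔ w' ∈ Z := by
          rw [hZ, mem_product, mem_product]
          exact ⟨fun h => ⟨mX _ _ _ _ hw.1 h.1, mY _ _ _ _ hw.2 h.2⟩, fun h => ⟨mX _ _ _ _ hw.1.symm h.1, mY _ _ _ _ hw.2.symm h.2⟩⟩
        simp only [this])
      simp only [mul_ite, mul_one, mul_zero] at ho
      rw [← sum_filter, ← sum_filter] at ho
      have hf : univ.filter (fun w => w ∈ Z) = Z := by ext; simp
      rw [hf] at ho
      rw [ho, pc_eq_sum]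
    · rw [sum_congr rfl (g := fun _ => edens R (cell π i) (cell π j))]
      · rw [sum_const, hZ, card_product, nsmul_eq_mul]; push_cast; ring
      · intro w hw
        have := mem_product.mp (hZsub hw)
        rw [mem_cell, mem_cell] at this
        rw [avg_dens, this.1, this.2]
  set xy : ℝ := ((X i j).card : ℝ) * (Y i j).card with hxy
  have hxy0 : 0 ≤ xy := by positivity
  have hpc0 : (0:ℝ) ≤ pc (X i j) (Y i j) R := Nat.cast_nonneg _
  have hxypos : 0 < xy := by
    rcases hxy0.eq_or_lt with h | h
    · rw [← h, mul_zero] at h3; linarith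
    · exact h
  have cs := sq_sum_le_card_mul_sum_sq (s := Z) (f := g)
  have hZc : (Z.card : ℝ) = xy := by rw [hZ, card_product]; push_cast; rfl
  rw [hZc] at cs
  have s2 : (ε * xy)^2 ≤ (∑ w ∈ Z, g w)^2 := by
    rw [s1, ← neg_sq (_ - _)]
    refine pow_le_pow_left₀ (by positivity) ?_ 2
    linarith
  have s3 : ε^2 * xy ≤ ∑ w ∈ Z, g w ^ 2 := by
    have : xy * (ε^2 * xy) ≤ xy * ∑ w ∈ Z, g w ^ 2 := by
      refine le_trans (le_of_eq ?_) (s2.trans cs); ring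
    exact le_of_mul_le_mul_left this hxypos
  have s4 : ε^2 * ((cell π i).card * (cell π j).card) ≤ xy := by
    have := mul_le_mul h1 h2 (by positivity) (by positivity)
    calc ε^2 * (((cell π i).card : ℝ) * (cell π j).card) = (ε * (cell π i).card) * (ε * (cell π j).card) := by ring
      _ ≤ _ := this
  have s5 : ∑ w ∈ Z, g w ^ 2 ≤ ∑ w ∈ cell π i ×ˢ cell π j, g w ^ 2 :=
    sum_le_sum_of_subset_of_nonneg hZsub fun _ _ _ => sq_nonneg _
  refine le_trans ?_ (s3.trans s5)
  have s6 := mul_le_mul_of_nonneg_left s4 (sq_nonneg ε)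
  refine le_trans (le_of_eq ?_) s6
  push_cast; ring

lemma witness {K : Type*} (R : V → V → Prop) (π : V → K) (ε : ℝ) : ∃ X Y : K → K → Finset V,
    (∀ i j, X i j ⊆ cell π i) ∧ (∀ i j, Y i j ⊆ cell π j) ∧
    (∀ i j, ¬ OneReg ε R (cell π i) (cell π j) →
      ε * (cell π i).card ≤ ((X i j).card : ℝ) ∧ ε * (cell π j).card ≤ ((Y i j).card : ℝ) ∧
      (pc (X i j) (Y i j) R : ℝ) < (edens R (cell π i) (cell π j) - ε) * ((X i j).card * (Y i j).card)) := by
  have : ∀ i j, ∃ X Y : Finset V, X ⊆ cell π i ∧ Y ⊆ cell π j ∧ (¬ OneReg ε R (cell π i) (cell π j) →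
      ε * (cell π i).card ≤ (X.card : ℝ) ∧ ε * (cell π j).card ≤ (Y.card : ℝ) ∧
      (pc X Y R : ℝ) < (edens R (cell π i) (cell π j) - ε) * (X.card * Y.card)) := by
    intro i j
    by_cases h : OneReg ε R (cell π i) (cell π j)
    · exact ⟨∅, ∅, by simp, by simp, fun h' => absurd h h'⟩
    · have h' := h
      unfold OneReg at h'
      push Not at h'
      obtain ⟨X, hX, Y, hY, h1, h2, h3⟩ := h'
      exact ⟨X, Y, hX, hY, fun _ => ⟨h1, h2, h3⟩⟩
  choose X Y h1 h2 h3 using this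
  exact ⟨X, Y, h1, h2, h3⟩

lemma step {k : ℕ} (R S : V → V → Prop) (π : V → Fin k) {ε : ℝ} (hε : 0 < ε) :
    ∃ k' : ℕ, k' = k * 16^(k*k) ∧ ∃ π' : V → Fin k', (∀ u v, π' u = π' v → π u = π v) ∧
      En R π + ε^4 * pc univ univ (fun u v => ¬ OneReg ε R (cell π (π u)) (cell π (π v))) ≤ En R π' ∧
      En S π + ε^4 * pc univ univ (fun u v => ¬ OneReg ε S (cell π (π u)) (cell π (π v))) ≤ En S π' := by
  obtain ⟨X, Y, hX, hY, hXY⟩ := witness R π ε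
  obtain ⟨X', Y', hX', hY', hXY'⟩ := witness S π ε
  let T := Fin k × (Fin k × Fin k → (Bool × Bool) × (Bool × Bool))
  have hT : Fintype.card T = k * 16^(k*k) := by
    simp [T]
  let π₀ : V → T := fun v => (π v, fun ij => ((decide (v ∈ X ij.1 ij.2), decide (v ∈ Y ij.1 ij.2)), (decide (v ∈ X' ij.1 ij.2), decide (v ∈ Y' ij.1 ij.2))))
  let E : T ≃ Fin (k * 16^(k*k)) := Fintype.equivFinOfCardEq hT
  have key : ∀ u v, E (π₀ u) = E (π₀ v) → π₀ u = π₀ v := fun u v h => E.injective h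
  have k1 : ∀ u v, π₀ u = π₀ v → π u = π v := fun u v h => congrArg Prod.fst h
  have k2 : ∀ i j u v, π₀ u = π₀ v → (u ∈ X i j ↔ v ∈ X i j) ∧ (u ∈ Y i j ↔ v ∈ Y i j) ∧ (u ∈ X' i j ↔ v ∈ X' i j) ∧ (u ∈ Y' i j ↔ v ∈ Y' i j) := by
    intro i j u v h
    have := congrFun (congrArg Prod.snd h) (i, j)
    simp only [π₀, Prod.mk.injEq, decide_eq_decide] at this
    tauto
  refine ⟨_, rfl, fun v => E (π₀ v), fun u v h => k1 u v (key u v h), ?_, ?_⟩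
  · exact En_gain R π _ hε (fun u v h => k1 u v (key u v h)) X Y hX hY
      (fun i j u v h => (k2 i j u v (key u v h)).1.mp) (fun i j u v h => (k2 i j u v (key u v h)).2.1.mp) hXY
  · exact En_gain S π _ hε (fun u v h => k1 u v (key u v h)) X' Y' hX' hY'
      (fun i j u v h => (k2 i j u v (key u v h)).2.2.1.mp) (fun i j u v h => (k2 i j u v (key u v h)).2.2.2.mp) hXY'
end reg

section reglemma
open Classical

lemma base_part {ε : ℝ} (hε : 0 < ε) : ∃ L N0 : ℕ, 0 < N0 ∧ ∀ n, N0 ≤ n → ∃ π : Fin n → Fin L,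
    (pc univ univ (fun u v => π u = π v) : ℝ) ≤ ε * n^2 := by
  obtain ⟨L, hL⟩ := exists_nat_gt (2/ε)
  have hL0 : 0 < L := by
    have : (0:ℝ) < L := lt_trans (by positivity) hL
    exact_mod_cast this
  refine ⟨L, L, hL0, fun n hn => ?_⟩
  set q := n / L + 1 with hq
  have hq0 : 0 < q := Nat.succ_pos _
  have hqL : n < q * L := by
    rw [hq]; have := Nat.div_add_mod n L; have := Nat.mod_lt n hL0; nlinarith
  obtain ⟨π, hπ⟩ : ∃ π : Fin n → Fin L, ∀ x, (π x).val = x.val / q :=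
    ⟨fun x => ⟨x.val / q, by rw [Nat.div_lt_iff_lt_mul hq0]; have := x.2; nlinarith⟩, fun x => rfl⟩
  refine ⟨π, ?_⟩
  have h1 : pc univ univ (fun u v => π u = π v) ≤ n * q := by
    unfold pc
    refine (sum_le_card_nsmul _ _ q (fun u _ => ?_)).trans (by simp)
    refine le_trans (le_of_eq (@card_filter _ (fun v => π u = π v) (fun _ => Classical.propDecidable _) univ).symm) ?_
    have hc : (Finset.Ico (u.val / q * q) (u.val / q * q + q)).card = q := by simp
    conv_rhs => rw [← hc]
    refine card_le_card_of_injOn (fun v => v.val) ?_ (fun a _ b _ h => Fin.ext h)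
    intro v hv
    have hv := ((@mem_filter _ (fun v => π u = π v) (fun _ => Classical.propDecidable _) univ v).mp hv).2
    have hv := congrArg Fin.val hv
    rw [hπ, hπ] at hv
    rw [mem_coe, mem_Ico, hv]
    have h1 := Nat.div_add_mod v.val q
    have h2 := Nat.mod_lt v.val hq0
    rw [mul_comm] at h1
    dsimp only
    omega
  refine (Nat.cast_le.mpr h1).trans ?_
  push_cast
  have hqr : (q:ℝ) ≤ n / L + 1 := by rw [hq]; push_cast; linarith [Nat.cast_div_le (α := ℝ) (m := n) (n := L)]
  have hLr : (0:ℝ) < L := by exact_mod_cast hL0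
  have hnL : (L:ℝ) ≤ n := by exact_mod_cast hn
  have h2 : (n:ℝ)/L ≤ ε/2 * n := by
    rw [div_le_iff₀ hLr]
    rw [div_lt_iff₀ hε] at hL
    nlinarith
  have h3 : (1:ℝ) ≤ ε/2 * n := by
    rw [div_lt_iff₀ hε] at hL
    nlinarith
  have hn0 : (0:ℝ) ≤ n := by positivity
  nlinarith

theorem regularity {ε : ℝ} (hε : 0 < ε) : ∃ M N0 : ℕ, 0 < N0 ∧ ∀ n, N0 ≤ n → ∀ R S : Fin n → Fin n → Prop,
    ∃ k ≤ M, ∃ π : Fin n → Fin k, (pc univ univ (fun u v => π u = π v) : ℝ) ≤ ε * n^2 ∧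
    (pc univ univ (fun u v => ¬ OneReg ε R (cell π (π u)) (cell π (π v)) ∨ ¬ OneReg ε S (cell π (π u)) (cell π (π v))) : ℝ) ≤ ε * n^2 := by
  obtain ⟨L, N0, hN0, hbase⟩ := base_part hε
  have it : ∀ m : ℕ, ∃ M : ℕ, ∀ n, N0 ≤ n → ∀ R S : Fin n → Fin n → Prop,
      ∃ k ≤ M, ∃ π : Fin n → Fin k, (pc univ univ (fun u v => π u = π v) : ℝ) ≤ ε * n^2 ∧
      ((pc univ univ (fun u v => ¬ OneReg ε R (cell π (π u)) (cell π (π v)) ∨ ¬ OneReg ε S (cell π (π u)) (cell π (π v))) : ℝ) ≤ ε * n^2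
        ∨ m * ε^5 * n^2 ≤ En R π + En S π) := by
    intro m
    induction m with
    | zero =>
      refine ⟨L, fun n hn R S => ?_⟩
      obtain ⟨π, hπ⟩ := hbase n hn
      refine ⟨L, le_rfl, π, hπ, Or.inr ?_⟩
      have := En_nonneg R π; have := En_nonneg S π
      push_cast; linarith
    | succ m ih =>
      obtain ⟨M, hM⟩ := ih
      refine ⟨max M (M * 16^(M*M)), fun n hn R S => ?_⟩
      obtain ⟨k, hk, π, hπ, hor⟩ := hM n hn R S
      by_cases hgood : (pc univ univ (fun u v => ¬ OneReg ε R (cell π (π u)) (cell π (π v)) ∨ ¬ OneReg ε S (cell π (π u)) (cell π (π v))) : ℝ) ≤ ε * n^2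
      · exact ⟨k, hk.trans (le_max_left _ _), π, hπ, Or.inl hgood⟩
      have hen := hor.resolve_left hgood
      obtain ⟨k', hk', π', href, g1, g2⟩ := step R S π hε
      refine ⟨k', ?_, π', ?_, Or.inr ?_⟩
      · rw [hk']
        refine le_trans ?_ (le_max_right _ _)
        exact Nat.mul_le_mul hk (Nat.pow_le_pow_right (by norm_num) (Nat.mul_le_mul hk hk))
      · refine le_trans (Nat.cast_le.mpr (pc_le fun u _ v _ h => href u v h)) hπ
      · push Not at hgood
        have h1 := pc_or (X := univ) (Y := univ) (fun u v => ¬ OneReg ε R (cell π (π u)) (cell π (π v))) (fun u v => ¬ OneReg ε S (cell π (π u)) (cell π (π v)))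
        have h1' : (pc univ univ (fun u v => ¬ OneReg ε R (cell π (π u)) (cell π (π v)) ∨ ¬ OneReg ε S (cell π (π u)) (cell π (π v))) : ℝ) ≤
          pc univ univ (fun u v => ¬ OneReg ε R (cell π (π u)) (cell π (π v))) + pc univ univ (fun u v => ¬ OneReg ε S (cell π (π u)) (cell π (π v))) := by exact_mod_cast h1
        have h2 := mul_le_mul_of_nonneg_left (hgood.le.trans h1') (by positivity : 0 ≤ ε^4)
        push_cast
        nlinarith
  obtain ⟨m, hm⟩ := exists_nat_gt (2/ε^5)
  obtain ⟨M, hM⟩ := it m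
  refine ⟨M, N0, hN0, fun n hn R S => ?_⟩
  obtain ⟨k, hk, π, hπ, hor⟩ := hM n hn R S
  refine ⟨k, hk, π, hπ, hor.resolve_right ?_⟩
  intro hcon
  have h1 := En_le R π
  have h2 := En_le S π
  rw [Fintype.card_fin] at h1 h2
  rw [div_lt_iff₀ (by positivity)] at hm
  have hn0 : (0:ℝ) < n := by exact_mod_cast (lt_of_lt_of_le hN0 hn)
  have : 2 * (n:ℝ)^2 < m * ε^5 * n^2 := mul_lt_mul_of_pos_right hm (by positivity)
  linarith
end reglemma

open Finset

section assembly
open Classical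
variable {V ι : Type*} [Fintype V] [Fintype ι]

lemma edens_symm {R : V → V → Prop} (hR : ∀ u v, R u v → R v u) (A B : Finset V) :
    edens R A B = edens R B A := by
  unfold edens
  rw [pc_comm hR, mul_comm]

lemma OneReg.symm {ε : ℝ} {R : V → V → Prop} (hR : ∀ u v, R u v → R v u) {A B : Finset V}
    (h : OneReg ε R A B) : OneReg ε R B A := by
  intro X hX Y hY h1 h2
  have := h Y hY X hX h2 h1
  rw [edens_symm hR, pc_comm hR, mul_comm (X.card : ℝ)]
  exact this

lemma OneReg.use {ε d : ℝ} {R : V → V → Prop} {A B : Finset V} (h : OneReg ε R A B)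
    (hd : d < edens R A B) {X Y : Finset V} (hX : X ⊆ A) (hY : Y ⊆ B)
    (h1 : ε * A.card ≤ X.card) (h2 : ε * B.card ≤ Y.card) :
    (d - ε) * (X.card * Y.card) ≤ (pc X Y R : ℝ) := by
  refine le_trans ?_ (h X hX Y hY h1 h2)
  exact mul_le_mul_of_nonneg_right (by linarith) (by positivity)

/-- good pair of clusters -/
def gd (ε c : ℝ) (R S : V → V → Prop) (π : V → ι) (i j : ι) : Prop :=
  i ≠ j ∧ OneReg ε R (cell π i) (cell π j) ∧ OneReg ε S (cell π i) (cell π j) ∧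
    c ≤ ((cell π i).card : ℝ) ∧ c ≤ ((cell π j).card : ℝ)

lemma gd.symm {ε c : ℝ} {R S : V → V → Prop} (hR : ∀ u v, R u v → R v u) (hS : ∀ u v, S u v → S v u)
    {π : V → ι} {i j : ι} (h : gd ε c R S π i j) : gd ε c R S π j i :=
  ⟨h.1.symm, h.2.1.symm hR, h.2.2.1.symm hS, h.2.2.2.2, h.2.2.2.1⟩

def rootC (δ' : ℝ) (R : V → V → Prop) (π : V → ι) (i : ι) : Prop :=
  ¬ ∃ X ⊆ cell π i, δ' * (cell π i).card ≤ (X.card : ℝ) ∧ ∀ u ∈ X, ∀ v ∈ X, ¬ R u v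

def rC (ε c d : ℝ) (R S : V → V → Prop) (π : V → ι) (i j : ι) : Prop :=
  gd ε c R S π i j ∧ d < edens R (cell π i) (cell π j)

def eC (ε c d : ℝ) (R S : V → V → Prop) (π : V → ι) (i j : ι) : Prop :=
  gd ε c R S π i j ∧ (d < edens R (cell π i) (cell π j) ∨ d < edens S (cell π i) (cell π j))

def hC (ε c d δ' : ℝ) (R S : V → V → Prop) (π : V → ι) (i j : ι) : Prop :=
  gd ε c R S π i j ∧ ¬ d < edens R (cell π i) (cell π j) ∧ d < edens S (cell π i) (cell π j) ∧
    edens S (cell π i) (cell π j) ≤ 1/2 + d ∧ ¬ rootC δ' R π i ∧ ¬ rootC δ' R π j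

lemma redS_of_reg {ε c d δ' β : ℝ} (E₁ E₂ : SimpleGraph V) (h3 : E₁.CliqueFree 3) (h7 : E₂.CliqueFree 7)
    (π : V → ι) (hε : 0 < ε) (hc : 0 < c) (hβ0 : 0 < β) (hβ1 : β ≤ 1) (hd : d = 2 * β) (hεβ : ε ≤ β)
    (hδ0 : 0 < δ') (hδ1 : δ' ≤ 1) (hδ : 10 * δ' ≤ β^2) (hεδ : 10 * ε ≤ β^7 * δ')
    (hind : ∀ X : Finset V, ε * c ≤ (X.card : ℝ) → ∃ u ∈ X, ∃ v ∈ X, E₁.Adj u v ∨ E₂.Adj u v) :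
    RedS (eC ε c d E₁.Adj E₂.Adj π) (rC ε c d E₁.Adj E₂.Adj π) (hC ε c d δ' E₁.Adj E₂.Adj π)
      (rootC δ' E₁.Adj π) := by
  have s1 : ∀ u v, E₁.Adj u v → E₁.Adj v u := fun u v h => h.symm
  have s2 : ∀ u v, E₂.Adj u v → E₂.Adj v u := fun u v h => h.symm
  have hb7 : ∀ m ≤ 7, β^7 ≤ β^m := fun m hm => pow_le_pow_of_le_one hβ0.le hβ1 hm
  have hb71 : β^7 ≤ 1 := pow_le_one₀ hβ0.le hβ1
  have hεδ' : ε ≤ δ' := by nlinarith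
  have noK : ∀ (E : SimpleGraph V) (m : ℕ), E.CliqueFree m → ∀ Q : Finset V, m ≤ Q.card →
      (∀ u ∈ Q, ∀ v ∈ Q, u ≠ v → E.Adj u v) → False := by
    intro E m hE Q hQ hcl
    obtain ⟨Q', hQ', hcard⟩ := exists_subset_card_eq hQ
    refine hE Q' ⟨?_, hcard⟩
    intro u hu v hv huv
    exact hcl u (hQ' hu) v (hQ' hv) huv
  refine ⟨?_, ?_, ?_, ?_, ?_, ?_, ?_, ?_, ?_, ?_, ?_⟩
  · rintro a b ⟨h1, h2⟩
    refine ⟨h1.symm s1 s2, ?_⟩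
    rwa [edens_symm s1, edens_symm s2]
  · rintro a b ⟨h1, h2⟩
    refine ⟨h1.symm s1 s2, ?_⟩
    rwa [edens_symm s1]
  · rintro a b ⟨h1, h2, h3, h4, h5, h6⟩
    refine ⟨h1.symm s1 s2, ?_, ?_, ?_, h6, h5⟩
    · rwa [edens_symm s1]
    · rwa [edens_symm s2]
    · rwa [edens_symm s2]
  · rintro a ⟨h1, -⟩
    exact h1.1 rfl
  · rintro a b ⟨h1, h2⟩
    exact ⟨h1, Or.inl h2⟩
  · rintro a b ⟨h1, h2, h3, -⟩
    exact ⟨h1, Or.inr h3⟩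
  · rintro a b ⟨h1, h2, -⟩ h
    exact h2 h.2
  · -- rR
    intro a b hab hRt
    have hab' : rC ε c d E₁.Adj E₂.Adj π b a := ⟨hab.1.symm s1 s2, by rw [edens_symm s1]; exact hab.2⟩
    have hne : a ≠ b := hab.1.1
    have key : ∀ x y : ι, rC ε c d E₁.Adj E₂.Adj π x y → ∀ X ⊆ cell π x, ∀ Y ⊆ cell π y,
        δ' * (cell π x).card ≤ (X.card : ℝ) → δ' * (cell π y).card ≤ (Y.card : ℝ) →
        β * (X.card * Y.card) ≤ (pc X Y E₁.Adj : ℝ) := by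
      intro x y hxy X hX Y hY h1 h2
      have := hxy.1.2.1.use hxy.2 hX hY ((mul_le_mul_of_nonneg_right hεδ' (by positivity)).trans h1)
        ((mul_le_mul_of_nonneg_right hεδ' (by positivity)).trans h2)
      refine le_trans (mul_le_mul_of_nonneg_right ?_ (by positivity)) this
      linarith
    have hca : ∀ x ∈ ({b} ∪ {a} : Finset ι), c ≤ ((cell π x).card : ℝ) := by
      intro x hx
      rcases mem_union.mp hx with h | h <;> rw [mem_singleton] at h <;> subst h
      · exact hab.1.2.2.2.2
      · exact hab.1.2.2.2.1
    obtain ⟨Q, hQ, -, hcl⟩ := emb E₁.Adj s1 (fun u => E₁.irrefl) (fun x => δ' * (cell π x).card) hβ0 hβ1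
      2 {b} {a} (cell π) (by norm_num) (by simpa using hne.symm) (by simp)
      (fun x hx => mul_pos hδ0 (lt_of_lt_of_le hc (hca x hx)))
      (fun x hx => by
        have := mul_le_mul_of_nonneg_right hδ (Nat.cast_nonneg (α := ℝ) (cell π x).card)
        linarith)
      (by
        intro x hx y hy hxy
        rcases mem_union.mp hx with h | h <;> rw [mem_singleton] at h <;>
          rcases mem_union.mp hy with h' | h' <;> rw [mem_singleton] at h' <;> subst h <;> subst h'
        · exact absurd rfl hxy
        · exact key _ _ hab'
        · exact key _ _ hab
        · exact absurd rfl hxy)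
      (by
        intro x hx y hy hxy
        rw [mem_singleton] at hx hy
        exact absurd (hx.trans hy.symm) hxy)
      (by
        intro x hx X hX hs
        rw [mem_singleton] at hx
        subst hx
        by_contra hcon
        push Not at hcon
        exact hRt ⟨X, hX, hs, hcon⟩)
    exact noK E₁ 3 h3 Q (by rw [hQ]; simp) hcl
  · rintro a b ⟨h1, h2, h3, h4, h5, h6⟩
    exact h5
  · -- notri
    intro a b e hab hbe hae
    have rs : ∀ x y, rC ε c d E₁.Adj E₂.Adj π x y → rC ε c d E₁.Adj E₂.Adj π y x := fun x y h =>
      ⟨h.1.symm s1 s2, by rw [edens_symm s1]; exact h.2⟩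
    have key : ∀ x y : ι, rC ε c d E₁.Adj E₂.Adj π x y → ∀ X ⊆ cell π x, ∀ Y ⊆ cell π y,
        ε * (cell π x).card ≤ (X.card : ℝ) → ε * (cell π y).card ≤ (Y.card : ℝ) →
        β * (X.card * Y.card) ≤ (pc X Y E₁.Adj : ℝ) := by
      intro x y hxy X hX Y hY h1 h2
      have := hxy.1.2.1.use hxy.2 hX hY h1 h2
      refine le_trans (mul_le_mul_of_nonneg_right ?_ (by positivity)) this
      linarith
    have hall : ∀ x ∈ ({a, b, e} : Finset ι), ∀ y ∈ ({a, b, e} : Finset ι), x ≠ y →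
        rC ε c d E₁.Adj E₂.Adj π x y := by
      intro x hx y hy hxy
      simp only [mem_insert, mem_singleton] at hx hy
      rcases hx with rfl | rfl | rfl <;> rcases hy with rfl | rfl | rfl <;>
        first
        | exact absurd rfl hxy
        | assumption
        | (apply rs; assumption)
    have hca : ∀ x ∈ ({a, b, e} : Finset ι), c ≤ ((cell π x).card : ℝ) := by
      intro x hx
      simp only [mem_insert, mem_singleton] at hx
      rcases hx with rfl | rfl | rfl
      · exact hab.1.2.2.2.1
      · exact hab.1.2.2.2.2
      · exact hbe.1.2.2.2.2
    have hcard : ({a, b, e} : Finset ι).card = 3 :=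
      card_eq_three.mpr ⟨a, b, e, hab.1.1, hae.1.1, hbe.1.1, rfl⟩
    obtain ⟨Q, hQ, -, hcl⟩ := emb E₁.Adj s1 (fun u => E₁.irrefl) (fun x => ε * (cell π x).card) hβ0 hβ1
      3 {a, b, e} ∅ (cell π) (by norm_num) (by simp) (by rw [hcard]; simp)
      (fun x hx => mul_pos hε (lt_of_lt_of_le hc (hca x (by rwa [union_empty] at hx))))
      (fun x hx => by
        have h1 : 10 * ε ≤ β^3 := by
          have := hb7 3 (by norm_num)
          have := mul_le_mul_of_nonneg_left hδ1 (by positivity : 0 ≤ β^7)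
          linarith
        have := mul_le_mul_of_nonneg_right h1 (Nat.cast_nonneg (α := ℝ) (cell π x).card)
        linarith)
      (by
        intro x hx y hy hxy
        rw [union_empty] at hx hy
        exact key _ _ (hall x hx y hy hxy))
      (by simp) (by simp)
    exact noK E₁ 3 h3 Q (by rw [hQ, hcard]; simp) hcl
  · -- clq
    have main : ∀ I J : Finset ι, Disjoint I J → I.card + J.card ≤ 7 → 2 ≤ I.card + J.card →
        (∀ a ∈ I ∪ J, ∀ b ∈ I ∪ J, a ≠ b → eC ε c d E₁.Adj E₂.Adj π a b ∧ ¬ rC ε c d E₁.Adj E₂.Adj π a b) →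
        (∀ a ∈ J, ¬ rootC δ' E₁.Adj π a) → (∀ a ∈ J, ∀ b ∈ J, ¬ hC ε c d δ' E₁.Adj E₂.Adj π a b) →
        I.card + 2 * J.card ≤ 6 := by
      intro I J hIJ hle hge hpair hJ hJh
      by_contra hgt
      have hca : ∀ x ∈ I ∪ J, c ≤ ((cell π x).card : ℝ) := by
        intro x hx
        have : 1 < (I ∪ J).card := by rw [card_union_of_disjoint hIJ]; omega
        obtain ⟨y, hy, hxy⟩ := exists_mem_ne this x
        exact (hpair x hx y hy hxy.symm).1.1.2.2.2.1
      have hCex : ∀ a, ∃ X ⊆ cell π a, (δ' * (cell π a).card ≤ (X.card : ℝ)) ∧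
          (a ∈ J → ∀ u ∈ X, ∀ v ∈ X, ¬ E₁.Adj u v) := by
        intro a
        by_cases ha : a ∈ J
        · have := hJ a ha
          unfold rootC at this
          rw [not_not] at this
          obtain ⟨X, hX, h1, h2⟩ := this
          exact ⟨X, hX, h1, fun _ => h2⟩
        · refine ⟨cell π a, subset_rfl, ?_, fun h => absurd h ha⟩
          exact mul_le_of_le_one_left (Nat.cast_nonneg _) hδ1
      choose C hCs hCc hCi using hCex
      have hblue : ∀ a ∈ I ∪ J, ∀ b ∈ I ∪ J, a ≠ b → d < edens E₂.Adj (cell π a) (cell π b) := by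
        intro a ha b hb hab
        obtain ⟨h1, h2⟩ := hpair a ha b hb hab
        rcases h1.2 with h | h
        · exact absurd ⟨h1.1, h⟩ h2
        · exact h
      obtain ⟨Q, hQ, -, hcl⟩ := emb E₂.Adj s2 (fun u => E₂.irrefl) (fun x => ε * (cell π x).card) hβ0 hβ1
        (I.card + J.card) I J C hle hIJ rfl
        (fun x hx => mul_pos hε (lt_of_lt_of_le hc (hca x hx)))
        (fun x hx => by
          have h1 := hb7 _ hle
          have h2 := mul_le_mul_of_nonneg_right hεδ (Nat.cast_nonneg (α := ℝ) (cell π x).card)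
          have h3 := mul_le_mul_of_nonneg_left (hCc x) (by positivity : 0 ≤ β^7)
          have h4 := mul_le_mul_of_nonneg_right h1 (Nat.cast_nonneg (α := ℝ) (C x).card)
          linarith)
        (by
          intro x hx y hy hxy X hX Y hY hs ht
          have := (hpair x hx y hy hxy).1.1.2.2.1.use (hblue x hx y hy hxy) (hX.trans (hCs x)) (hY.trans (hCs y)) hs ht
          refine le_trans (mul_le_mul_of_nonneg_right ?_ (by positivity)) this
          linarith)
        (by
          intro x hx y hy hxy X hX Y hY hs ht
          have hx' : x ∈ I ∪ J := mem_union_right _ hx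
          have hy' : y ∈ I ∪ J := mem_union_right _ hy
          obtain ⟨he, hr⟩ := hpair x hx' y hy' hxy
          have hdd : 1/2 + d < edens E₂.Adj (cell π x) (cell π y) := by
            by_contra hcon
            exact hJh x hx y hy ⟨he.1, fun h => hr ⟨he.1, h⟩, hblue x hx' y hy' hxy, not_lt.mp hcon,
              hJ x hx, hJ y hy⟩
          have := he.1.2.2.1.use hdd (hX.trans (hCs x)) (hY.trans (hCs y)) hs ht
          refine le_trans (mul_le_mul_of_nonneg_right ?_ (by positivity)) this
          linarith)
        (by
          intro x hx X hX hs
          have hcx := hca x (mem_union_right _ hx)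
          obtain ⟨u, hu, v, hv, huv⟩ := hind X ((mul_le_mul_of_nonneg_left hcx hε.le).trans hs)
          exact ⟨u, hu, v, hv, huv.resolve_left (hCi x hx u (hX hu) v (hX hv))⟩)
      exact noK E₂ 7 h7 Q (by rw [hQ]; omega) hcl
    intro S T hTS hpair hT hTh
    have hTc := card_le_card hTS
    by_cases hS2 : S.card ≤ 1
    · omega
    by_cases hS7 : 7 ≤ S.card
    · obtain ⟨S', hS', hc7⟩ := exists_subset_card_eq hS7
      have := main S' ∅ (by simp) (by simp [hc7]) (by simp [hc7])
        (by
          intro a ha b hb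
          rw [union_empty] at ha hb
          exact hpair a (hS' ha) b (hS' hb)) (by simp) (by simp)
      simp [hc7] at this
    · have hsd : (S \ T).card + T.card = S.card := card_sdiff_add_card_eq_card hTS
      have := main (S \ T) T sdiff_disjoint (by omega) (by omega)
        (by
          rw [sdiff_union_of_subset hTS]
          exact hpair) hT hTh
      omega
end assembly

open Finset

section final
open Classical

lemma low_dens {V ι : Type*} [Fintype V] [Fintype ι] (R : V → V → Prop) (π : V → ι) {d : ℝ} (hd : 0 ≤ d) :
    (pc univ univ (fun u v => R u v ∧ ¬ d < edens R (cell π (π u)) (cell π (π v))) : ℝ) ≤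
      d * (Fintype.card V : ℝ)^2 := by
  have hsum : (∑ i, ((cell π i).card : ℝ)) = Fintype.card V := by
    exact_mod_cast card_cells π
  rw [pc_cells π]
  push_cast
  rw [← hsum, pow_two, sum_mul_sum, mul_sum]
  refine sum_le_sum fun i _ => ?_
  rw [mul_sum]
  refine sum_le_sum fun j _ => ?_
  by_cases hlow : d < edens R (cell π i) (cell π j)
  · rw [pc_none]
    · push_cast; positivity
    · intro u hu v hv h
      rw [mem_cell] at hu hv
      rw [hu, hv] at h
      exact h.2 hlow
  · have h1 : (pc (cell π i) (cell π j) (fun u v => R u v ∧ ¬ d < edens R (cell π (π u)) (cell π (π v))) : ℝ) ≤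
        pc (cell π i) (cell π j) R := by
      refine Nat.cast_le.mpr (pc_le ?_)
      intro u _ v _ h
      exact h.1
    refine h1.trans ?_
    rw [not_lt] at hlow
    unfold edens at hlow
    by_cases h0 : ((cell π i).card : ℝ) * (cell π j).card = 0
    · have h2 : (pc (cell π i) (cell π j) R : ℝ) ≤ ((cell π i).card : ℝ) * (cell π j).card := by
        exact_mod_cast pc_le_card R
      rw [h0] at h2 ⊢
      linarith
    · have h0' : 0 < ((cell π i).card : ℝ) * (cell π j).card := lt_of_le_of_ne (by positivity) (Ne.symm h0)
      rwa [div_le_iff₀ h0'] at hlow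

lemma tiny_mass {V ι : Type*} [Fintype V] [Fintype ι] (π : V → ι) {c : ℝ} (hc : 0 ≤ c) :
    ((univ.filter (fun u => ((cell π (π u)).card : ℝ) < c)).card : ℝ) ≤ Fintype.card ι * c := by
  rw [card_eq_sum_card_fiberwise (f := π) (t := univ) (fun _ _ => mem_coe.mpr (mem_univ _))]
  push_cast
  have : (Fintype.card ι : ℝ) * c = ∑ _i : ι, c := by simp
  rw [this]
  refine sum_le_sum fun i _ => ?_
  by_cases h : ((cell π i).card : ℝ) < c
  · refine le_trans ?_ h.le
    refine Nat.cast_le.mpr (card_le_card fun u hu => ?_)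
    rw [mem_cell]
    exact (mem_filter.mp hu).2
  · rw [filter_eq_empty_iff.mpr]
    · simpa using hc
    · intro u hu hui
      rw [mem_filter] at hu
      rw [hui] at hu
      exact h hu.2

theorem close_of_adm : ∀ η : ℝ, 0 < η → ∃ δ : ℝ, 0 < δ ∧ δ ≤ η ∧ ∃ N : ℕ, 0 < N ∧ ∀ n : ℕ, N ≤ n →
    ∀ G : SimpleGraph (Fin n), Adm δ G → Close8 η G := by
  intro η hη
  obtain ⟨κ, hκ0, hκη, hκ1⟩ : ∃ κ : ℝ, 0 < κ ∧ 40000 * κ ≤ η ∧ κ ≤ 1/2000 :=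
    ⟨min (η/40000) (1/2000), lt_min (by positivity) (by norm_num),
      by linarith [min_le_left (η/40000) (1/2000)], min_le_right _ _⟩
  obtain ⟨β, hβ⟩ : ∃ β : ℝ, β = κ/20 := ⟨_, rfl⟩
  have hβ0 : 0 < β := by rw [hβ]; positivity
  have hβ1 : β ≤ 1 := by rw [hβ]; linarith
  obtain ⟨d, hd⟩ : ∃ d : ℝ, d = 2 * β := ⟨_, rfl⟩
  obtain ⟨δ', hδ'⟩ : ∃ δ' : ℝ, δ' = β^2/10 := ⟨_, rfl⟩
  have hδ0 : 0 < δ' := by rw [hδ']; positivity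
  have hδ1 : δ' ≤ 1 := by rw [hδ']; nlinarith
  obtain ⟨ε, hε⟩ : ∃ ε : ℝ, ε = β^7 * δ' / 10 := ⟨_, rfl⟩
  have hε0 : 0 < ε := by rw [hε]; positivity
  have hεβ : ε ≤ β := by
    have h1 : β^7 ≤ β^1 := pow_le_pow_of_le_one hβ0.le hβ1 (by norm_num)
    rw [pow_one] at h1
    have h2 := mul_le_mul_of_nonneg_left hδ1 (by positivity : 0 ≤ β^7)
    rw [hε]; linarith
  obtain ⟨M, N0, hN0, hreg⟩ := regularity hε0
  obtain ⟨μ, hμ⟩ : ∃ μ : ℝ, μ = ε/(M+1) := ⟨_, rfl⟩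
  have hμ0 : 0 < μ := by rw [hμ]; positivity
  have hμM : (M:ℝ) * μ ≤ ε := by
    have : μ * (M+1) = ε := by rw [hμ]; field_simp
    linarith
  refine ⟨min κ (ε*μ/2), lt_min hκ0 (by positivity), (min_le_left _ _).trans (by linarith), N0, hN0, ?_⟩
  intro n hn G hG
  have hn0 : (0:ℝ) < n := by exact_mod_cast (lt_of_lt_of_le hN0 hn)
  obtain ⟨E₁, E₂, hsup, -, h3, h7⟩ := hG.col
  have hadj : ∀ u v, G.Adj u v ↔ E₁.Adj u v ∨ E₂.Adj u v := by
    intro u v; rw [← hsup, SimpleGraph.sup_adj]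
  obtain ⟨k, hkM, π, hπ, hirr⟩ := hreg n hn E₁.Adj E₂.Adj
  have hkM' : (k:ℝ) ≤ M := by exact_mod_cast hkM
  have D := redS_of_reg (ε := ε) (c := μ * n) (d := d) (δ' := δ') (β := β) E₁ E₂ h3 h7 π hε0
    (by positivity) hβ0 hβ1 hd hεβ hδ0 hδ1 (by rw [hδ']; linarith) (by rw [hε]; linarith)
    (by
      intro X hX
      by_contra hcon
      push Not at hcon
      have h1 := hG.ind X (fun x hx y hy _ h => by
        rw [hadj] at h
        rcases h with h | h
        · exact (hcon x hx y hy).1 h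
        · exact (hcon x hx y hy).2 h)
      have h2 : min κ (ε*μ/2) * n ≤ ε*μ/2 * n := mul_le_mul_of_nonneg_right (min_le_right _ _) hn0.le
      have h3 : 0 < ε * μ * n := by positivity
      linarith)
  have hclose := close_of_reduced G π D hκ0.le hκ1 ?_ ?_ ?_
  · obtain ⟨c, hc⟩ := hclose
    exact ⟨c, hc.trans (mul_le_mul_of_nonneg_right hκη (by positivity))⟩
  · -- bad pairs
    set P1 : Fin n → Fin n → Prop := fun u v => π u = π v with hP1
    set P2 : Fin n → Fin n → Prop := fun u v => ¬ OneReg ε E₁.Adj (cell π (π u)) (cell π (π v)) ∨ ¬ OneReg ε E₂.Adj (cell π (π u)) (cell π (π v)) with hP2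
    set P3 : Fin n → Fin n → Prop := fun u _ => ((cell π (π u)).card : ℝ) < μ * n with hP3
    set P4 : Fin n → Fin n → Prop := fun _ v => ((cell π (π v)).card : ℝ) < μ * n with hP4
    set P5 : Fin n → Fin n → Prop := fun u v => E₁.Adj u v ∧ ¬ d < edens E₁.Adj (cell π (π u)) (cell π (π v)) with hP5
    set P6 : Fin n → Fin n → Prop := fun u v => E₂.Adj u v ∧ ¬ d < edens E₂.Adj (cell π (π u)) (cell π (π v)) with hP6
    have b5 := low_dens E₁.Adj π (d := d) (by rw [hd]; positivity)
    have b6 := low_dens E₂.Adj π (d := d) (by rw [hd]; positivity)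
    rw [Fintype.card_fin] at b5 b6
    have tm := tiny_mass π (c := μ * n) (by positivity)
    rw [Fintype.card_fin] at tm
    have tm' : ((univ.filter (fun u => ((cell π (π u)).card : ℝ) < μ * n)).card : ℝ) * n ≤ ε * n^2 := by
      have h1 : (k:ℝ) * (μ * n) ≤ ε * n := by
        have : (k:ℝ) * μ ≤ M * μ := mul_le_mul_of_nonneg_right hkM' hμ0.le
        nlinarith
      have := mul_le_mul_of_nonneg_right (tm.trans h1) hn0.le
      linarith
    have b3 : (pc univ univ P3 : ℝ) ≤ ε * n^2 := by
      rw [hP3, pc_left (fun u => ((cell π (π u)).card : ℝ) < μ * n), Fintype.card_fin]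
      push_cast; exact tm'
    have b4 : (pc univ univ P4 : ℝ) ≤ ε * n^2 := by
      rw [hP4, pc_right (fun u => ((cell π (π u)).card : ℝ) < μ * n), Fintype.card_fin]
      push_cast; exact tm'
    have hle : pc univ univ (fun u v => G.Adj u v ∧ ¬ eC ε (μ * n) d E₁.Adj E₂.Adj π (π u) (π v)) ≤
        pc univ univ (fun u v => P1 u v ∨ P2 u v ∨ P3 u v ∨ P4 u v ∨ P5 u v ∨ P6 u v) := by
      refine pc_le fun u _ v _ h => ?_
      obtain ⟨h1, h2⟩ := h
      by_contra hcon
      simp only [not_or] at hcon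
      obtain ⟨c1, c2, c3, c4, c5, c6⟩ := hcon
      simp only [hP2, not_or, not_not] at c2
      simp only [hP5, not_and, not_not] at c5
      simp only [hP6, not_and, not_not] at c6
      refine h2 ⟨⟨c1, c2.1, c2.2, not_lt.mp c3, not_lt.mp c4⟩, ?_⟩
      rcases (hadj u v).mp h1 with h | h
      · exact Or.inl (c5 h)
      · exact Or.inr (c6 h)
    have o1 := pc_or (X := univ) (Y := univ) P1 (fun u v => P2 u v ∨ P3 u v ∨ P4 u v ∨ P5 u v ∨ P6 u v)
    have o2 := pc_or (X := univ) (Y := univ) P2 (fun u v => P3 u v ∨ P4 u v ∨ P5 u v ∨ P6 u v)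
    have o3 := pc_or (X := univ) (Y := univ) P3 (fun u v => P4 u v ∨ P5 u v ∨ P6 u v)
    have o4 := pc_or (X := univ) (Y := univ) P4 (fun u v => P5 u v ∨ P6 u v)
    have o5 := pc_or (X := univ) (Y := univ) P5 P6
    have tot : pc univ univ (fun u v => G.Adj u v ∧ ¬ eC ε (μ * n) d E₁.Adj E₂.Adj π (π u) (π v)) ≤
        pc univ univ P1 + (pc univ univ P2 + (pc univ univ P3 + (pc univ univ P4 + (pc univ univ P5 + pc univ univ P6)))) := by
      linarith
    have tot' : (pc univ univ (fun u v => G.Adj u v ∧ ¬ eC ε (μ * n) d E₁.Adj E₂.Adj π (π u) (π v)) : ℝ) ≤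
        pc univ univ P1 + (pc univ univ P2 + (pc univ univ P3 + (pc univ univ P4 + (pc univ univ P5 + pc univ univ P6)))) := by
      exact_mod_cast tot
    have hfin : (4 * ε + 2 * d) * (n:ℝ)^2 ≤ κ * n^2 :=
      mul_le_mul_of_nonneg_right (by rw [hd]; linarith) (by positivity)
    linarith
  · -- half-dense pairs
    rintro i j ⟨hg, hr, -, hb, -, -⟩
    have hci : 0 < ((cell π i).card : ℝ) := lt_of_lt_of_le (by positivity) hg.2.2.2.1
    have hcj : 0 < ((cell π j).card : ℝ) := lt_of_lt_of_le (by positivity) hg.2.2.2.2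
    have hm := mul_pos hci hcj
    rw [not_lt] at hr
    unfold edens at hr hb
    rw [div_le_iff₀ hm] at hr hb
    have h1 : pc (cell π i) (cell π j) G.Adj ≤ pc (cell π i) (cell π j) E₁.Adj + pc (cell π i) (cell π j) E₂.Adj :=
      (pc_le fun u _ v _ h => (hadj u v).mp h).trans (pc_or _ _)
    have h1' : (pc (cell π i) (cell π j) G.Adj : ℝ) ≤ pc (cell π i) (cell π j) E₁.Adj + pc (cell π i) (cell π j) E₂.Adj := by
      exact_mod_cast h1
    have h2 : (1/2 + 2 * d) * (((cell π i).card : ℝ) * (cell π j).card) ≤ (1/2 + κ) * (((cell π i).card : ℝ) * (cell π j).card) :=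
      mul_le_mul_of_nonneg_right (by rw [hd]; linarith) hm.le
    linarith
  · refine le_trans (mul_le_mul_of_nonneg_right ?_ (by positivity)) hG.edge
    linarith [min_le_left κ (ε*μ/2)]
end final



/-- Weak stability for RT(n,3,7,o(n)): any two near-extremal (K₃,K₇)-free graphs with small
independence number are within edit distance εn² of each other (up to relabelling). -/
theorem rt_3_7_weak_stability :
    ∀ ε : ℝ, 0 < ε → ∃ δ : ℝ, 0 < δ ∧ ∃ N : ℕ, 0 < N ∧
      ∀ n : ℕ, N ≤ n → ∀ G G' : SimpleGraph (Fin n),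
        (∀ s : Finset (Fin n),
            (∀ x ∈ s, ∀ y ∈ s, x ≠ y → ¬ G.Adj x y) → (s.card : ℝ) ≤ δ * n) →
        (∃ E₁ E₂ : SimpleGraph (Fin n),
            E₁ ⊔ E₂ = G ∧ E₁ ⊓ E₂ = ⊥ ∧ E₁.CliqueFree 3 ∧ E₂.CliqueFree 7) →
        (7 / 16 - δ) * n ^ 2 ≤ (G.edgeSet.ncard : ℝ) →
        (∀ s : Finset (Fin n),
            (∀ x ∈ s, ∀ y ∈ s, x ≠ y → ¬ G'.Adj x y) → (s.card : ℝ) ≤ δ * n) →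
        (∃ E₁ E₂ : SimpleGraph (Fin n),
            E₁ ⊔ E₂ = G' ∧ E₁ ⊓ E₂ = ⊥ ∧ E₁.CliqueFree 3 ∧ E₂.CliqueFree 7) →
        (7 / 16 - δ) * n ^ 2 ≤ (G'.edgeSet.ncard : ℝ) →
        ∃ σ : Fin n ≃ Fin n,
          ((symmDiff G'.edgeSet (Sym2.map σ '' G.edgeSet)).ncard : ℝ) ≤ ε * n ^ 2 := by
  intro ε hε
  obtain ⟨δ, hδ, N, hN, H⟩ := main_of_close close_of_adm ε hε
  refine ⟨δ, hδ, N, hN, ?_⟩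
  intro n hn G G' h1 h2 h3 h4 h5 h6
  exact H n hn G G' ⟨h1, h2, h3⟩ ⟨h4, h5, h6⟩
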